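/- Let n ≤ 3, let P ⊂ ℝ^n be a compact flat polyhedron whose support is an n-manifold with boundary, and let K₁ and K₂ be simplicial triangulations of P that induce the same triangulation of ∂P. Then K₁ and K₂ are related by a finite sequence of geometric bistellar moves, each of which keeps the triangulation of the boundary fixed (no derived subdivisions are needed). -/

import Mathlib

open Set
open scoped Classical

variable {E : Type*} [NormedAddCommGroup E] [NormedSpace ℝ E]

/-- `K'` is a subdivision of `K`: same support, and every simplex of `K'` is contained in
some simplex of `K`. -/
def IsSubdivision (K' K : Geometry.SimplicialComplex ℝ E) : Prop :=
  K'.space = K.space ∧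
    ∀ s ∈ K'.faces, ∃ t ∈ K.faces, convexHull ℝ (s : Set E) ⊆ convexHull ℝ (t : Set E)

/-- `K'` is a derived subdivision of `K`: for each simplex `A` of `K` an interior point `b A`
(in the relative interior of its convex hull; for a vertex this forces `b {x} = x`) is chosen,
and the simplices of `K'` are exactly the convex hulls of the sets `{b A₀, …, b Aₖ}` for chains
`A₀ ⊊ ⋯ ⊊ Aₖ` of simplices of `K`. -/
def IsDerivedSubdivision (K' K : Geometry.SimplicialComplex ℝ E) : Prop :=
  ∃ b : Finset E → E,
    (∀ s ∈ K.faces, b s ∈ intrinsicInterior ℝ (convexHull ℝ (s : Set E))) ∧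
    K'.faces = {S | ∃ T : Finset (Finset E), ↑T ⊆ K.faces ∧ T.Nonempty ∧
      (∀ A ∈ T, ∀ B ∈ T, A ⊆ B ∨ B ⊆ A) ∧ S = T.image b}

/-- `K'` is an `s`-fold iterated derived subdivision of `K`. -/
def IsIterDerived : ℕ → Geometry.SimplicialComplex ℝ E → Geometry.SimplicialComplex ℝ E → Prop
  | 0, K', K => K' = K
  | (s + 1), K', K => ∃ K'', IsIterDerived s K'' K ∧ IsDerivedSubdivision K' K''

/-- The geometric bistellar move `κ(A,B)` on an `n`-dimensional complex: `A` is a simplex of `K`,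
`B` is a simplex not in `K` with `dim A + dim B = n` (i.e. `card A + card B = n + 2`), the link
of `A` in `K` is the boundary complex of `B`, and `K'` is obtained from `K` by replacing
`A ⋆ ∂B` (the simplices containing `A`) with `∂A ⋆ B`; the result is again a geometric
simplicial complex with the same support. -/
def BistellarMove (n : ℕ) (K K' : Geometry.SimplicialComplex ℝ E) : Prop :=
  ∃ A B : Finset E, A ∈ K.faces ∧ B ∉ K.faces ∧ B.Nonempty ∧
    A.card + B.card = n + 2 ∧
    {C : Finset E | C.Nonempty ∧ Disjoint A C ∧ A ∪ C ∈ K.faces} =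
      {C : Finset E | C.Nonempty ∧ C ⊂ B} ∧
    K'.faces = (K.faces \ {s | A ⊆ s}) ∪ {s | ∃ A' : Finset E, A' ⊂ A ∧ s = A' ∪ B} ∧
    K'.space = K.space

/-- `h` is a regular function for the triangulation `K` of a flat `d`-dimensional polyhedron:
it is affine on each simplex of `K` and strictly convex across each codimension-one simplex,
i.e. for `x`, `y` in distinct `d`-simplices sharing a common `(d-1)`-face, the open segment
from `(x, h x)` to `(y, h y)` lies strictly above the graph of `h`. -/
def IsRegularFunction (d : ℕ) (K : Geometry.SimplicialComplex ℝ E) (h : E → ℝ) : Prop :=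
  (∀ s ∈ K.faces, ∃ g : E →ᵃ[ℝ] ℝ, ∀ x ∈ convexHull ℝ (s : Set E), h x = g x) ∧
  (∀ σ ∈ K.faces, ∀ σ' ∈ K.faces, σ ≠ σ' → σ.card = d + 1 → σ'.card = d + 1 →
    (σ ∩ σ').card = d →
    ∀ x ∈ convexHull ℝ (σ : Set E), ∀ y ∈ convexHull ℝ (σ' : Set E),
      ∀ t : ℝ, t ∈ Set.Ioo (0 : ℝ) 1 → (1 - t) • x + t • y ∈ K.space →
        h ((1 - t) • x + t • y) < (1 - t) * h x + t * h y)

/-- `K` is a regular triangulation (of a flat `d`-dimensional polyhedron). -/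
def IsRegularTriangulation (d : ℕ) (K : Geometry.SimplicialComplex ℝ E) : Prop :=
  ∃ h : E → ℝ, IsRegularFunction d K h

/-- `P` is strictly star-convex: there is an interior point `x` such that for every `y ∈ P`
the open segment from `x` to `y` lies in the interior of `P`. -/
def StrictlyStarConvex (P : Set E) : Prop :=
  ∃ x ∈ interior P, ∀ y ∈ P, ∀ t ∈ Set.Ioo (0 : ℝ) 1, (1 - t) • x + t • y ∈ interior P

set_option linter.unusedSectionVars false

namespace GeoFlip

/-- Homogenization of a point. -/
def hom (x : E) : E × ℝ := (x, 1)

/-- Weighted sum of homogenized points. -/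
noncomputable def Φ : (E →₀ ℝ) →ₗ[ℝ] E × ℝ := Finsupp.linearCombination ℝ hom

/-- The weight equal to one on `f` and zero elsewhere. -/
noncomputable def ind (f : Finset E) : E →₀ ℝ := Finsupp.indicator f (fun _ _ => 1)

lemma ind_apply (f : Finset E) (x : E) : ind f x = if x ∈ f then 1 else 0 := by
  simp [ind, Finsupp.indicator_apply]

lemma ind_nonneg (f : Finset E) : 0 ≤ ind f := fun x => by
  rw [ind_apply]; split_ifs <;> simp

lemma ind_support (f : Finset E) : (ind f).support = f := by
  ext x; simp [ind_apply]

lemma Φ_single (x : E) (t : ℝ) : Φ (Finsupp.single x t) = t • hom x := by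
  simp [Φ]

lemma Φ_eq_sum {w : E →₀ ℝ} {s : Finset E} (h : w.support ⊆ s) :
    Φ w = ∑ x ∈ s, w x • hom x := by
  rw [Φ, Finsupp.linearCombination_apply, Finsupp.sum_of_support_subset _ h]
  simp

/-- A finite family of finite sets (with the empty set) which are the faces of a geometric
complex, stated through uniqueness of nonnegative weights. -/
structure Geo (F : Finset (Finset E)) : Prop where
  empty : ∅ ∈ F
  down : ∀ f ∈ F, ∀ g ⊆ f, g ∈ F
  inj : ∀ w v : E →₀ ℝ, 0 ≤ w → 0 ≤ v → w.support ∈ F → v.support ∈ F → Φ w = Φ v → w = v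

/-- A multiple of the indicator of `f` makes any weight nonnegative on `f`. -/
lemma exists_add_ind_nonneg (f : Finset E) (u : E →₀ ℝ) (hu : ∀ x ∉ f, 0 ≤ u x) :
    ∃ K : ℝ, 0 ≤ K ∧ ∀ t ≥ K, 0 ≤ u + t • ind f := by
  refine ⟨∑ x ∈ f, |u x|, Finset.sum_nonneg fun _ _ => abs_nonneg _, fun t ht x => ?_⟩
  by_cases hx : x ∈ f
  · have := Finset.single_le_sum (f := fun x => |u x|) (fun _ _ => abs_nonneg _) hx
    have h2 := neg_abs_le (u x)
    simp [ind_apply, hx] at *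
    linarith
  · simpa [ind_apply, hx] using hu x hx

lemma support_add_smul_ind (f : Finset E) (u : E →₀ ℝ) (t : ℝ) :
    (u + t • ind f).support ⊆ u.support ∪ f := by
  intro x hx
  by_contra h
  simp only [Finset.mem_union, not_or, Finsupp.mem_support_iff, not_not] at h
  simp [ind_apply, h.1, h.2] at hx

namespace Geo

variable {F : Finset (Finset E)}

/-- Weights that are nonnegative off `f` are determined by their sum. -/
lemma inj_off (hF : Geo F) (f : Finset E) {u u' : E →₀ ℝ} (hu : ∀ x ∉ f, 0 ≤ u x)
    (hu' : ∀ x ∉ f, 0 ≤ u' x) (h : u.support ∪ f ∈ F) (h' : u'.support ∪ f ∈ F)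
    (e : Φ u = Φ u') : u = u' := by
  obtain ⟨K, -, hK⟩ := exists_add_ind_nonneg f u hu
  obtain ⟨K', -, hK'⟩ := exists_add_ind_nonneg f u' hu'
  have := hF.inj (u + (max K K') • ind f) (u' + (max K K') • ind f) (hK _ (le_max_left _ _))
    (hK' _ (le_max_right _ _)) (hF.down _ h _ (support_add_smul_ind _ _ _))
    (hF.down _ h' _ (support_add_smul_ind _ _ _)) (by rw [map_add, map_add, e])
  exact add_right_cancel this

/-- Signed weights on a face are determined by their sum. -/
lemma inj_on (hF : Geo F) {f : Finset E} (hf : f ∈ F) {u u' : E →₀ ℝ} (h : u.support ⊆ f)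
    (h' : u'.support ⊆ f) (e : Φ u = Φ u') : u = u' :=
  hF.inj_off f (fun x hx => by simp [Finsupp.notMem_support_iff.1 fun hx' => hx (h hx')])
    (fun x hx => by simp [Finsupp.notMem_support_iff.1 fun hx' => hx (h' hx')])
    (by rwa [Finset.union_eq_right.2 h]) (by rwa [Finset.union_eq_right.2 h']) e

lemma linearIndepOn (hF : Geo F) {f : Finset E} (hf : f ∈ F) :
    LinearIndepOn ℝ hom (f : Set E) := by
  rw [linearIndepOn_iff]
  intro l hl h0
  refine hF.inj_on hf (u := l) (u' := 0) ?_ (by simp) (by simpa [Φ] using h0)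
  exact_mod_cast (Finsupp.mem_supported ℝ l).1 hl

end Geo

/-- The size of full-dimensional simplices. -/
noncomputable def topCard (E : Type*) [NormedAddCommGroup E] [NormedSpace ℝ E] : ℕ :=
  Module.finrank ℝ (E × ℝ)

/-- The barycentric coordinates of `v` with respect to `ρ`, if `ρ` spans. -/
noncomputable def cw (ρ : Finset E) : E × ℝ →ₗ[ℝ] (E →₀ ℝ) :=
  if h : ∃ L : E × ℝ →ₗ[ℝ] (E →₀ ℝ), ∀ v, (L v).support ⊆ ρ ∧ Φ (L v) = v then h.choose else 0

section FiniteDim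

variable [FiniteDimensional ℝ E] {F : Finset (Finset E)}

lemma Geo.card_le (hF : Geo F) {f : Finset E} (hf : f ∈ F) : f.card ≤ topCard E := by
  have := (hF.linearIndepOn hf).linearIndependent.fintype_card_le_finrank
  simpa [topCard] using this

lemma Geo.cw_spec (hF : Geo F) {ρ : Finset E} (hρ : ρ ∈ F) (hc : ρ.card = topCard E)
    (v : E × ℝ) : (cw ρ v).support ⊆ ρ ∧ Φ (cw ρ v) = v := by
  have h : ∃ L : E × ℝ →ₗ[ℝ] (E →₀ ℝ), ∀ v, (L v).support ⊆ ρ ∧ Φ (L v) = v := by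
    have hli := (hF.linearIndepOn hρ).linearIndependent
    have hcard : Fintype.card (↥(ρ : Set E)) = Module.finrank ℝ (E × ℝ) := by
      simpa [topCard] using hc
    have hne : Nonempty (↥(ρ : Set E)) := by
      rw [← Fintype.card_pos_iff, hcard]
      exact Module.finrank_pos
    let b := basisOfLinearIndependentOfCardEqFinrank hli hcard
    refine ⟨(Finsupp.lmapDomain ℝ ℝ (Subtype.val : ↥(ρ : Set E) → E)) ∘ₗ b.repr.toLinearMap,
      fun v => ⟨?_, ?_⟩⟩
    · intro x hx
      have := Finsupp.mapDomain_support hx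
      simp only [Finset.mem_image] at this
      obtain ⟨a, -, rfl⟩ := this
      exact a.2
    · have := b.linearCombination_repr v
      simp only [LinearMap.comp_apply, Finsupp.lmapDomain_apply, Φ,
        Finsupp.linearCombination_mapDomain]
      rw [show (hom ∘ Subtype.val : ↥(ρ : Set E) → E × ℝ) = b by funext x; simp [b]]
      exact this
  rw [cw, dif_pos h]
  exact h.choose_spec v

lemma Geo.cw_Φ (hF : Geo F) {ρ : Finset E} (hρ : ρ ∈ F) (hc : ρ.card = topCard E)
    {w : E →₀ ℝ} (hw : w.support ⊆ ρ) : cw ρ (Φ w) = w :=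
  hF.inj_on hρ (hF.cw_spec hρ hc _).1 hw (hF.cw_spec hρ hc _).2

lemma Geo.cw_hom (hF : Geo F) {ρ : Finset E} (hρ : ρ ∈ F) (hc : ρ.card = topCard E)
    {x : E} (hx : x ∈ ρ) : cw ρ (hom x) = Finsupp.single x 1 := by
  rw [← hF.cw_Φ hρ hc (w := Finsupp.single x 1) (Finsupp.support_single_subset.trans (by simpa)),
    Φ_single, one_smul]

lemma Geo.cw_apply_eq_zero (hF : Geo F) {ρ : Finset E} (hρ : ρ ∈ F) (hc : ρ.card = topCard E)
    {x : E} (hx : x ∉ ρ) (v : E × ℝ) : cw ρ v x = 0 :=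
  Finsupp.notMem_support_iff.1 fun h => hx ((hF.cw_spec hρ hc v).1 h)

lemma cw_apply {ρ : Finset E} (u : E →₀ ℝ) (c : E) :
    cw ρ (Φ u) c = ∑ x ∈ u.support, u x * cw ρ (hom x) c := by
  rw [Φ_eq_sum (Finset.Subset.refl _), map_sum, Finsupp.finsetSum_apply]
  simp

/-- Two tops sharing a facet lie on different sides of it. -/
lemma Geo.two_sides (hF : Geo F) {τ : Finset E} {c c' : E} (hc : c ∉ τ) (hc' : c' ∉ τ)
    (hcc : c ≠ c') (h : insert c τ ∈ F) (h' : insert c' τ ∈ F)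
    (hN : (insert c τ).card = topCard E) : cw (insert c τ) (hom c') c < 0 := by
  by_contra! hn
  obtain ⟨h1, h2⟩ := hF.cw_spec h hN (hom c')
  have key := hF.inj_off τ (u := Finsupp.single c' 1) (u' := cw (insert c τ) (hom c'))
    (fun x _ => by classical
                   simp only [Finsupp.single_apply]; split_ifs <;> simp)
    (fun x hx => by
      by_cases hxc : x = c
      · subst hxc; exact hn
      · rw [hF.cw_apply_eq_zero h hN (by simp [hxc, hx])])
    (by rwa [Finsupp.support_single _ one_ne_zero])
    (hF.down _ h _ (Finset.union_subset h1 (Finset.subset_insert _ _)))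
    (by rw [h2, Φ_single, one_smul])
  have : c' ∈ insert c τ := h1 (by rw [← key]; simp)
  simp [hcc.symm, hc'] at this

lemma Geo.cw_neighbor (hF : Geo F) {τ : Finset E} {c c' : E} (hc : c ∉ τ) (hc' : c' ∉ τ)
    (h : insert c τ ∈ F) (h' : insert c' τ ∈ F)
    (hN : (insert c τ).card = topCard E) (y : E × ℝ) :
    cw (insert c τ) y c = cw (insert c' τ) y c' * cw (insert c τ) (hom c') c := by
  have hN' : (insert c' τ).card = topCard E := by
    rw [← hN, Finset.card_insert_of_notMem hc, Finset.card_insert_of_notMem hc']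
  obtain ⟨h1, h2⟩ := hF.cw_spec h' hN' y
  conv_lhs => rw [← h2]
  rw [cw_apply, Finset.sum_subset h1 (by intro x _ hx; simp [Finsupp.notMem_support_iff.1 hx]),
    Finset.sum_insert hc', add_eq_left]
  refine Finset.sum_eq_zero fun x hx => ?_
  rw [hF.cw_hom h hN (Finset.mem_insert_of_mem hx), Finsupp.single_apply_eq_zero.2, mul_zero]
  rintro rfl; exact absurd hx hc

/-- If `y` is beyond a facet, it is not beyond it as seen from the other top. -/
lemma Geo.neg_iff_pos (hF : Geo F) {τ : Finset E} {c c' : E} (hc : c ∉ τ) (hc' : c' ∉ τ)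
    (hcc : c ≠ c') (h : insert c τ ∈ F) (h' : insert c' τ ∈ F)
    (hN : (insert c τ).card = topCard E) (y : E × ℝ) :
    cw (insert c τ) y c < 0 ↔ 0 < cw (insert c' τ) y c' := by
  have h1 := hF.two_sides hc hc' hcc h h' hN
  rw [hF.cw_neighbor hc hc' h h' hN y]
  constructor
  · intro h2; by_contra! h3; nlinarith
  · intro h2; nlinarith

lemma Geo.sum_cw (hF : Geo F) {ρ : Finset E} (hρ : ρ ∈ F) (hc : ρ.card = topCard E)
    (y : E × ℝ) : ∑ x ∈ ρ, cw ρ y x = y.2 := by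
  obtain ⟨h1, h2⟩ := hF.cw_spec hρ hc y
  rw [Φ_eq_sum h1] at h2
  conv_rhs => rw [← h2]
  simp [hom, Prod.snd_sum]

end FiniteDim

end GeoFlip

namespace GeoFlip

/-- The union of the cones over the faces. -/
def cone (F : Finset (Finset E)) : Set (E × ℝ) :=
  {y | ∃ w : E →₀ ℝ, 0 ≤ w ∧ w.support ∈ F ∧ Φ w = y}

/-- The algebraic interior. -/
def core (C : Set (E × ℝ)) (y : E × ℝ) : Prop :=
  ∀ d, ∃ ε > (0 : ℝ), ∀ t, 0 ≤ t → t ≤ ε → y + t • d ∈ C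

/-- A simplex whose relative interior is interior. -/
def Inn (C : Set (E × ℝ)) (f : Finset E) : Prop := core C (Φ (ind f))

/-- The star of `f` spans everything. -/
def Full (F : Finset (Finset E)) (f : Finset E) : Prop :=
  ∀ d, ∃ u : E →₀ ℝ, (∀ x ∉ f, 0 ≤ u x) ∧ u.support ∪ f ∈ F ∧ Φ u = d

variable {F : Finset (Finset E)}

lemma core.mem {C : Set (E × ℝ)} {y : E × ℝ} (h : core C y) : y ∈ C := by
  obtain ⟨ε, hε, h⟩ := h 0
  simpa using h 0 le_rfl hε.le

lemma Full.mem (hF : Geo F) {f : Finset E} (h : Full F f) : f ∈ F := by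
  obtain ⟨u, -, h, -⟩ := h 0
  exact hF.down _ h _ Finset.subset_union_right

/-- Directions reachable after adding large multiples of an interior point of `g` are reachable
in the star of `g`. -/
lemma Geo.exists_star_weight (hF : Geo F) {f : Finset E} {w : E →₀ ℝ} (hw : 0 ≤ w)
    (hwF : w.support ∈ F) (hf : f ⊆ w.support) (d : E × ℝ) (M₀ : ℕ)
    (h : ∀ M : ℕ, M₀ ≤ M → ∃ u : E →₀ ℝ, (∀ x ∉ f, 0 ≤ u x) ∧ u.support ∪ f ∈ F ∧
      Φ u = d + (M : ℝ) • Φ w) :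
    ∃ p : E →₀ ℝ, (∀ x ∉ w.support, 0 ≤ p x) ∧ p.support ∪ w.support ∈ F ∧ Φ p = d := by
  choose u hu1 hu2 hu3 using fun M : ℕ => h (M₀ + M) (by omega)
  obtain ⟨⟨g, hg⟩, hinf⟩ := Finite.exists_infinite_fiber
    (fun M : ℕ => (⟨(u M).support ∪ f, hu2 M⟩ : {x // x ∈ F}))
  have hinf' : Set.Infinite {M : ℕ | (u M).support ∪ f = g} := by
    rw [Set.infinite_coe_iff] at hinf
    convert hinf using 1
    ext M
    simp
  obtain ⟨a, ha⟩ := hinf'.nonempty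
  obtain ⟨b, hb, hab⟩ := hinf'.exists_gt a
  simp only [Set.mem_ofPred_eq] at ha hb
  have hba : (0 : ℝ) < (b : ℝ) - a := by
    have : (a : ℝ) < b := by exact_mod_cast hab
    linarith
  set q : E →₀ ℝ := ((b : ℝ) - a)⁻¹ • (u b - u a) with hq
  have hsg : ∀ M, (u M).support ∪ f = g → (u M).support ⊆ g := fun M hM => by
    rw [← hM]; exact Finset.subset_union_left
  have hqs : q.support ⊆ g := by
    refine Finsupp.support_smul.trans (Finsupp.support_sub.trans ?_)
    exact Finset.union_subset (hsg b hb) (hsg a ha)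
  have hΦq : Φ q = Φ w := by
    rw [hq, map_smul, map_sub, hu3, hu3, add_sub_add_left_eq_sub, ← sub_smul, smul_smul]
    push_cast
    rw [show ((b : ℝ) - a)⁻¹ * (M₀ + b - (M₀ + a)) = 1 by field_simp; ring, one_smul]
  have hform : ∀ M, (u M).support ∪ f = g → u M = u a + ((M : ℝ) - a) • q := by
    intro M hM
    refine hF.inj_on hg (hsg M hM) ?_ ?_
    · exact Finsupp.support_add.trans (Finset.union_subset (hsg a ha)
        (Finsupp.support_smul.trans hqs))
    · rw [map_add, map_smul, hΦq, hu3, hu3, add_assoc, ← add_smul]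
      push_cast
      ring_nf
  have hq0 : ∀ x ∉ f, 0 ≤ q x := by
    intro x hx
    by_contra! hneg
    obtain ⟨k, hk⟩ := exists_nat_gt (u a x / (-q x) + a)
    obtain ⟨M, hM, hkM⟩ := hinf'.exists_gt k
    have h1 := hu1 M x hx
    rw [hform M hM] at h1
    simp only [Finsupp.coe_add, Pi.add_apply, Finsupp.coe_smul, Pi.smul_apply, smul_eq_mul] at h1
    have h2 : (k : ℝ) < M := by exact_mod_cast hkM
    have h3 : u a x / (-q x) < (M : ℝ) - a := by linarith
    rw [div_lt_iff₀ (by linarith)] at h3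
    nlinarith
  have hfg : f ⊆ g := by rw [← ha]; exact Finset.subset_union_right
  have hqw : q = w := by
    refine hF.inj_off f hq0 (fun x _ => hw x) (hF.down _ hg _ (Finset.union_subset hqs hfg)) ?_ hΦq
    rwa [Finset.union_eq_left.2 hf]
  rw [hqw] at hqs
  refine ⟨u a - ((M₀ + a : ℕ) : ℝ) • w, fun x hx => ?_, ?_, ?_⟩
  · simp only [Finsupp.coe_sub, Pi.sub_apply, Finsupp.coe_smul, Pi.smul_apply, smul_eq_mul]
    rw [Finsupp.notMem_support_iff.1 hx, mul_zero, sub_zero]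
    exact hu1 a x (fun h => hx (hf h))
  · refine hF.down _ hg _ (Finset.union_subset ?_ hqs)
    exact Finsupp.support_sub.trans (Finset.union_subset (hsg a ha)
      (Finsupp.support_smul.trans hqs))
  · rw [map_sub, map_smul, hu3, add_sub_cancel_right]

lemma Geo.full_of_core (hF : Geo F) {w : E →₀ ℝ} (hw : 0 ≤ w) (hwF : w.support ∈ F)
    (h : core (cone F) (Φ w)) : Full F w.support := by
  intro d
  obtain ⟨ε, hε, h⟩ := h d
  obtain ⟨M₀, hM₀⟩ := exists_nat_gt ε⁻¹
  have hM₀pos : (0 : ℝ) < M₀ := (inv_pos.2 hε).trans hM₀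
  refine hF.exists_star_weight hw hwF (Finset.empty_subset _) d M₀ fun M hM => ?_
  have hMM : (M₀ : ℝ) ≤ M := by exact_mod_cast hM
  have hMpos : (0 : ℝ) < M := hM₀pos.trans_le hMM
  obtain ⟨u, hu, hus, hue⟩ := h (M : ℝ)⁻¹ (by positivity)
    (inv_le_of_inv_le₀ hε (hM₀.le.trans hMM))
  refine ⟨(M : ℝ) • u, fun x _ => ?_, ?_, ?_⟩
  · exact mul_nonneg hMpos.le (hu x)
  · rw [Finset.union_empty]
    exact hF.down _ hus _ Finsupp.support_smul
  · rw [map_smul, hue, smul_add, smul_smul, mul_inv_cancel₀ hMpos.ne', one_smul, add_comm]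

/-- Small perturbations of a nonnegative weight. -/
lemma exists_pos_add_smul_nonneg {w u : E →₀ ℝ} (hw : 0 ≤ w)
    (hu : ∀ x ∉ w.support, 0 ≤ u x) :
    ∃ ε > (0 : ℝ), ∀ t, 0 ≤ t → t ≤ ε → 0 ≤ w + t • u := by
  obtain ⟨δ, hδ, hδ'⟩ : ∃ δ > (0 : ℝ), ∀ x ∈ w.support, δ * |u x| ≤ w x := by
    have hfin : ∀ s : Finset E, (∀ x ∈ s, 0 < w x) →
        ∃ δ > (0 : ℝ), ∀ x ∈ s, δ * |u x| ≤ w x := by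
      intro s
      induction s using Finset.induction_on with
      | empty => intro _; exact ⟨1, one_pos, by simp⟩
      | insert a s _ ih =>
        intro hs
        obtain ⟨δ, hδ, h⟩ := ih fun x hx => hs x (Finset.mem_insert_of_mem hx)
        have ha := hs a (Finset.mem_insert_self _ _)
        refine ⟨min δ (w a / (|u a| + 1)), lt_min hδ (by positivity), ?_⟩
        intro x hx
        rcases Finset.mem_insert.1 hx with rfl | hx
        · calc min δ (w x / (|u x| + 1)) * |u x| ≤ (w x / (|u x| + 1)) * (|u x| + 1) := by
                gcongr
                · exact min_le_right _ _
                · linarith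
            _ = w x := by field_simp
        · exact (mul_le_mul_of_nonneg_right (min_le_left _ _) (abs_nonneg _)).trans (h x hx)
    refine hfin w.support fun x hx => lt_of_le_of_ne (hw x) ?_
    exact (Finsupp.mem_support_iff.1 hx).symm
  refine ⟨δ, hδ, fun t ht htδ x => ?_⟩
  simp only [Finsupp.coe_add, Pi.add_apply, Finsupp.coe_smul, Pi.smul_apply, smul_eq_mul,
    Finsupp.coe_zero, Pi.zero_apply]
  by_cases hx : x ∈ w.support
  · have h1 := hδ' x hx
    have h2 := neg_abs_le (u x)
    have h3 := abs_nonneg (u x)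
    nlinarith
  · rw [Finsupp.notMem_support_iff.1 hx, zero_add]
    exact mul_nonneg ht (hu x hx)

lemma Geo.core_of_full (hF : Geo F) {w : E →₀ ℝ} (hw : 0 ≤ w)
    (h : Full F w.support) : core (cone F) (Φ w) := by
  intro d
  obtain ⟨u, hu, hus, hue⟩ := h d
  obtain ⟨ε, hε, hε'⟩ := exists_pos_add_smul_nonneg hw hu
  refine ⟨ε, hε, fun t ht htε => ⟨w + t • u, hε' t ht htε, hF.down _ hus _ ?_, ?_⟩⟩
  · rw [Finset.union_comm]
    exact Finsupp.support_add.trans (Finset.union_subset_union_right Finsupp.support_smul)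
  · rw [map_add, map_smul, hue]

lemma Geo.core_iff (hF : Geo F) {w : E →₀ ℝ} (hw : 0 ≤ w) (hwF : w.support ∈ F) :
    core (cone F) (Φ w) ↔ Full F w.support :=
  ⟨hF.full_of_core hw hwF, hF.core_of_full hw⟩

lemma Geo.inn_iff (hF : Geo F) {f : Finset E} (hf : f ∈ F) : Inn (cone F) f ↔ Full F f := by
  have := hF.core_iff (ind_nonneg f) (by rwa [ind_support])
  rwa [ind_support] at this

lemma Geo.full_mono (hF : Geo F) {f g : Finset E} (hfg : f ⊆ g) (hg : g ∈ F) (h : Full F f) :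
    Full F g := by
  intro d
  have := hF.exists_star_weight (ind_nonneg g) (by rwa [ind_support])
    (by rwa [ind_support]) d 0 (f := f) (fun M _ => h _)
  simpa only [ind_support] using this

lemma Geo.core_of_full_subset (hF : Geo F) {w : E →₀ ℝ} (hw : 0 ≤ w) (hwF : w.support ∈ F)
    {f : Finset E} (hf : Full F f) (hfw : f ⊆ w.support) : core (cone F) (Φ w) :=
  hF.core_of_full hw (hF.full_mono hfw hwF hf)

section FiniteDim

variable [FiniteDimensional ℝ E]

lemma Geo.full_top (hF : Geo F) {ρ : Finset E} (hρ : ρ ∈ F) (hc : ρ.card = topCard E) :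
    Full F ρ := fun d =>
  ⟨cw ρ d, fun x hx => (hF.cw_apply_eq_zero hρ hc hx d).ge,
    by rw [Finset.union_eq_right.2 (hF.cw_spec hρ hc d).1]; exact hρ, (hF.cw_spec hρ hc d).2⟩

/-- Beyond a full facet there is another top. -/
lemma Geo.exists_other (hF : Geo F) {τ : Finset E} {c : E} (hc : c ∉ τ) (hτ : Full F τ)
    (h : insert c τ ∈ F) (hN : (insert c τ).card = topCard E) {y : E × ℝ}
    (hy : cw (insert c τ) y c < 0) :
    ∃ c', c' ∉ τ ∧ c' ≠ c ∧ insert c' τ ∈ F ∧ cw (insert c τ) (hom c') c < 0 := by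
  obtain ⟨u, hu, hus, rfl⟩ := hτ y
  rw [cw_apply] at hy
  obtain ⟨x, hx, hneg⟩ := Finset.exists_lt_of_sum_lt (hy.trans_eq Finset.sum_const_zero.symm)
  have hxτ : x ∉ τ := by
    intro hxτ
    rw [hF.cw_hom h hN (Finset.mem_insert_of_mem hxτ), Finsupp.single_apply_eq_zero.2, mul_zero] at hneg
    · exact lt_irrefl _ hneg
    · rintro rfl; exact absurd hxτ hc
  have h0 := hu x hxτ
  have hlt : cw (insert c τ) (hom x) c < 0 := by
    by_contra! h1; nlinarith
  refine ⟨x, hxτ, ?_, hF.down _ hus _ ?_, hlt⟩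
  · rintro rfl
    rw [hF.cw_hom h hN (Finset.mem_insert_self _ _)] at hlt
    simp at hlt; linarith
  · exact Finset.insert_subset (Finset.mem_union_left _ hx) Finset.subset_union_right

/-- A full face lies in a top. -/
lemma Geo.exists_top (hF : Geo F) {f : Finset E} (hf : Full F f) :
    ∃ ρ ∈ F, ρ.card = topCard E ∧ f ⊆ ρ := by
  obtain ⟨ρ, hfρ, hmax⟩ := Finset.exists_le_maximal F (hf.mem hF)
  refine ⟨ρ, hmax.prop, le_antisymm (hF.card_le hmax.prop) ?_, hfρ⟩
  have hfull := hF.full_mono hfρ hmax.prop hf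
  have hspan : Submodule.span ℝ ((ρ.image hom : Finset (E × ℝ)) : Set (E × ℝ)) = ⊤ := by
    rw [Submodule.eq_top_iff']
    intro d
    obtain ⟨u, -, hus, rfl⟩ := hfull d
    have : u.support ⊆ ρ := by
      have := hmax.eq_of_le hus (show ρ ≤ _ from Finset.subset_union_right)
      rw [this]; exact Finset.subset_union_left
    rw [Φ_eq_sum this]
    exact Submodule.sum_mem _ fun x hx => Submodule.smul_mem _ _
      (Submodule.subset_span (by simp; exact ⟨x, hx, rfl⟩))
  have := finrank_span_finset_le_card (R := ℝ) (ρ.image hom : Finset (E × ℝ))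
  rw [Set.finrank, hspan, finrank_top] at this
  exact this.trans Finset.card_image_le

end FiniteDim

/-- A triangulation of the cone `C` whose boundary faces are prescribed. -/
structure Tri (C : Set (E × ℝ)) (B₀ F : Finset (Finset E)) : Prop where
  geo : Geo F
  cone_eq : cone F = C
  bdry : ∀ f, ¬ Inn C f → (f ∈ F ↔ f ∈ B₀)

variable {C : Set (E × ℝ)} {B₀ : Finset (Finset E)}

lemma Tri.inn_iff (hF : Tri C B₀ F) {f : Finset E} (hf : f ∈ F) : Inn C f ↔ Full F f := by
  rw [← hF.cone_eq]; exact hF.geo.inn_iff hf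

lemma Tri.core_of_inn_subset (hF : Tri C B₀ F) {w : E →₀ ℝ} (hw : 0 ≤ w) (hwF : w.support ∈ F)
    {f : Finset E} (hf : Inn C f) (hfw : f ⊆ w.support) : core C (Φ w) := by
  rw [← hF.cone_eq]
  exact hF.geo.core_of_full_subset hw hwF
    ((hF.inn_iff (hF.geo.down _ hwF _ hfw)).1 hf) hfw

lemma Tri.inn_mono (hF : Tri C B₀ F) {f g : Finset E} (hfg : f ⊆ g) (hg : g ∈ F)
    (h : Inn C f) : Inn C g := by
  rw [hF.inn_iff hg]
  exact hF.geo.full_mono hfg hg ((hF.inn_iff (hF.geo.down _ hg _ hfg)).1 h)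

/-- The top-dimensional simplices. -/
noncomputable def tops (F : Finset (Finset E)) : Finset (Finset E) :=
  F.filter fun f => f.card = topCard E

lemma mem_tops {f : Finset E} : f ∈ tops F ↔ f ∈ F ∧ f.card = topCard E := by
  simp [tops]

section FiniteDim

variable [FiniteDimensional ℝ E] {F' : Finset (Finset E)}

lemma Tri.subset_of_tops (hF : Tri C B₀ F) (hF' : Tri C B₀ F') (h : tops F ⊆ tops F') :
    F ⊆ F' := by
  intro f hf
  by_cases hi : Inn C f
  · obtain ⟨ρ, hρ, hc, hfρ⟩ := hF.geo.exists_top ((hF.inn_iff hf).1 hi)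
    exact hF'.geo.down _ (mem_tops.1 (h (mem_tops.2 ⟨hρ, hc⟩))).1 _ hfρ
  · rw [hF'.bdry f hi, ← hF.bdry f hi]; exact hf

lemma Tri.eq_of_tops (hF : Tri C B₀ F) (hF' : Tri C B₀ F') (h : tops F = tops F') : F = F' :=
  Finset.Subset.antisymm (hF.subset_of_tops hF' h.subset) (hF'.subset_of_tops hF h.symm.subset)

end FiniteDim

end GeoFlip

namespace GeoFlip

/-- Replace the star of `A` by the star of `B`. -/
noncomputable def exch (F : Finset (Finset E)) (A B : Finset E) : Finset (Finset E) :=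
  F.filter (fun f => ¬ A ⊆ f) ∪
    ((F.filter fun g => A ⊆ g).biUnion fun g => (g ∪ B).powerset).filter
      fun f => B ⊆ f ∧ ¬ A ⊆ f

lemma mem_exch {F : Finset (Finset E)} {A B f : Finset E} :
    f ∈ exch F A B ↔ ¬ A ⊆ f ∧ (f ∈ F ∨ B ⊆ f ∧ ∃ g ∈ F, A ⊆ g ∧ f ⊆ g ∪ B) := by
  simp only [exch, Finset.mem_union, Finset.mem_filter, Finset.mem_biUnion, Finset.mem_powerset]
  constructor
  · rintro (⟨h1, h2⟩ | ⟨⟨g, ⟨hg, hA⟩, hf⟩, hB, hA'⟩)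
    · exact ⟨h2, Or.inl h1⟩
    · exact ⟨hA', Or.inr ⟨hB, g, hg, hA, hf⟩⟩
  · rintro ⟨h1, h2 | ⟨hB, g, hg, hA, hf⟩⟩
    · exact Or.inl ⟨h2, h1⟩
    · exact Or.inr ⟨⟨g, ⟨hg, hA⟩, hf⟩, hB, h1⟩

/-- The largest multiple of a positive weight that may be subtracted. -/
lemma exists_max_sub {w β : E →₀ ℝ} (hβ : ∀ x ∈ β.support, 0 < β x) (hne : β.support.Nonempty)
    (hw : 0 ≤ w) :
    ∃ t : ℝ, 0 ≤ t ∧ 0 ≤ w - t • β ∧ (∃ b ∈ β.support, w b = t * β b) ∧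
      (β.support ⊆ w.support → 0 < t) := by
  obtain ⟨b, hb, hmin⟩ := Finset.exists_min_image β.support (fun x => w x / β x) hne
  have hbp := hβ b hb
  refine ⟨w b / β b, div_nonneg (hw b) hbp.le, fun x => ?_, ⟨b, hb, by field_simp⟩, fun h => ?_⟩
  · by_cases hx : x ∈ β.support
    · have := hmin x hx
      rw [le_div_iff₀ (hβ x hx)] at this
      simpa using this
    · simpa [Finsupp.notMem_support_iff.1 hx] using hw x
  · exact div_pos (lt_of_le_of_ne (hw b) (Finsupp.mem_support_iff.1 (h hb)).symm) hbp

/-- Data for exchanging the star of the support of `α` with that of `β`. -/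
structure ExchData (F : Finset (Finset E)) (α β : E →₀ ℝ) : Prop where
  pos_left : ∀ x ∈ α.support, 0 < α x
  pos_right : ∀ x ∈ β.support, 0 < β x
  ne_left : α.support.Nonempty
  ne_right : β.support.Nonempty
  disj : Disjoint α.support β.support
  eq : Φ α = Φ β
  mem : ∀ f ∈ F, α.support ⊆ f → ∀ b ∈ β.support, f.erase b ∪ β.support.erase b ∈ F

namespace ExchData

variable {F : Finset (Finset E)} {α β : E →₀ ℝ}

lemma nonneg_left (h : ExchData F α β) : 0 ≤ α := fun x => by
  by_cases hx : x ∈ α.support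
  · exact (h.pos_left x hx).le
  · exact (Finsupp.notMem_support_iff.1 hx).ge

lemma nonneg_right (h : ExchData F α β) : 0 ≤ β := fun x => by
  by_cases hx : x ∈ β.support
  · exact (h.pos_right x hx).le
  · exact (Finsupp.notMem_support_iff.1 hx).ge

lemma right_zero (h : ExchData F α β) {x : E} (hx : x ∈ α.support) : β x = 0 :=
  Finsupp.notMem_support_iff.1 (Finset.disjoint_left.1 h.disj hx)

lemma left_zero (h : ExchData F α β) {x : E} (hx : x ∈ β.support) : α x = 0 :=
  Finsupp.notMem_support_iff.1 (Finset.disjoint_right.1 h.disj hx)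

/-- A weight on the exchanged complex comes from one on the original complex. -/
lemma exists_back (h : ExchData F α β) (hF : Geo F) {w : E →₀ ℝ} (hw : 0 ≤ w)
    (hs : w.support ∈ exch F α.support β.support) :
    ∃ t : ℝ, 0 ≤ t ∧ 0 ≤ w + t • (α - β) ∧ (w + t • (α - β)).support ∈ F := by
  obtain ⟨hA, hs | ⟨hB, g, hg, hAg, hwg⟩⟩ := mem_exch.1 hs
  · exact ⟨0, le_rfl, by simpa using hw, by simpa using hs⟩
  obtain ⟨t, ht, hsub, ⟨b, hb, hbt⟩, -⟩ := exists_max_sub h.pos_right h.ne_right hw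
  refine ⟨t, ht, ?_, hF.down _ (h.mem g hg hAg b hb) _ ?_⟩
  · rw [show w + t • (α - β) = (w - t • β) + t • α by rw [smul_sub]; abel]
    exact add_nonneg hsub (smul_nonneg ht h.nonneg_left)
  · intro x hx
    have hxb : x ≠ b := by
      rintro rfl
      simp [hbt, h.left_zero hb] at hx
    have : x ∈ g ∪ β.support := by
      by_contra hcon
      have hxα : x ∉ α.support := fun hh => hcon (Finset.mem_union_left _ (hAg hh))
      have hxβ : x ∉ β.support := fun hh => hcon (Finset.mem_union_right _ hh)
      have hxw : x ∉ w.support := fun hh => hcon (hwg hh)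
      rw [Finsupp.mem_support_iff] at hx
      rw [Finsupp.notMem_support_iff] at hxα hxβ hxw
      simp [hxα, hxβ, hxw] at hx
    simpa [hxb] using this

/-- A weight on the original complex comes from one on the exchanged complex. -/
lemma exists_forth (h : ExchData F α β) {w : E →₀ ℝ} (hw : 0 ≤ w) (hs : w.support ∈ F) :
    ∃ t : ℝ, 0 ≤ t ∧ 0 ≤ w - t • (α - β) ∧
      (w - t • (α - β)).support ∈ exch F α.support β.support := by
  by_cases hA : α.support ⊆ w.support
  · obtain ⟨t, ht, hsub, ⟨a, ha, hat⟩, htpos⟩ := exists_max_sub h.pos_left h.ne_left hw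
    have htpos := htpos hA
    refine ⟨t, ht, ?_, mem_exch.2 ⟨fun hcon => ?_, Or.inr ⟨fun x hx => ?_, w.support, hs, hA, ?_⟩⟩⟩
    · rw [show w - t • (α - β) = (w - t • α) + t • β by rw [smul_sub]; abel]
      exact add_nonneg hsub (smul_nonneg ht h.nonneg_right)
    · have := hcon ha
      rw [Finsupp.mem_support_iff] at this
      simp [hat, h.right_zero ha] at this
    · rw [Finsupp.mem_support_iff]
      have h1 : 0 ≤ w x := hw x
      have h2 := mul_pos htpos (h.pos_right x hx)
      have h3 := h.left_zero hx
      simp [h3]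
      linarith
    · intro x hx
      by_contra hcon
      simp only [Finset.mem_union, not_or, Finsupp.notMem_support_iff] at hcon
      have hxα : α x = 0 := Finsupp.notMem_support_iff.1 fun hh =>
        Finsupp.mem_support_iff.1 (hA hh) hcon.1
      rw [Finsupp.mem_support_iff] at hx
      simp [hcon.1, hcon.2, hxα] at hx
  · exact ⟨0, le_rfl, by simpa using hw, by simpa using mem_exch.2 ⟨hA, Or.inl hs⟩⟩

lemma geo (h : ExchData F α β) (hF : Geo F) : Geo (exch F α.support β.support) where
  empty := mem_exch.2 ⟨fun hh => h.ne_left.ne_empty (Finset.subset_empty.1 hh), Or.inl hF.empty⟩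
  down := by
    intro f hf g hgf
    obtain ⟨hA, hf | ⟨hB, k, hk, hAk, hfk⟩⟩ := mem_exch.1 hf
    · exact mem_exch.2 ⟨fun hh => hA (hh.trans hgf), Or.inl (hF.down _ hf _ hgf)⟩
    · refine mem_exch.2 ⟨fun hh => hA (hh.trans hgf), ?_⟩
      by_cases hBg : β.support ⊆ g
      · exact Or.inr ⟨hBg, k, hk, hAk, hgf.trans hfk⟩
      · obtain ⟨b, hb, hbg⟩ := Finset.not_subset.1 hBg
        refine Or.inl (hF.down _ (h.mem k hk hAk b hb) _ fun x hx => ?_)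
        have hxb : x ≠ b := by rintro rfl; exact hbg hx
        have := hfk (hgf hx)
        simpa [hxb] using this
  inj := by
    have key : ∀ w w' : E →₀ ℝ, 0 ≤ w' → w.support ∈ exch F α.support β.support →
        ∀ t t' : ℝ, w + t • (α - β) = w' + t' • (α - β) → t' ≤ t := by
      intro w w' hw' hs t t' hE
      by_contra! hlt
      refine (mem_exch.1 hs).1 fun x hx => Finsupp.mem_support_iff.2 ?_
      have h1 := DFunLike.congr_fun hE x
      simp only [Finsupp.coe_add, Pi.add_apply, Finsupp.coe_smul, Pi.smul_apply, smul_eq_mul,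
        Finsupp.coe_sub, Pi.sub_apply, h.right_zero hx, sub_zero] at h1
      have h2 : 0 ≤ w' x := hw' x
      have h3 := h.pos_left x hx
      have h4 : 0 < (t' - t) * α x := mul_pos (by linarith) h3
      intro h0
      rw [h0] at h1
      nlinarith
    intro w w' hw hw' hs hs' hE
    obtain ⟨t, -, h1, h2⟩ := h.exists_back hF hw hs
    obtain ⟨t', -, h1', h2'⟩ := h.exists_back hF hw' hs'
    have hz : Φ (α - β) = 0 := by rw [map_sub, h.eq, sub_self]
    have := hF.inj _ _ h1 h1' h2 h2' (by simp only [map_add, map_smul, hz, smul_zero, add_zero, hE])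
    have htt := le_antisymm (key _ _ hw hs' _ _ this.symm) (key _ _ hw' hs _ _ this)
    rw [htt] at this
    exact add_right_cancel this

lemma cone_eq (h : ExchData F α β) (hF : Geo F) :
    GeoFlip.cone (exch F α.support β.support) = GeoFlip.cone F := by
  have hz : Φ (α - β) = 0 := by rw [map_sub, h.eq, sub_self]
  ext y
  constructor
  · rintro ⟨w, hw, hs, rfl⟩
    obtain ⟨t, -, h1, h2⟩ := h.exists_back hF hw hs
    exact ⟨_, h1, h2, by rw [map_add, map_smul, hz, smul_zero, add_zero]⟩
  · rintro ⟨w, hw, hs, rfl⟩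
    obtain ⟨t, -, h1, h2⟩ := h.exists_forth hw hs
    exact ⟨_, h1, h2, by rw [map_sub, map_smul, hz, smul_zero, sub_zero]⟩

lemma tri {C : Set (E × ℝ)} {B₀ : Finset (Finset E)} (h : ExchData F α β) (hF : Tri C B₀ F)
    (hc : core C (Φ α)) : Tri C B₀ (exch F α.support β.support) where
  geo := h.geo hF.geo
  cone_eq := (h.cone_eq hF.geo).trans hF.cone_eq
  bdry := by
    intro f hf
    rw [← hF.bdry f hf, mem_exch]
    constructor
    · rintro ⟨hA, hfF | ⟨hB, g, hg, hAg, hfg⟩⟩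
      · exact hfF
      · have hfe : f ∈ exch F α.support β.support := mem_exch.2 ⟨hA, Or.inr ⟨hB, g, hg, hAg, hfg⟩⟩
        have hG := h.geo hF.geo
        refine absurd ?_ hf
        rw [← hF.cone_eq, ← h.cone_eq hF.geo, hG.inn_iff hfe]
        refine hG.full_mono hB hfe (hG.full_of_core h.nonneg_right (hG.down _ hfe _ hB) ?_)
        rwa [h.cone_eq hF.geo, hF.cone_eq, ← h.eq]
    · intro hfF
      refine ⟨fun hA => hf ?_, Or.inl hfF⟩
      rw [hF.inn_iff hfF]
      refine hF.geo.full_mono hA hfF (hF.geo.full_of_core h.nonneg_left (hF.geo.down _ hfF _ hA) ?_)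
      rwa [hF.cone_eq]

end ExchData

end GeoFlip

namespace GeoFlip

/-- Combinatorial bistellar moves. -/
def Move (F F' : Finset (Finset E)) : Prop :=
  ∃ A B : Finset E, A.Nonempty ∧ B.Nonempty ∧ Disjoint A B ∧ A.card + B.card = topCard E + 1 ∧
    A ∈ F ∧ B ∉ F ∧ B ∈ F' ∧ A ∉ F' ∧
    (∀ f, (f ∈ F ∧ A ⊆ f) ↔ ∃ B', B' ⊂ B ∧ f = A ∪ B') ∧
    (∀ f, (f ∈ F' ∧ B ⊆ f) ↔ ∃ A', A' ⊂ A ∧ f = A' ∪ B) ∧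
    (∀ f, ¬ A ⊆ f → ¬ B ⊆ f → (f ∈ F ↔ f ∈ F'))

lemma Move.symm {F F' : Finset (Finset E)} (h : Move F F') : Move F' F := by
  obtain ⟨A, B, h1, h2, h3, h4, h5, h6, h7, h8, h9, h10, h11⟩ := h
  refine ⟨B, A, h2, h1, h3.symm, by omega, h7, h8, h5, h6, ?_, ?_, fun f h h' => (h11 f h' h).symm⟩
  · simpa only [Finset.union_comm] using h10
  · simpa only [Finset.union_comm] using h9

/-- Connectedness by moves between triangulations in a class. -/
def Conn (C : Set (E × ℝ)) (B₀ : Finset (Finset E)) :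
    Finset (Finset E) → Finset (Finset E) → Prop :=
  Relation.ReflTransGen fun X Y => Tri C B₀ X ∧ Tri C B₀ Y ∧ Move X Y

variable {C : Set (E × ℝ)} {B₀ : Finset (Finset E)} {F : Finset (Finset E)}

lemma Conn.symm {F F' : Finset (Finset E)} (h : Conn C B₀ F F') : Conn C B₀ F' F := by
  induction h with
  | refl => exact Relation.ReflTransGen.refl
  | tail _ h ih => exact Relation.ReflTransGen.head ⟨h.2.1, h.1, h.2.2.symm⟩ ih

lemma Conn.trans {F F' F'' : Finset (Finset E)} (h : Conn C B₀ F F') (h' : Conn C B₀ F' F'') :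
    Conn C B₀ F F'' := Relation.ReflTransGen.trans h h'

lemma Conn.refl (F : Finset (Finset E)) : Conn C B₀ F F := Relation.ReflTransGen.refl

/-- Chains with coefficients modulo two. -/
abbrev Chain (E : Type*) := Finset E →₀ ZMod 2

lemma Chain.add_self (c : Chain E) : c + c = 0 := by
  ext x; simp [CharTwo.add_self_eq_zero]

lemma Chain.add_add_cancel (c d : Chain E) : c + d + d = c := by
  rw [add_assoc, Chain.add_self, add_zero]

/-- The sum of a finite set of simplices. -/
noncomputable def chn (D : Finset (Finset E)) : Chain E := ∑ ρ ∈ D, Finsupp.single ρ 1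

lemma chn_apply (D : Finset (Finset E)) (σ : Finset E) : chn D σ = if σ ∈ D then 1 else 0 := by
  simp [chn, Finsupp.finsetSum_apply, Finsupp.single_apply]

lemma chn_injective : Function.Injective (chn (E := E)) := by
  intro D D' h
  ext σ
  have := DFunLike.congr_fun h σ
  rw [chn_apply, chn_apply] at this
  by_cases h1 : σ ∈ D <;> by_cases h2 : σ ∈ D' <;> simp_all

lemma chn_union {D D' : Finset (Finset E)} (h : Disjoint D D') :
    chn (D ∪ D') = chn D + chn D' := Finset.sum_union h

/-- The boundary operator. -/
noncomputable def bd : Chain E →ₗ[ZMod 2] Chain E :=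
  Finsupp.linearCombination (ZMod 2) fun ρ => ∑ x ∈ ρ, Finsupp.single (ρ.erase x) 1

/-- The cone operator. -/
noncomputable def cn (v : E) : Chain E →ₗ[ZMod 2] Chain E :=
  Finsupp.linearCombination (ZMod 2) fun ρ => Finsupp.single (insert v ρ) 1

lemma bd_single (ρ : Finset E) :
    bd (Finsupp.single ρ 1) = ∑ x ∈ ρ, Finsupp.single (ρ.erase x) (1 : ZMod 2) := by
  simp [bd]

lemma cn_single (v : E) (ρ : Finset E) :
    cn v (Finsupp.single ρ 1) = Finsupp.single (insert v ρ) (1 : ZMod 2) := by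
  simp [cn]

lemma bd_cn_single {v : E} {ρ : Finset E} (hv : v ∉ ρ) :
    bd (Finsupp.single (insert v ρ) 1) =
      Finsupp.single ρ (1 : ZMod 2) + cn v (bd (Finsupp.single ρ 1)) := by
  rw [bd_single, bd_single, Finset.sum_insert hv, Finset.erase_insert hv, map_sum]
  congr 1
  refine Finset.sum_congr rfl fun x hx => ?_
  rw [cn_single, Finset.erase_insert_of_ne]
  rintro rfl; exact hv hx

section FiniteDim

variable [FiniteDimensional ℝ E]

/-- The complex obtained by a bistellar move. -/
structure Flip (C : Set (E × ℝ)) (B₀ F : Finset (Finset E)) (A B : Finset E)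
    (F₁ : Finset (Finset E)) : Prop where
  tri : Tri C B₀ F₁
  move : Move F F₁
  star : ∀ f, (f ∈ F ∧ A ⊆ f) ↔ ∃ B', B' ⊂ B ∧ f = A ∪ B'
  mem : ∀ f, f ∈ F₁ ↔ (f ∈ F ∧ ¬ A ⊆ f) ∨ ∃ A', A' ⊂ A ∧ f = A' ∪ B
  chain : chn (tops F₁) = chn (tops F) + bd (Finsupp.single (A ∪ B) 1)

/-- A spanning circuit all of whose `B`-facets are present can be flipped. -/
lemma Tri.exists_flip (hF : Tri C B₀ F) {α β : E →₀ ℝ}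
    (hα : ∀ x ∈ α.support, 0 < α x) (hβ : ∀ x ∈ β.support, 0 < β x)
    (hαn : α.support.Nonempty) (hβn : β.support.Nonempty)
    (hdisj : Disjoint α.support β.support) (heq : Φ α = Φ β)
    (hcard : α.support.card + β.support.card = topCard E + 1)
    (hmem : ∀ b ∈ β.support, (α.support ∪ β.support).erase b ∈ F)
    (hB : β.support ∉ F) :
    ∃ F₁, Flip C B₀ F α.support β.support F₁ := by
  set A := α.support with hA
  set B := β.support with hBdef
  have hAs : ∀ b ∈ B, A ⊆ (A ∪ B).erase b := fun b hb x hx =>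
    Finset.mem_erase.2 ⟨fun h => Finset.disjoint_left.1 hdisj hx (h ▸ hb), Finset.mem_union_left _
        hx⟩
  have hcAB : (A ∪ B).card = topCard E + 1 := by rw [Finset.card_union_of_disjoint hdisj, hcard]
  have htop : ∀ b ∈ B, ((A ∪ B).erase b).card = topCard E := fun b hb => by
    rw [Finset.card_erase_of_mem (Finset.mem_union_right _ hb), hcAB]; rfl
  obtain ⟨b₀, hb₀⟩ := hβn
  have hAF : A ∈ F := hF.geo.down _ (hmem b₀ hb₀) _ (hAs b₀ hb₀)
  have hα0 : ∀ x ∈ B, α x = 0 := fun x hx =>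
    Finsupp.notMem_support_iff.1 (Finset.disjoint_right.1 hdisj hx)
  have hβ0 : ∀ x ∈ A, β x = 0 := fun x hx =>
    Finsupp.notMem_support_iff.1 (Finset.disjoint_left.1 hdisj hx)
  have hrep : ∀ d, ∃ u : E →₀ ℝ, (∀ x ∉ A, 0 ≤ u x) ∧ (∃ b ∈ B, u.support ⊆ (A ∪ B).erase b) ∧
      Φ u = d := by
    intro d
    obtain ⟨hs, hd⟩ := hF.geo.cw_spec (hmem b₀ hb₀) (htop b₀ hb₀) d
    set u := cw ((A ∪ B).erase b₀) d with hu
    obtain ⟨b, hb, hmin⟩ := Finset.exists_min_image B (fun x => u x / β x) ⟨b₀, hb₀⟩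
    refine ⟨u - (u b / β b) • (β - α), fun x hx => ?_, ⟨b, hb, fun x hx => ?_⟩, ?_⟩
    · by_cases hxB : x ∈ B
      · have := hmin x hxB
        rw [le_div_iff₀ (hβ x hxB)] at this
        simpa [hα0 x hxB] using this
      · have h1 : u x = 0 := Finsupp.notMem_support_iff.1 fun h => by
          have := hs h; simp [hx, hxB] at this
        simp [h1, Finsupp.notMem_support_iff.1 hx, Finsupp.notMem_support_iff.1 hxB]
    · rw [Finset.mem_erase]
      constructor
      · rintro rfl
        rw [Finsupp.mem_support_iff] at hx
        apply hx
        have := (hβ x hb).ne'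
        simp [hα0 x hb]
        field_simp
        simp
      · by_contra hcon
        simp only [Finset.mem_union, not_or] at hcon
        have h1 : u x = 0 := Finsupp.notMem_support_iff.1 fun h => by
          have := hs h; simp [hcon] at this
        rw [Finsupp.mem_support_iff] at hx
        simp [h1, Finsupp.notMem_support_iff.1 hcon.1, Finsupp.notMem_support_iff.1 hcon.2] at hx
    · rw [map_sub, map_smul, map_sub, heq, sub_self, smul_zero, sub_zero, hd]
  have hunion : ∀ (u : E →₀ ℝ), (∃ b ∈ B, u.support ⊆ (A ∪ B).erase b) →
      u.support ∪ A ∈ F := by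
    rintro u ⟨b, hb, hub⟩
    exact hF.geo.down _ (hmem b hb) _ (Finset.union_subset hub (hAs b hb))
  have hfull : Full F A := fun d => by
    obtain ⟨u, h1, h2, h3⟩ := hrep d
    exact ⟨u, h1, hunion u h2, h3⟩
  have hstar : ∀ f ∈ F, A ⊆ f → ∃ b ∈ B, f ⊆ (A ∪ B).erase b := by
    intro f hf hAf
    obtain ⟨u, h1, ⟨b, hb, hub⟩, h3⟩ := hrep (Φ (ind f))
    refine ⟨b, hb, ?_⟩
    have := hF.geo.inj_off A (fun x _ => ind_nonneg f x) h1
      (by rwa [ind_support, Finset.union_eq_left.2 hAf]) (hunion u ⟨b, hb, hub⟩) h3.symm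
    rw [← ind_support f, this]
    exact hub
  have hdata : ExchData F α β := by
    refine ⟨hα, hβ, hαn, ⟨b₀, hb₀⟩, hdisj, heq, fun f hf hAf b hb => ?_⟩
    obtain ⟨b', hb', hfb⟩ := hstar f hf hAf
    refine hF.geo.down _ (hmem b hb) _ ?_
    refine Finset.union_subset ?_ (Finset.erase_subset_erase _ Finset.subset_union_right)
    exact Finset.erase_subset_erase _ (hfb.trans (Finset.erase_subset _ _))
  have hcore : core C (Φ α) := by
    rw [← hF.cone_eq]
    exact hF.geo.core_of_full (fun x => by
      by_cases hx : x ∈ A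
      · exact (hα x hx).le
      · exact (Finsupp.notMem_support_iff.1 hx).ge) hfull
  have hT := hdata.tri hF hcore
  rw [← hA, ← hBdef] at hT
  have hmem1 : ∀ f, f ∈ exch F A B ↔ (f ∈ F ∧ ¬ A ⊆ f) ∨ ∃ A', A' ⊂ A ∧ f = A' ∪ B := by
    intro f
    rw [mem_exch]
    constructor
    · rintro ⟨h1, h2 | ⟨hBf, g, hg, hAg, hfg⟩⟩
      · exact Or.inl ⟨h2, h1⟩
      · obtain ⟨b, hb, hgb⟩ := hstar g hg hAg
        refine Or.inr ⟨f ∩ A, ⟨Finset.inter_subset_right, fun h => h1 (h.trans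
            Finset.inter_subset_left)⟩, ?_⟩
        ext x
        constructor
        · intro hx
          rcases Finset.mem_union.1 (hfg hx) with h | h
          · rcases Finset.mem_union.1 (Finset.mem_of_mem_erase (hgb h)) with h | h
            · exact Finset.mem_union_left _ (Finset.mem_inter.2 ⟨hx, h⟩)
            · exact Finset.mem_union_right _ h
          · exact Finset.mem_union_right _ h
        · intro hx
          rcases Finset.mem_union.1 hx with h | h
          · exact (Finset.mem_inter.1 h).1
          · exact hBf h
    · rintro (⟨h1, h2⟩ | ⟨A', hA', rfl⟩)
      · exact ⟨h2, Or.inl h1⟩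
      · refine ⟨fun h => hA'.2 fun x hx => ?_, Or.inr ⟨Finset.subset_union_right, A, hAF,
          subset_rfl,
          Finset.union_subset_union_left hA'.1⟩⟩
        rcases Finset.mem_union.1 (h hx) with h | h
        · exact h
        · exact absurd h (Finset.disjoint_left.1 hdisj hx)
  have hstar' : ∀ f, (f ∈ F ∧ A ⊆ f) ↔ ∃ B', B' ⊂ B ∧ f = A ∪ B' := by
    intro f
    constructor
    · rintro ⟨hf, hAf⟩
      obtain ⟨b, hb, hfb⟩ := hstar f hf hAf
      refine ⟨f ∩ B, ⟨Finset.inter_subset_right, fun h => ?_⟩, ?_⟩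
      · have := hfb (Finset.mem_inter.1 (h hb)).1
        simp at this
      · ext x
        constructor
        · intro hx
          rcases Finset.mem_union.1 (Finset.mem_of_mem_erase (hfb hx)) with h | h
          · exact Finset.mem_union_left _ h
          · exact Finset.mem_union_right _ (Finset.mem_inter.2 ⟨hx, h⟩)
        · intro hx
          rcases Finset.mem_union.1 hx with h | h
          · exact hAf h
          · exact (Finset.mem_inter.1 h).1
    · rintro ⟨B', hB', rfl⟩
      obtain ⟨b, hb, hbB'⟩ := Finset.not_subset.1 hB'.2
      refine ⟨hF.geo.down _ (hmem b hb) _ (Finset.union_subset (hAs b hb) fun x hx => ?_),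
        Finset.subset_union_left⟩
      exact Finset.mem_erase.2 ⟨by rintro rfl; exact hbB' hx, Finset.mem_union_right _ (hB'.1 hx)⟩
  refine ⟨exch F A B, hT, ?_, hstar', hmem1, ?_⟩
  · refine ⟨A, B, hαn, ⟨b₀, hb₀⟩, hdisj, hcard, hAF, hB, ?_, ?_, hstar', ?_, ?_⟩
    · exact (hmem1 B).2 (Or.inr ⟨∅, Finset.empty_ssubset.2 hαn, by simp⟩)
    · exact fun h => (mem_exch.1 h).1 subset_rfl
    · intro f
      constructor
      · rintro ⟨hf, hBf⟩
        rcases (hmem1 f).1 hf with h | h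
        · exact absurd (hF.geo.down _ h.1 _ hBf) hB
        · exact h
      · rintro ⟨A', hA', rfl⟩
        exact ⟨(hmem1 _).2 (Or.inr ⟨A', hA', rfl⟩), Finset.subset_union_right⟩
    · intro f hAf hBf
      rw [hmem1]
      constructor
      · exact fun h => Or.inl ⟨h, hAf⟩
      · rintro (h | ⟨A', _, rfl⟩)
        · exact h.1
        · exact absurd Finset.subset_union_right hBf
  · set T := (tops F).filter (fun f => ¬ A ⊆ f) with hTdef
    have hinj : Set.InjOn (fun x => (A ∪ B).erase x) ((A ∪ B : Finset E) : Set E) :=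
      Finset.erase_injOn _
    have h1 : tops F = T ∪ B.image (fun x => (A ∪ B).erase x) := by
      ext σ
      simp only [hTdef, Finset.mem_union, Finset.mem_filter, Finset.mem_image, mem_tops]
      constructor
      · rintro ⟨h, hc⟩
        by_cases hAσ : A ⊆ σ
        · obtain ⟨b, hb, hσ⟩ := hstar σ h hAσ
          exact Or.inr ⟨b, hb, (Finset.eq_of_subset_of_card_le hσ (by rw [htop b hb, hc])).symm⟩
        · exact Or.inl ⟨⟨h, hc⟩, hAσ⟩
      · rintro (h | ⟨b, hb, rfl⟩)
        · exact h.1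
        · exact ⟨hmem b hb, htop b hb⟩
    have h2 : tops (exch F A B) = T ∪ A.image (fun x => (A ∪ B).erase x) := by
      ext σ
      simp only [hTdef, Finset.mem_union, Finset.mem_filter, Finset.mem_image, mem_tops, hmem1]
      constructor
      · rintro ⟨h | ⟨A', hA', rfl⟩, hc⟩
        · exact Or.inl ⟨⟨h.1, hc⟩, h.2⟩
        · obtain ⟨a, ha, haA'⟩ := Finset.not_subset.1 hA'.2
          refine Or.inr ⟨a, ha, (Finset.eq_of_subset_of_card_le (fun x hx => ?_) ?_).symm⟩
          · refine Finset.mem_erase.2 ⟨?_, Finset.union_subset_union_left hA'.1 hx⟩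
            rintro rfl
            rcases Finset.mem_union.1 hx with h | h
            · exact haA' h
            · exact Finset.disjoint_left.1 hdisj ha h
          · rw [Finset.card_erase_of_mem (Finset.mem_union_left _ ha), hcAB, hc]; simp
      · rintro (⟨⟨h1, h2⟩, h3⟩ | ⟨a, ha, rfl⟩)
        · exact ⟨Or.inl ⟨h1, h3⟩, h2⟩
        · refine ⟨Or.inr ⟨A.erase a, Finset.erase_ssubset ha, ?_⟩, ?_⟩
          · rw [Finset.erase_union_distrib, Finset.erase_eq_of_notMem (s := B)
              (Finset.disjoint_left.1 hdisj ha)]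
          · rw [Finset.card_erase_of_mem (Finset.mem_union_left _ ha), hcAB]; simp
    have hd1 : Disjoint T (B.image (fun x => (A ∪ B).erase x)) := by
      rw [Finset.disjoint_left]
      rintro σ hσ hσ'
      obtain ⟨b, hb, rfl⟩ := Finset.mem_image.1 hσ'
      exact (Finset.mem_filter.1 hσ).2 (hAs b hb)
    have hd2 : Disjoint T (A.image (fun x => (A ∪ B).erase x)) := by
      rw [Finset.disjoint_left]
      rintro σ hσ hσ'
      obtain ⟨a, ha, rfl⟩ := Finset.mem_image.1 hσ'
      refine hB (hF.geo.down _ (mem_tops.1 (Finset.mem_filter.1 hσ).1).1 _ fun x hx => ?_)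
      exact Finset.mem_erase.2 ⟨by rintro rfl; exact Finset.disjoint_left.1 hdisj ha hx,
        Finset.mem_union_right _ hx⟩
    rw [h1, h2, chn_union hd1, chn_union hd2, bd_single, Finset.sum_union hdisj, chn, chn, chn,
      Finset.sum_image (hinj.mono (by simp)), Finset.sum_image (hinj.mono (by simp))]
    rw [add_assoc, add_comm (∑ x ∈ B, _), Chain.add_add_cancel]

end FiniteDim

end GeoFlip

namespace GeoFlip

variable {C : Set (E × ℝ)} {B₀ : Finset (Finset E)} {F : Finset (Finset E)}
variable [FiniteDimensional ℝ E]

/-- Flip at a top and a vertex which sees only facets already joined to it. -/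
lemma Tri.exists_vertex_flip (hF : Tri C B₀ F) {ρ : Finset E} (hρ : ρ ∈ tops F) {v : E}
    (hv : v ∉ ρ) (hne : ∀ x ∈ ρ, cw ρ (hom v) x ≠ 0)
    (hvis : ∀ x ∈ ρ, cw ρ (hom v) x < 0 → insert v (ρ.erase x) ∈ F) :
    ∃ F₁, Flip C B₀ F (ρ.filter fun x => 0 < cw ρ (hom v) x)
      (insert v (ρ.filter fun x => cw ρ (hom v) x < 0)) F₁ := by
  obtain ⟨hρF, hρc⟩ := mem_tops.1 hρ
  obtain ⟨hs, hu⟩ := hF.geo.cw_spec hρF hρc (hom v)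
  have hsum := hF.geo.sum_cw hρF hρc (hom v)
  set u := cw ρ (hom v) with hudef
  let α : E →₀ ℝ := u.mapRange (fun t => max t 0) (by simp)
  let γ : E →₀ ℝ := u.mapRange (fun t => max (-t) 0) (by simp)
  let β : E →₀ ℝ := Finsupp.single v 1 + γ
  have hout : ∀ x ∉ ρ, u x = 0 := fun x hx => Finsupp.notMem_support_iff.1 fun h => hx (hs h)
  have hα : ∀ x, α x = max (u x) 0 := fun x => by simp [α]
  have hγ : ∀ x, γ x = max (-u x) 0 := fun x => by simp [γ]
  have hβ : ∀ x, β x = (if v = x then 1 else 0) + max (-u x) 0 := fun x => by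
    simp only [β, Finsupp.add_apply, hγ, Finsupp.single_apply]
  have hαs : α.support = ρ.filter fun x => 0 < u x := by
    ext x
    rw [Finsupp.mem_support_iff, hα, Finset.mem_filter]
    constructor
    · intro h
      have h0 : 0 < u x := by
        by_contra! h'; exact h (max_eq_right h')
      exact ⟨hs (Finsupp.mem_support_iff.2 h0.ne'), h0⟩
    · rintro ⟨_, h⟩
      rw [max_eq_left h.le]; exact h.ne'
  have hβpos : ∀ x, 0 ≤ β x := fun x => by
    rw [hβ]; split_ifs <;> positivity
  have hβs : β.support = insert v (ρ.filter fun x => u x < 0) := by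
    ext x
    rw [Finsupp.mem_support_iff, hβ, Finset.mem_insert, Finset.mem_filter]
    constructor
    · intro h
      by_cases hx : v = x
      · exact Or.inl hx.symm
      · have h0 : u x < 0 := by
          by_contra! h'
          rw [if_neg hx, max_eq_right (by linarith), add_zero] at h
          exact h rfl
        exact Or.inr ⟨hs (Finsupp.mem_support_iff.2 h0.ne), h0⟩
    · rintro (rfl | ⟨_, h⟩)
      · simp; positivity
      · rw [max_eq_left (by linarith)]
        have : (0 : ℝ) ≤ if v = x then 1 else 0 := by split_ifs <;> simp
        intro hh; linarith
  have heq : Φ α = Φ β := by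
    have h1 : u = α - γ := by
      ext x
      rw [Finsupp.sub_apply, hα, hγ]
      rcases le_total (u x) 0 with h | h
      · rw [max_eq_right h, max_eq_left (by linarith)]; ring
      · rw [max_eq_left h, max_eq_right (by linarith)]; ring
    have h2 : Φ α - Φ γ = hom v := by rw [← map_sub, ← h1, hu]
    simp only [β, map_add, Φ_single, one_smul]
    rw [← h2, sub_add_cancel]
  have hdisj : Disjoint α.support β.support := by
    rw [hαs, hβs, Finset.disjoint_left]
    intro x hx hx'
    rw [Finset.mem_filter] at hx
    rcases Finset.mem_insert.1 hx' with rfl | h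
    · exact hv hx.1
    · rw [Finset.mem_filter] at h; linarith [hx.2, h.2]
  have hunion : α.support ∪ β.support = insert v ρ := by
    rw [hαs, hβs]
    ext x
    simp only [Finset.mem_union, Finset.mem_filter, Finset.mem_insert]
    constructor
    · tauto
    · rintro (h | h)
      · tauto
      · rcases lt_or_gt_of_ne (hne x h) with h' | h' <;> tauto
  have hαn : α.support.Nonempty := by
    rw [hαs]
    have : ∑ x ∈ ρ, (0 : ℝ) < ∑ x ∈ ρ, u x := by rw [hsum]; simp [hom]
    obtain ⟨x, hx, h⟩ := Finset.exists_lt_of_sum_lt this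
    exact ⟨x, Finset.mem_filter.2 ⟨hx, h⟩⟩
  rw [← hαs, ← hβs]
  refine hF.exists_flip ?_ ?_ hαn ⟨v, by rw [hβs]; simp⟩ hdisj heq ?_ ?_ ?_
  · intro x hx
    rw [hαs, Finset.mem_filter] at hx
    rw [hα]; exact lt_max_of_lt_left hx.2
  · intro x hx
    exact lt_of_le_of_ne (hβpos x) (Finsupp.mem_support_iff.1 hx).symm
  · rw [← Finset.card_union_of_disjoint hdisj, hunion, Finset.card_insert_of_notMem hv, hρc]
  · intro b hb
    rw [hunion]
    rw [hβs] at hb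
    rcases Finset.mem_insert.1 hb with rfl | h
    · rwa [Finset.erase_insert hv]
    · rw [Finset.mem_filter] at h
      rw [Finset.erase_insert_of_ne (by rintro rfl; exact hv h.1)]
      exact hvis b h.1 h.2
  · intro hB
    have hA : α.support ∈ F := hF.geo.down _ hρF _ (by rw [hαs]; exact Finset.filter_subset _ _)
    have := hF.geo.inj α β (fun x => by rw [hα]; exact le_max_right _ _) hβpos hA hB heq
    rw [this, disjoint_self] at hdisj
    rw [← this] at hdisj
    exact hαn.ne_empty hdisj

lemma filter_union_insert {ρ : Finset E} {v : E} {u : E → ℝ} (hne : ∀ x ∈ ρ, u x ≠ 0) :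
    (ρ.filter fun x => 0 < u x) ∪ insert v (ρ.filter fun x => u x < 0) = insert v ρ := by
  ext x
  simp only [Finset.mem_union, Finset.mem_filter, Finset.mem_insert]
  constructor
  · tauto
  · rintro (h | h)
    · tauto
    · rcases lt_or_gt_of_ne (hne x h) with h' | h' <;> tauto

/-- Two distinct tops through a common facet, as seen from a point. -/
lemma Geo.facet_neg_iff (hF : Geo F) {ρ ρ' : Finset E} (hρ : ρ ∈ tops F) (hρ' : ρ' ∈ tops F)
    (hne : ρ ≠ ρ') {x x' : E} (hx : x ∈ ρ) (hx' : x' ∈ ρ') (he : ρ.erase x = ρ'.erase x')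
    (y : E × ℝ) : cw ρ y x < 0 ↔ 0 < cw ρ' y x' := by
  rw [mem_tops] at hρ hρ'
  have e1 : insert x (ρ.erase x) = ρ := Finset.insert_erase hx
  have e2 : insert x' (ρ.erase x) = ρ' := by rw [he]; exact Finset.insert_erase hx'
  have h := hF.neg_iff_pos (τ := ρ.erase x) (c := x) (c' := x') (Finset.notMem_erase _ _)
    (by rw [he]; exact Finset.notMem_erase _ _)
    (by rintro rfl; exact hne (e1.symm.trans e2)) (by rw [e1]; exact hρ.1)
    (by rw [e2]; exact hρ'.1) (by rw [e1]; exact hρ.2) y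
  rwa [e1, e2] at h

lemma exists_erase_of_subset {ρ ρ' : Finset E} {x : E} (hx : x ∈ ρ) (hc : ρ.card = ρ'.card)
    (h : ρ.erase x ⊆ ρ') : ∃ x' ∈ ρ', ρ.erase x = ρ'.erase x' := by
  have : ∃ x' ∈ ρ', x' ∉ ρ.erase x := by
    by_contra! hcon
    have := Finset.card_le_card hcon
    rw [Finset.card_erase_of_mem hx, ← hc] at this
    have := Finset.card_pos.2 ⟨x, hx⟩
    omega
  obtain ⟨x', hx', hn⟩ := this
  refine ⟨x', hx', Finset.eq_of_subset_of_card_le (fun y hy => ?_) ?_⟩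
  · exact Finset.mem_erase.2 ⟨by rintro rfl; exact hn hy, h hy⟩
  · rw [Finset.card_erase_of_mem hx', Finset.card_erase_of_mem hx, hc]

/-- Radial starring: cone off a family of tops, sorted by visibility from `v`. -/
lemma Tri.exists_radial {κ : Type*} [LinearOrder κ] (hF : Tri C B₀ F) {v : E} (r : Finset E → κ)
    {D : Finset (Finset E)} (hD : D ⊆ tops F) (hv : ∀ ρ ∈ D, v ∉ ρ)
    (hne : ∀ ρ ∈ D, ∀ x ∈ ρ, cw ρ (hom v) x ≠ 0)
    (hvis : ∀ ρ ∈ D, ∀ x ∈ ρ, cw ρ (hom v) x < 0 →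
      insert v (ρ.erase x) ∈ F ∨ ∃ ρ' ∈ D, r ρ' < r ρ ∧ ρ.erase x ⊆ ρ') :
    ∃ F', Tri C B₀ F' ∧ Conn C B₀ F F' ∧
      chn (tops F') = chn (tops F) + chn D + cn v (bd (chn D)) := by
  induction D using Finset.strongInduction generalizing F with
  | H D ih =>
    rcases D.eq_empty_or_nonempty with rfl | hDn
    · exact ⟨F, hF, Conn.refl _, by simp [chn]⟩
    obtain ⟨ρ, hρ, hmin⟩ := Finset.exists_min_image D r hDn
    have hρv : ∀ x ∈ ρ, cw ρ (hom v) x < 0 → insert v (ρ.erase x) ∈ F := by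
      intro x hx hneg
      rcases hvis ρ hρ x hx hneg with h | ⟨ρ', hρ', hlt, -⟩
      · exact h
      · exact absurd (hmin ρ' hρ') (not_le.2 hlt)
    obtain ⟨F₁, hF₁⟩ := hF.exists_vertex_flip (hD hρ) (hv ρ hρ) (hne ρ hρ) hρv
    have hstay : ∀ σ ∈ F, (∀ b, b ∈ insert v (ρ.filter fun x => cw ρ (hom v) x < 0) →
        ¬ σ ⊆ (insert v ρ).erase b) → σ ∈ F₁ := by
      intro σ hσ hn
      refine (hF₁.mem σ).2 (Or.inl ⟨hσ, fun hA => ?_⟩)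
      obtain ⟨B', hB', rfl⟩ := (hF₁.star σ).1 ⟨hσ, hA⟩
      obtain ⟨b, hb, hbB'⟩ := Finset.not_subset.1 hB'.2
      refine hn b hb fun x hx => ?_
      rw [← filter_union_insert (hne ρ hρ)]
      refine Finset.mem_erase.2 ⟨?_, Finset.union_subset_union_right hB'.1 hx⟩
      rintro rfl
      rcases Finset.mem_union.1 hx with h | h
      · rw [Finset.mem_filter] at h
        rcases Finset.mem_insert.1 hb with rfl | h'
        · exact hv ρ hρ h.1
        · rw [Finset.mem_filter] at h'; linarith [h.2, h'.2]
      · exact hbB' h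
    have hsub : ∀ σ ∈ D.erase ρ, ∀ x, σ.erase x ⊆ ρ → x ∈ σ →
        ∃ y ∈ ρ, σ.erase x = ρ.erase y ∧ (cw σ (hom v) x < 0 ↔ 0 < cw ρ (hom v) y) := by
      intro σ hσ x hx hxσ
      obtain ⟨hne', hσD⟩ := Finset.mem_erase.1 hσ
      obtain ⟨y, hy, he⟩ := exists_erase_of_subset hxσ
        ((mem_tops.1 (hD hσD)).2.trans (mem_tops.1 (hD hρ)).2.symm) hx
      exact ⟨y, hy, he, hF.geo.facet_neg_iff (hD hσD) (hD hρ) hne' hxσ hy he _⟩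
    obtain ⟨F', hF', hconn, hch⟩ := ih (D.erase ρ) (Finset.erase_ssubset hρ) (F := F₁) hF₁.tri
      (fun σ hσ => by
        obtain ⟨hne', hσD⟩ := Finset.mem_erase.1 hσ
        obtain ⟨hσF, hσc⟩ := mem_tops.1 (hD hσD)
        refine mem_tops.2 ⟨hstay σ hσF fun b hb hsub' => hne' ?_, hσc⟩
        refine Finset.eq_of_subset_of_card_le (fun x hx => ?_) (by rw [hσc, (mem_tops.1 (hD hρ)).2])
        rcases Finset.mem_insert.1 (Finset.mem_of_mem_erase (hsub' hx)) with rfl | h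
        · exact absurd hx (hv σ hσD)
        · exact h)
      (fun σ hσ => hv σ (Finset.mem_of_mem_erase hσ))
      (fun σ hσ => hne σ (Finset.mem_of_mem_erase hσ))
      (fun σ hσ x hx hneg => by
        obtain ⟨hne', hσD⟩ := Finset.mem_erase.1 hσ
        have hmain : σ.erase x ⊆ ρ → insert v (σ.erase x) ∈ F₁ := by
          intro hsub'
          obtain ⟨y, hy, he, hiff⟩ := hsub σ hσ x hsub' hx
          have hypos := hiff.1 hneg
          refine (hF₁.mem _).2 (Or.inr ⟨(ρ.filter fun x => 0 < cw ρ (hom v) x).erase y, ?_, ?_⟩)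
          · exact Finset.erase_ssubset (Finset.mem_filter.2 ⟨hy, hypos⟩)
          · rw [he, ← Finset.erase_insert_of_ne (by rintro rfl; exact hv ρ hρ hy),
              ← filter_union_insert (hne ρ hρ), Finset.erase_union_distrib,
              Finset.erase_eq_of_notMem (s := insert v _)]
            simp only [Finset.mem_insert, Finset.mem_filter, not_or, not_and, not_lt]
            exact ⟨by rintro rfl; exact hv ρ hρ hy, fun _ => hypos.le⟩
        rcases hvis σ hσD x hx hneg with h | ⟨ρ', hρ', hlt, hsub'⟩
        · left
          by_cases hsub' : σ.erase x ⊆ ρ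
          · exact hmain hsub'
          · refine hstay _ h fun b hb hcon => hsub' fun z hz => ?_
            rcases Finset.mem_insert.1 (Finset.mem_of_mem_erase (hcon (Finset.mem_insert_of_mem
                hz)))
              with rfl | h'
            · exact absurd (Finset.mem_of_mem_erase hz) (hv σ hσD)
            · exact h'
        · by_cases hρρ' : ρ' = ρ
          · subst hρρ'
            exact Or.inl (hmain hsub')
          · exact Or.inr ⟨ρ', Finset.mem_erase.2 ⟨hρρ', hρ'⟩, hlt, hsub'⟩)
    refine ⟨F', hF', Conn.trans (Relation.ReflTransGen.single ⟨hF, hF₁.tri, hF₁.move⟩) hconn, ?_⟩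
    have hsplit : chn D = chn (D.erase ρ) + Finsupp.single ρ 1 := by
      rw [chn, chn, Finset.sum_erase_add _ _ hρ]
    rw [hch, hF₁.chain, filter_union_insert (hne ρ hρ), bd_cn_single (hv ρ hρ), hsplit,
      map_add, map_add]
    abel

/-- A vertex avoiding the coordinate hyperplanes of a top is not one of its vertices. -/
lemma Geo.notMem_of_cw_ne (hF : Geo F) (hE : 2 ≤ topCard E) {ρ : Finset E} (hρ : ρ ∈ tops F)
    {v : E} (hne : ∀ x ∈ ρ, cw ρ (hom v) x ≠ 0) : v ∉ ρ := by
  intro hv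
  obtain ⟨hρF, hρc⟩ := mem_tops.1 hρ
  obtain ⟨x, hx, hxv⟩ := Finset.exists_mem_ne (by omega : 1 < ρ.card) v
  apply hne x hx
  rw [hF.cw_hom hρF hρc hv, Finsupp.single_apply, if_neg hxv.symm]

lemma Tri.core_of_pos (hF : Tri C B₀ F) {ρ : Finset E} (hρ : ρ ∈ tops F) {y : E × ℝ}
    (h : ∀ x ∈ ρ, 0 < cw ρ y x) : core C y := by
  obtain ⟨hρF, hρc⟩ := mem_tops.1 hρ
  obtain ⟨hs, hy⟩ := hF.geo.cw_spec hρF hρc y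
  have hsupp : (cw ρ y).support = ρ :=
    Finset.Subset.antisymm hs fun x hx => Finsupp.mem_support_iff.2 (h x hx).ne'
  rw [← hF.cone_eq, ← hy]
  refine hF.geo.core_of_full (fun x => ?_) (by rw [hsupp]; exact hF.geo.full_top hρF hρc)
  by_cases hx : x ∈ ρ
  · exact (h x hx).le
  · exact (hF.geo.cw_apply_eq_zero hρF hρc hx y).ge

/-- If visible facets of a nonempty family can always be passed, the point is interior. -/
lemma Tri.core_of_radial {κ : Type*} [LinearOrder κ] (hF : Tri C B₀ F) {v : E}
    (r : Finset E → κ) {D : Finset (Finset E)} (hD : D ⊆ tops F) (hDn : D.Nonempty)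
    (hne : ∀ ρ ∈ D, ∀ x ∈ ρ, cw ρ (hom v) x ≠ 0)
    (hvis : ∀ ρ ∈ D, ∀ x ∈ ρ, cw ρ (hom v) x < 0 → ∃ ρ' ∈ D, r ρ' < r ρ ∧ ρ.erase x ⊆ ρ') :
    core C (hom v) := by
  obtain ⟨ρ, hρ, hmin⟩ := Finset.exists_min_image D r hDn
  refine hF.core_of_pos (hD hρ) fun x hx => ?_
  refine lt_of_le_of_ne ?_ (hne ρ hρ x hx).symm
  by_contra! hneg
  obtain ⟨ρ', hρ', hlt, -⟩ := hvis ρ hρ x hx hneg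
  exact absurd (hmin ρ' hρ') (not_le.2 hlt)

section Boundary

lemma bd_chn_apply (D : Finset (Finset E)) (τ : Finset E) :
    bd (chn D) τ =
      ((D.filter fun ρ => ∃ c, c ∉ τ ∧ ρ = insert c τ).card : ZMod 2) := by
  rw [chn, map_sum, Finsupp.finsetSum_apply, Finset.card_filter]
  push_cast
  refine Finset.sum_congr rfl fun ρ _ => ?_
  rw [bd_single, Finsupp.finsetSum_apply]
  split_ifs with h
  · obtain ⟨c, hc, rfl⟩ := h
    rw [Finset.sum_eq_single c]
    · simp [Finset.erase_insert hc]
    · intro b hb hbc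
      rw [Finsupp.single_apply, if_neg]
      intro h
      apply hc
      rw [← h]
      exact Finset.mem_erase.2 ⟨hbc.symm, Finset.mem_insert_self _ _⟩
    · intro h; simp at h
  · refine Finset.sum_eq_zero fun x hx => ?_
    rw [Finsupp.single_apply, if_neg]
    rintro rfl
    exact h ⟨x, Finset.notMem_erase _ _, (Finset.insert_erase hx).symm⟩

/-- Facets with tops on both sides are full. -/
lemma Geo.full_of_two (hF : Geo F) {τ : Finset E} {c c' : E} (hc : c ∉ τ) (hc' : c' ∉ τ)
    (hcc : c ≠ c') (h : insert c τ ∈ tops F) (h' : insert c' τ ∈ tops F) : Full F τ := by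
  obtain ⟨h1, h2⟩ := mem_tops.1 h
  obtain ⟨h1', h2'⟩ := mem_tops.1 h'
  have key : ∀ b, b ∉ τ → insert b τ ∈ F → (insert b τ).card = topCard E → ∀ d,
      0 ≤ cw (insert b τ) d b →
      ∃ u : E →₀ ℝ, (∀ x ∉ τ, 0 ≤ u x) ∧ u.support ∪ τ ∈ F ∧ Φ u = d := by
    intro b hb hbF hbc d hd
    obtain ⟨hs, he⟩ := hF.cw_spec hbF hbc d
    refine ⟨cw (insert b τ) d, fun x hx => ?_,
      hF.down _ hbF _ (Finset.union_subset hs (Finset.subset_insert _ _)), he⟩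
    by_cases hxb : x = b
    · subst hxb; exact hd
    · exact (hF.cw_apply_eq_zero hbF hbc (by simp [hxb, hx]) d).ge
  intro d
  rcases lt_or_ge (cw (insert c τ) d c) 0 with hd | hd
  · exact key c' hc' h1' h2' d ((hF.neg_iff_pos hc hc' hcc h1 h1' h2 d).1 hd).le
  · exact key c hc h1 h2 d hd

/-- The tops at a full facet come in pairs. -/
lemma Geo.card_tops_full (hF : Geo F) {τ : Finset E} (hτ : Full F τ) :
    (((tops F).filter fun ρ => ∃ c, c ∉ τ ∧ ρ = insert c τ).card : ZMod 2) = 0 := by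
  by_cases hem : (tops F).filter (fun ρ => ∃ c, c ∉ τ ∧ ρ = insert c τ) = ∅
  · rw [hem]; simp
  obtain ⟨ρ, hρ⟩ := Finset.nonempty_iff_ne_empty.2 hem
  obtain ⟨hρ, c, hc, rfl⟩ := Finset.mem_filter.1 hρ
  obtain ⟨hρF, hρc⟩ := mem_tops.1 hρ
  obtain ⟨c', hc', hne, hF', hneg⟩ := hF.exists_other hc hτ hρF hρc (y := - hom c) (by
    rw [map_neg, hF.cw_hom hρF hρc (Finset.mem_insert_self _ _)]; simp)
  have hcard' : (insert c' τ).card = topCard E := by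
    rw [← hρc, Finset.card_insert_of_notMem hc, Finset.card_insert_of_notMem hc']
  have : (tops F).filter (fun ρ => ∃ c, c ∉ τ ∧ ρ = insert c τ) = {insert c τ, insert c' τ} := by
    ext σ
    simp only [Finset.mem_filter, Finset.mem_insert, Finset.mem_singleton]
    constructor
    · rintro ⟨hσ, b, hb, rfl⟩
      obtain ⟨hσF, hσc⟩ := mem_tops.1 hσ
      by_contra! hcon
      have hbc : c ≠ b := by rintro rfl; exact hcon.1 rfl
      have hbc' : c' ≠ b := by rintro rfl; exact hcon.2 rfl
      have h1 := hF.two_sides hc hb hbc hρF hσF hρc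
      have h2 := (hF.neg_iff_pos hc hc' hne.symm hρF hF' hρc (hom b)).1 h1
      have h3 := hF.two_sides hc' hb hbc' hF' hσF hcard'
      linarith
    · rintro (rfl | rfl)
      · exact ⟨hρ, c, hc, rfl⟩
      · exact ⟨mem_tops.2 ⟨hF', hcard'⟩, c', hc', rfl⟩
  rw [this, Finset.card_pair]
  · exact CharTwo.two_eq_zero
  · intro h
    have : c ∈ insert c' τ := by rw [← h]; simp
    simp [hne.symm, hc] at this

/-- Tops at a boundary facet, if present, are determined by the cone. -/
lemma Tri.exists_bdry_top {F' : Finset (Finset E)} (hF : Tri C B₀ F) (hF' : Tri C B₀ F')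
    {τ : Finset E} (hi : ¬ Inn C τ) {c : E} (hc : c ∉ τ) (h : insert c τ ∈ tops F) :
    ∃ c', c' ∉ τ ∧ insert c' τ ∈ tops F' := by
  obtain ⟨h1, h2⟩ := mem_tops.1 h
  have hτF : τ ∈ F := hF.geo.down _ h1 _ (Finset.subset_insert _ _)
  have hτF' : τ ∈ F' := by rw [hF'.bdry τ hi, ← hF.bdry τ hi]; exact hτF
  obtain ⟨p, hp, hps, hpe⟩ := hF'.geo.exists_star_weight (ind_nonneg τ) (by rwa [ind_support])
    (Finset.empty_subset _) (hom c) 0 (fun M _ => by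
      have : hom c + (M : ℝ) • Φ (ind τ) ∈ cone F := by
        refine ⟨Finsupp.single c 1 + (M : ℝ) • ind τ, ?_, ?_, ?_⟩
        · exact add_nonneg (by simp) (smul_nonneg (by positivity) (ind_nonneg τ))
        · refine hF.geo.down _ h1 _ ((support_add_smul_ind _ _ _).trans ?_)
          exact Finset.union_subset (Finsupp.support_single_subset.trans (by simp))
            (Finset.subset_insert _ _)
        · rw [map_add, map_smul, Φ_single, one_smul]
      rw [hF.cone_eq, ← hF'.cone_eq] at this
      obtain ⟨w, hw, hws, hwe⟩ := this
      exact ⟨w, fun x _ => hw x, by simpa using hws, hwe⟩)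
  rw [ind_support] at hp hps
  have hx : ∃ x ∈ p.support, x ∉ τ := by
    by_contra! hcon
    have := hF.geo.inj_on h1 (u := p) (u' := Finsupp.single c 1)
      (fun x hx => Finset.mem_insert_of_mem (hcon x hx))
      (Finsupp.support_single_subset.trans (by simp)) (by rw [hpe, Φ_single, one_smul])
    exact hc (hcon c (by rw [this]; simp))
  obtain ⟨x, hx, hxτ⟩ := hx
  refine ⟨x, hxτ, mem_tops.2 ⟨hF'.geo.down _ hps _ ?_, ?_⟩⟩
  · exact Finset.insert_subset (Finset.mem_union_left _ hx) Finset.subset_union_right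
  · rw [Finset.card_insert_of_notMem hxτ, ← h2, Finset.card_insert_of_notMem hc]

lemma Tri.card_le_one (hF : Tri C B₀ F) {τ : Finset E} (hi : ¬ Inn C τ) :
    ((tops F).filter fun ρ => ∃ c, c ∉ τ ∧ ρ = insert c τ).card ≤ 1 := by
  rw [Finset.card_le_one]
  intro σ hσ σ' hσ'
  obtain ⟨hσ, c, hc, rfl⟩ := Finset.mem_filter.1 hσ
  obtain ⟨hσ', c', hc', rfl⟩ := Finset.mem_filter.1 hσ'
  by_contra hne
  apply hi
  have hτ := hF.geo.down _ (mem_tops.1 hσ).1 _ (Finset.subset_insert c τ)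
  exact (hF.inn_iff hτ).2 (hF.geo.full_of_two hc hc' (by rintro rfl; exact hne rfl) hσ hσ')

/-- Triangulations in one class have the same boundary chain. -/
lemma Tri.bd_eq {F' : Finset (Finset E)} (hF : Tri C B₀ F) (hF' : Tri C B₀ F') :
    bd (chn (tops F)) = bd (chn (tops F')) := by
  ext τ
  rw [bd_chn_apply, bd_chn_apply]
  by_cases hi : Inn C τ
  · have key : ∀ {G}, Tri C B₀ G →
        (((tops G).filter fun ρ => ∃ c, c ∉ τ ∧ ρ = insert c τ).card : ZMod 2) = 0 := by
      intro G hG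
      by_cases hτ : τ ∈ G
      · exact hG.geo.card_tops_full ((hG.inn_iff hτ).1 hi)
      · rw [Finset.filter_eq_empty_iff.2, Finset.card_empty, Nat.cast_zero]
        rintro ρ hρ ⟨c, -, rfl⟩
        exact hτ (hG.geo.down _ (mem_tops.1 hρ).1 _ (Finset.subset_insert _ _))
    rw [key hF, key hF']
  · have key : ∀ {G G'}, Tri C B₀ G → Tri C B₀ G' →
        ((tops G).filter fun ρ => ∃ c, c ∉ τ ∧ ρ = insert c τ).card ≤
        ((tops G').filter fun ρ => ∃ c, c ∉ τ ∧ ρ = insert c τ).card := by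
      intro G G' hG hG'
      rcases Finset.eq_empty_or_nonempty ((tops G).filter fun ρ => ∃ c, c ∉ τ ∧ ρ = insert c τ)
        with h | ⟨ρ, hρ⟩
      · rw [h]; simp
      · refine (hG.card_le_one hi).trans ?_
        obtain ⟨hρ, c, hc, rfl⟩ := Finset.mem_filter.1 hρ
        obtain ⟨c', hc', h'⟩ := hG.exists_bdry_top hG' hi hc hρ
        exact Finset.card_pos.2 ⟨_, Finset.mem_filter.2 ⟨h', c', hc', rfl⟩⟩
    rw [le_antisymm (key hF hF') (key hF' hF)]

end Boundary

end GeoFlip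

namespace GeoFlip

variable {C : Set (E × ℝ)} {B₀ : Finset (Finset E)} {F : Finset (Finset E)}

/-- The barycentric coordinate at `x` as a functional. -/
noncomputable def cf (ρ : Finset E) (x : E) : E × ℝ →ₗ[ℝ] ℝ := Finsupp.lapply x ∘ₗ cw ρ

@[simp] lemma cf_apply (ρ : Finset E) (x : E) (y : E × ℝ) : cf ρ x y = cw ρ y x := rfl

lemma norm_lt_of_opposite {W : Type*} [NormedAddCommGroup W] [NormedSpace ℝ W]
    [StrictConvexSpace ℝ W] {U V : W} {k t : ℝ} (hk : k < 0) (hU : U ≠ 0)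
    (hV : ∀ s : ℝ, V ≠ s • U) : k * ‖U‖ + t * ‖V‖ < ‖k • U + t • V‖ := by
  have hUn := norm_pos_iff.2 hU
  rcases le_or_gt t 0 with ht | ht
  · have := norm_nonneg V
    have := norm_nonneg (k • U + t • V)
    nlinarith
  · have h1 : (k • U + t • V) + (-k) • U = t • V := by
      rw [neg_smul]; abel
    have h2 := norm_add_le (k • U + t • V) ((-k) • U)
    rcases h2.lt_or_eq with h | h
    · rw [h1, norm_smul, norm_smul, Real.norm_of_nonneg ht.le, Real.norm_of_nonneg (by linarith)]
        at h
      linarith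
    · exfalso
      obtain ⟨r, _, hr⟩ := (sameRay_iff_norm_add.2 h).exists_nonneg_right
        (smul_ne_zero (by linarith) hU)
      rw [hr] at h1
      apply hV (t⁻¹ * (r * (-k) + -k))
      rw [mul_smul, add_smul, mul_smul, h1, smul_smul, inv_mul_cancel₀ ht.ne', one_smul]

variable [FiniteDimensional ℝ E]

lemma exists_proj (A : Finset E) : ∃ (k : ℕ) (π : E × ℝ →ₗ[ℝ] EuclideanSpace ℝ (Fin k)),
    ∀ y, π y = 0 ↔ ∃ w : E →₀ ℝ, w.support ⊆ A ∧ Φ w = y := by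
  let S : Submodule ℝ (E × ℝ) := Submodule.span ℝ (hom '' (A : Set E))
  let e : ((E × ℝ) ⧸ S) ≃ₗ[ℝ] EuclideanSpace ℝ (Fin (Module.finrank ℝ ((E × ℝ) ⧸ S))) :=
    LinearEquiv.ofFinrankEq _ _ (by simp)
  refine ⟨_, e.toLinearMap ∘ₗ S.mkQ, fun y => ?_⟩
  rw [LinearMap.comp_apply, LinearEquiv.coe_coe, LinearEquiv.map_eq_zero_iff, Submodule.mkQ_apply,
    Submodule.Quotient.mk_eq_zero, Finsupp.mem_span_image_iff_linearCombination]
  simp only [Finsupp.mem_supported, Finset.coe_subset, Φ]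

/-- In low dimension the fan around `A` carries a strictly convex piecewise linear function. -/
lemma Geo.exists_fan (hdim : topCard E ≤ 4) (hF : Geo F) {A : Finset E} (hA : 2 ≤ A.card) :
    ∃ ℓ : Finset E → (E × ℝ →ₗ[ℝ] ℝ), ∀ ρ ∈ tops F, ∀ ρ' ∈ tops F, A ⊆ ρ → A ⊆ ρ' →
      ρ' ≠ ρ → ∀ c ∈ ρ, ρ.erase c ⊆ ρ' → ∀ y, cw ρ y c < 0 → ℓ ρ y < ℓ ρ' y := by
  obtain ⟨k, π, hπ⟩ := exists_proj A
  set g : E → ℝ := fun x => ‖π (hom x)‖ with hg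
  have hgA : ∀ x ∈ A, π (hom x) = 0 := fun x hx => (hπ _).2
    ⟨Finsupp.single x 1, Finsupp.support_single_subset.trans (by simpa using hx), by
      rw [Φ_single, one_smul]⟩
  refine ⟨fun ρ => ∑ x ∈ ρ, g x • cf ρ x, ?_⟩
  intro ρ hρ ρ' hρ' hAρ hAρ' hne c hc hsub y hy
  obtain ⟨hρF, hρc⟩ := mem_tops.1 hρ
  obtain ⟨hρF', hρc'⟩ := mem_tops.1 hρ'
  obtain ⟨c', hc', he⟩ := exists_erase_of_subset hc (hρc.trans hρc'.symm) hsub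
  set τ := ρ.erase c with hτ
  have eρ : ρ = insert c τ := (Finset.insert_erase hc).symm
  have eρ' : ρ' = insert c' τ := by rw [he, Finset.insert_erase hc']
  have hcτ : c ∉ τ := Finset.notMem_erase _ _
  have hcτ' : c' ∉ τ := by rw [he]; exact Finset.notMem_erase _ _
  have hcc : c ≠ c' := by rintro rfl; exact hne (eρ'.trans eρ.symm)
  have hpos : 0 < cw ρ' y c' := by
    rw [eρ] at hy hρF hρc
    rw [eρ'] at hρF' ⊢
    exact (hF.neg_iff_pos hcτ hcτ' hcc hρF hρF' hρc y).1 hy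
  have hside : cw ρ (hom c') c < 0 := by
    rw [eρ] at hρF hρc ⊢
    rw [eρ'] at hρF'
    exact hF.two_sides hcτ hcτ' hcc hρF hρF' hρc
  have hcA : c ∉ A := fun h => by
    have := hAρ' h
    rw [eρ'] at this
    rcases Finset.mem_insert.1 this with h | h
    · exact hcc h
    · exact hcτ h
  have hAτ : A ⊆ τ := fun x hx => Finset.mem_erase.2 ⟨by rintro rfl; exact hcA hx, hAρ hx⟩
  set L : E × ℝ →ₗ[ℝ] ℝ := ∑ x ∈ ρ, g x • cf ρ x with hL
  have hLapp : ∀ z, L z = ∑ x ∈ ρ, g x * cw ρ z x := fun z => by simp [hL]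
  have hLτ : ∀ z ∈ τ, L (hom z) = g z := by
    intro z hz
    rw [hLapp, Finset.sum_eq_single z]
    · rw [hF.cw_hom hρF hρc (Finset.mem_of_mem_erase hz)]; simp
    · intro b _ hbz
      rw [hF.cw_hom hρF hρc (Finset.mem_of_mem_erase hz), Finsupp.single_apply, if_neg hbz.symm,
        mul_zero]
    · intro h; exact absurd (Finset.mem_of_mem_erase hz) h
  have hmain : L (hom c') < g c' := by
    have hs := hF.cw_spec hρF hρc (hom c')
    set u := cw ρ (hom c') with hu
    have hcard : (τ \ A).card ≤ 1 := by
      rw [Finset.card_sdiff_of_subset hAτ, hτ, Finset.card_erase_of_mem hc, hρc]; omega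
    have hsplitρ : ∀ (G : Type _) [AddCommMonoid G] (f : E → G),
        (∀ x ∈ A, f x = 0) → ∑ x ∈ ρ, f x = f c + ∑ x ∈ τ \ A, f x := by
      intro G _ f hf
      rw [eρ, Finset.sum_insert hcτ, ← Finset.sum_sdiff hAτ, Finset.sum_eq_zero (s := A) hf,
        add_zero]
    have hπc : π (hom c') = u c • π (hom c) + ∑ x ∈ τ \ A, u x • π (hom x) := by
      conv_lhs => rw [← hs.2]
      rw [Φ_eq_sum hs.1, map_sum, ← hsplitρ _ (fun x => u x • π (hom x))
        (fun x hx => by rw [hgA x hx, smul_zero])]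
      simp
    have hLc : L (hom c') = u c * g c + ∑ x ∈ τ \ A, u x * g x := by
      rw [hLapp, ← hsplitρ _ (fun x => u x * g x) (fun x hx => by simp [hg, hgA x hx])]
      exact Finset.sum_congr rfl fun x _ => mul_comm _ _
    have hind : ∀ w : E →₀ ℝ, w.support ⊆ ρ → π (Φ w) = 0 → w.support ⊆ A := by
      intro w hw h0
      obtain ⟨w', hw', he⟩ := (hπ _).1 h0
      rw [← hF.inj_on hρF (hw'.trans hAρ) hw he]
      exact hw'
    have hU : π (hom c) ≠ 0 := fun h => by
      have := hind (Finsupp.single c 1) (Finsupp.support_single_subset.trans (by simpa using hc))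
        (by rwa [Φ_single, one_smul])
      exact hcA (this (by simp))
    rw [hLc]
    change _ < ‖π (hom c')‖
    rw [hπc]
    rcases Finset.eq_empty_or_nonempty (τ \ A) with hem | hnem
    · rw [hem]
      simp only [Finset.sum_empty, add_zero]
      have h1 := norm_pos_iff.2 hU
      have h2 := norm_nonneg (u c • π (hom c))
      change u c * ‖π (hom c)‖ < _
      nlinarith
    · obtain ⟨b, hb⟩ := Finset.card_eq_one.1 (le_antisymm hcard (Finset.card_pos.2 hnem))
      rw [hb, Finset.sum_singleton, Finset.sum_singleton]
      have hbτ : b ∈ τ \ A := by rw [hb]; simp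
      obtain ⟨hbτ, hbA⟩ := Finset.mem_sdiff.1 hbτ
      refine norm_lt_of_opposite hside hU fun s hs' => hbA ?_
      have hbc : c ≠ b := by rintro rfl; exact hcτ hbτ
      refine hind (Finsupp.single b 1 - s • Finsupp.single c 1) ?_ ?_ ?_
      · refine Finsupp.support_sub.trans (Finset.union_subset ?_ ?_)
        · exact Finsupp.support_single_subset.trans (by simpa using Finset.mem_of_mem_erase hbτ)
        · exact Finsupp.support_smul.trans (Finsupp.support_single_subset.trans (by simpa using hc))
      · rw [map_sub, map_smul, Φ_single, Φ_single, one_smul, one_smul, map_sub, map_smul, hs',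
          sub_self]
      · rw [Finsupp.mem_support_iff]
        simp [hbc]
  have hLy : L y = ∑ z ∈ ρ', cw ρ' y z * L (hom z) := by
    conv_lhs => rw [← (hF.cw_spec hρF' hρc' y).2, Φ_eq_sum (hF.cw_spec hρF' hρc' y).1, map_sum]
    simp
  have hL'y : (∑ x ∈ ρ', g x • cf ρ' x) y = ∑ z ∈ ρ', cw ρ' y z * g z := by
    simp [mul_comm]
  rw [hL'y, hLy]
  refine Finset.sum_lt_sum (fun z hz => ?_) ⟨c', hc', mul_lt_mul_of_pos_left hmain hpos⟩
  rw [eρ'] at hz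
  rcases Finset.mem_insert.1 hz with rfl | hz
  · exact mul_le_mul_of_nonneg_left hmain.le hpos.le
  · rw [hLτ z hz]

end GeoFlip

namespace GeoFlip

open Filter Topology in
/-- A point arbitrarily close to `c` at which finitely many functionals do not vanish. -/
lemma exists_generic (c : E) (𝓛 𝓠 : Finset (E × ℝ →ₗ[ℝ] ℝ)) (h : ∀ L ∈ 𝓛, L ≠ 0) :
    ∃ v : E, (∀ L ∈ 𝓛, L (hom v) ≠ 0) ∧ ∀ L ∈ 𝓠, 0 < L (hom c) → 0 < L (hom v) := by
  have key : ∃ d : E, ∀ L ∈ 𝓛.filter (fun L => ∃ x : E, L (x, 0) ≠ 0), L (d, 0) ≠ 0 := by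
    obtain ⟨d, hd⟩ := Module.Dual.exists_forall_ne_zero_of_forall_exists (K := ℝ) (M := E)
      (fun L : ↥(𝓛.filter (fun L => ∃ x : E, L (x, 0) ≠ 0)) => L.1 ∘ₗ LinearMap.inl ℝ E ℝ)
      (fun L => by simpa using (Finset.mem_filter.1 L.2).2)
    exact ⟨d, fun L hL => by simpa using hd ⟨L, hL⟩⟩
  obtain ⟨d, hd⟩ := key
  have hhom : ∀ (ε : ℝ), hom (c + ε • d) = hom c + ε • ((d, 0) : E × ℝ) := fun ε => by
    simp [hom]
  have e1 : ∀ L ∈ 𝓛, ∀ᶠ ε in 𝓝[>] (0 : ℝ), L (hom (c + ε • d)) ≠ 0 := by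
    intro L hL
    by_cases h0 : L (hom c) = 0
    · have hx : ∃ x : E, L (x, 0) ≠ 0 := by
        by_contra! hx
        refine h L hL (LinearMap.ext fun y => ?_)
        have : y = (y.1 - y.2 • c, 0) + y.2 • hom c := by simp [hom]
        rw [this, map_add, map_smul, hx, h0]; simp
      filter_upwards [self_mem_nhdsWithin] with ε hε
      rw [hhom, map_add, h0, map_smul, zero_add, smul_eq_mul]
      exact mul_ne_zero (ne_of_gt hε) (hd L (Finset.mem_filter.2 ⟨hL, hx⟩))
    · have ht : Tendsto (fun ε : ℝ => L (hom (c + ε • d))) (𝓝[>] 0) (𝓝 (L (hom c))) := by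
        simp only [hhom, map_add, map_smul, smul_eq_mul]
        have : Continuous fun ε : ℝ => L (hom c) + ε * L (d, 0) := by fun_prop
        simpa using (this.tendsto 0).mono_left nhdsWithin_le_nhds
      exact ht.eventually_ne h0
  have e2 : ∀ L ∈ 𝓠, ∀ᶠ ε in 𝓝[>] (0 : ℝ), 0 < L (hom c) → 0 < L (hom (c + ε • d)) := by
    intro L _
    by_cases h0 : 0 < L (hom c)
    · have ht : Tendsto (fun ε : ℝ => L (hom (c + ε • d))) (𝓝[>] 0) (𝓝 (L (hom c))) := by
        simp only [hhom, map_add, map_smul, smul_eq_mul]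
        have : Continuous fun ε : ℝ => L (hom c) + ε * L (d, 0) := by fun_prop
        simpa using (this.tendsto 0).mono_left nhdsWithin_le_nhds
      filter_upwards [ht.eventually (lt_mem_nhds h0)] with ε hε _ using hε
    · exact Eventually.of_forall fun _ hh => absurd hh h0
  obtain ⟨ε, h1, h2⟩ := (((Finset.eventually_all 𝓛).2 e1).and ((Finset.eventually_all 𝓠).2
      e2)).exists
  exact ⟨_, h1, h2⟩

variable {C : Set (E × ℝ)} {B₀ : Finset (Finset E)} {F : Finset (Finset E)}

section Stell

lemma Geo.singleton_notMem (hF : Geo F) {α : E →₀ ℝ} (hα : 0 ≤ α) (hA : α.support ∈ F)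
    (h2 : 2 ≤ α.support.card) {m : E} (hm : Φ α = hom m) : {m} ∉ F := by
  intro h
  have hs : (Finsupp.single m (1 : ℝ)).support = {m} := Finsupp.support_single _ one_ne_zero
  have := hF.inj α (Finsupp.single m 1) hα (by intro x; by_cases hx : m = x <;> simp [hx])
    hA (by rw [hs]; exact h) (by rw [Φ_single, one_smul, hm])
  rw [this, hs] at h2
  simp at h2

lemma Geo.exchData_single (hF : Geo F) {α : E →₀ ℝ} (hα : 0 ≤ α) (hA : α.support ∈ F)
    (h2 : 2 ≤ α.support.card) {m : E} (hm : Φ α = hom m) :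
    ExchData F α (Finsupp.single m 1) := by
  have hs : (Finsupp.single m (1 : ℝ)).support = {m} := Finsupp.support_single _ one_ne_zero
  refine ⟨fun x hx => lt_of_le_of_ne (hα x) (Finsupp.mem_support_iff.1 hx).symm, ?_,
    Finset.card_pos.1 (by omega), by rw [hs]; simp, ?_, by rw [Φ_single, one_smul, hm], ?_⟩
  · rw [hs]; simp
  · rw [hs, Finset.disjoint_singleton_right]
    exact fun h => hF.singleton_notMem hα hA h2 hm (hF.down _ hA _ (by simpa using h))
  · rw [hs]
    intro f hf _ b hb
    rw [Finset.mem_singleton.1 hb]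
    exact hF.down _ hf _ (by simp [Finset.erase_subset])

variable [FiniteDimensional ℝ E]

lemma mem_tops_stell (hF : Geo F) {A : Finset E} {m : E} (hm : {m} ∉ F) {σ : Finset E} :
    σ ∈ tops (exch F A {m}) ↔ (σ ∈ tops F ∧ ¬ A ⊆ σ) ∨
      ∃ ρ ∈ tops F, A ⊆ ρ ∧ ∃ a ∈ A, σ = insert m (ρ.erase a) := by
  have hmf : ∀ f ∈ F, m ∉ f := fun f hf h => hm (hF.down _ hf _ (by simpa))
  constructor
  · intro h
    obtain ⟨h, hc⟩ := mem_tops.1 h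
    obtain ⟨h1, h2 | ⟨h2, g, hg, hAg, hs⟩⟩ := mem_exch.1 h
    · exact Or.inl ⟨mem_tops.2 ⟨h2, hc⟩, h1⟩
    · right
      rw [Finset.singleton_subset_iff] at h2
      have hsub : σ.erase m ⊆ g := by
        intro x hx
        have := hs (Finset.mem_of_mem_erase hx)
        simp only [Finset.mem_union, Finset.mem_singleton] at this
        exact this.resolve_right (Finset.ne_of_mem_erase hx)
      obtain ⟨a, ha, has⟩ := Finset.not_subset.1 h1
      have h3 : insert a (σ.erase m) ⊆ g := Finset.insert_subset (hAg ha) hsub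
      have h4 : (insert a (σ.erase m)).card = topCard E := by
        rw [Finset.card_insert_of_notMem (fun h => has (Finset.mem_of_mem_erase h)),
          Finset.card_erase_add_one h2, hc]
      have h5 : insert a (σ.erase m) = g :=
        Finset.eq_of_subset_of_card_le h3 (by rw [h4]; exact hF.card_le hg)
      refine ⟨g, mem_tops.2 ⟨hg, h5 ▸ h4⟩, hAg, a, ha, ?_⟩
      rw [← h5, Finset.erase_insert (fun h => has (Finset.mem_of_mem_erase h)),
        Finset.insert_erase h2]
  · rintro (⟨h1, h2⟩ | ⟨ρ, hρ, hA, a, ha, rfl⟩)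
    · exact mem_tops.2 ⟨mem_exch.2 ⟨h2, Or.inl (mem_tops.1 h1).1⟩, (mem_tops.1 h1).2⟩
    · have hρ' := mem_tops.1 hρ
      have hmρ := hmf _ hρ'.1
      refine mem_tops.2 ⟨mem_exch.2 ⟨fun h => ?_, Or.inr ⟨by simp, ρ, hρ'.1, hA, ?_⟩⟩, ?_⟩
      · have := h ha
        simp only [Finset.mem_insert, Finset.mem_erase] at this
        exact this.elim (fun h => hmρ (h ▸ hA ha)) (fun h => h.1 rfl)
      · intro x hx
        simp only [Finset.mem_insert, Finset.mem_erase, Finset.mem_union, Finset.mem_singleton] at hx ⊢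
        tauto
      · rw [Finset.card_insert_of_notMem (fun h => hmρ (Finset.mem_of_mem_erase h)),
          Finset.card_erase_add_one (hA ha), hρ'.2]

lemma cw_stell (hF : Geo F) {ρ : Finset E} (hρ : ρ ∈ tops F) {α : E →₀ ℝ} {m : E}
    (hm : Φ α = hom m) (hA : α.support ⊆ ρ) {a : E} (ha : a ∈ α.support)
    {G : Finset (Finset E)} (hG : Geo G) (hσ : insert m (ρ.erase a) ∈ tops G) (y : E × ℝ) :
    cw (insert m (ρ.erase a)) y =
      cw ρ y + (cw ρ y a / α a) • (Finsupp.single m 1 - α) := by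
  obtain ⟨h1, h2⟩ := hF.cw_spec (mem_tops.1 hρ).1 (mem_tops.1 hρ).2 y
  have hΦ : Φ (cw ρ y + (cw ρ y a / α a) • (Finsupp.single m 1 - α)) = y := by
    rw [map_add, map_smul, map_sub, Φ_single, hm, h2]; simp
  conv_lhs => rw [← hΦ]
  refine hG.cw_Φ (mem_tops.1 hσ).1 (mem_tops.1 hσ).2 fun x hx => ?_
  by_contra hn
  simp only [Finset.mem_insert, Finset.mem_erase, not_or, not_and] at hn
  have hxm : m ≠ x := Ne.symm hn.1
  rw [Finsupp.mem_support_iff] at hx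
  apply hx
  by_cases hxa : x = a
  · subst hxa
    have := Finsupp.mem_support_iff.1 ha
    simp [hxm, this]
  · have hxρ := hn.2 hxa
    have e1 : cw ρ y x = 0 := Finsupp.notMem_support_iff.1 fun h => hxρ (h1 h)
    have e2 : α x = 0 := Finsupp.notMem_support_iff.1 fun h => hxρ (hA h)
    simp [hxm, e1, e2]

lemma cf_ne_zero (hF : Geo F) {ρ : Finset E} (hρ : ρ ∈ tops F) {x : E} (hx : x ∈ ρ) :
    cf ρ x ≠ 0 := fun h => by
  have := congrArg (fun L => L (hom x)) h
  simp [hF.cw_hom (mem_tops.1 hρ).1 (mem_tops.1 hρ).2 hx] at this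

/-- All coordinate functionals of the tops of a complex. -/
noncomputable def cfs (F : Finset (Finset E)) : Finset (E × ℝ →ₗ[ℝ] ℝ) :=
  (tops F).biUnion fun ρ => ρ.image (cf ρ)

lemma mem_cfs {L : E × ℝ →ₗ[ℝ] ℝ} : L ∈ cfs F ↔ ∃ ρ ∈ tops F, ∃ x ∈ ρ, cf ρ x = L := by
  simp [cfs]

lemma cfs_ne_zero (hF : Geo F) : ∀ L ∈ cfs F, L ≠ 0 := fun L hL => by
  obtain ⟨ρ, hρ, x, hx, rfl⟩ := mem_cfs.1 hL
  exact cf_ne_zero hF hρ hx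

/-- Stellar subdivision at an interior simplex is a composition of moves. -/
lemma Tri.stell (hdim : topCard E ≤ 4) (hE : 2 ≤ topCard E) (hF : Tri C B₀ F) {α : E →₀ ℝ}
    (hα : 0 ≤ α) (hA : α.support ∈ F) (hi : Inn C α.support) (h2 : 2 ≤ α.support.card) {m : E}
    (hm : Φ α = hom m) :
    Tri C B₀ (exch F α.support {m}) ∧ Conn C B₀ F (exch F α.support {m}) := by
  have hs : (Finsupp.single m (1 : ℝ)).support = {m} := Finsupp.support_single _ one_ne_zero
  have hmF := hF.geo.singleton_notMem hα hA h2 hm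
  have hmf : ∀ f ∈ F, m ∉ f := fun f hf h => hmF (hF.geo.down _ hf _ (by simpa))
  have hG : Tri C B₀ (exch F α.support {m}) := by
    have := (hF.geo.exchData_single hα hA h2 hm).tri hF
      (hF.core_of_inn_subset hα hA hi subset_rfl)
    rwa [hs] at this
  refine ⟨hG, ?_⟩
  set A := α.support with hAdef
  set G := exch F A {m} with hGdef
  have hpos : ∀ x ∈ A, 0 < α x := fun x hx => lt_of_le_of_ne (hα x) (Finsupp.mem_support_iff.1
      hx).symm
  obtain ⟨ℓ, hℓ⟩ := hF.geo.exists_fan hdim h2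
  obtain ⟨v, hv1, hv2⟩ := exists_generic m (cfs F ∪ cfs G) (cfs F ∪ cfs G) (fun L hL =>
    (Finset.mem_union.1 hL).elim (cfs_ne_zero hF.geo L) (cfs_ne_zero hG.geo L))
  have neF : ∀ ρ ∈ tops F, ∀ x ∈ ρ, cw ρ (hom v) x ≠ 0 := fun ρ hρ x hx =>
    hv1 (cf ρ x) (Finset.mem_union_left _ (mem_cfs.2 ⟨ρ, hρ, x, hx, rfl⟩))
  have neG : ∀ ρ ∈ tops G, ∀ x ∈ ρ, cw ρ (hom v) x ≠ 0 := fun ρ hρ x hx =>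
    hv1 (cf ρ x) (Finset.mem_union_right _ (mem_cfs.2 ⟨ρ, hρ, x, hx, rfl⟩))
  have posF : ∀ ρ ∈ tops F, ∀ x ∈ ρ, 0 < cw ρ (hom m) x → 0 < cw ρ (hom v) x := fun ρ hρ x hx =>
    hv2 (cf ρ x) (Finset.mem_union_left _ (mem_cfs.2 ⟨ρ, hρ, x, hx, rfl⟩))
  have posG : ∀ ρ ∈ tops G, ∀ x ∈ ρ, 0 < cw ρ (hom m) x → 0 < cw ρ (hom v) x := fun ρ hρ x hx =>
    hv2 (cf ρ x) (Finset.mem_union_right _ (mem_cfs.2 ⟨ρ, hρ, x, hx, rfl⟩))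
  have posA : ∀ ρ ∈ tops F, A ⊆ ρ → ∀ x ∈ A, 0 < cw ρ (hom v) x := fun ρ hρ hAρ x hx => by
    refine posF ρ hρ x (hAρ hx) ?_
    rw [← hm, hF.geo.cw_Φ (mem_tops.1 hρ).1 (mem_tops.1 hρ).2 hAρ]
    exact hpos x hx
  have hfull : Full F A := (hF.inn_iff hA).1 hi
  have other : ∀ ρ ∈ tops F, A ⊆ ρ → ∀ x ∈ ρ, x ∉ A → cw ρ (hom v) x < 0 →
      ∃ c', c' ∉ ρ.erase x ∧ insert c' (ρ.erase x) ∈ tops F ∧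
        ℓ ρ (hom v) < ℓ (insert c' (ρ.erase x)) (hom v) := by
    intro ρ hρ hAρ x hx hxA hneg
    obtain ⟨hρF, hρc⟩ := mem_tops.1 hρ
    have hAe : A ⊆ ρ.erase x := fun z hz => Finset.mem_erase.2 ⟨fun h => hxA (h ▸ hz), hAρ hz⟩
    have heF := hF.geo.down _ hρF _ (Finset.erase_subset x ρ)
    have hins : insert x (ρ.erase x) = ρ := Finset.insert_erase hx
    obtain ⟨c', h1, h2, h3, -⟩ := hF.geo.exists_other (Finset.notMem_erase x ρ)
      (hF.geo.full_mono hAe heF hfull) (by rwa [hins]) (by rwa [hins]) (y := hom v) (by rwa [hins])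
    have hc' : insert c' (ρ.erase x) ∈ tops F := mem_tops.2 ⟨h3, by
      rw [Finset.card_insert_of_notMem h1, Finset.card_erase_add_one hx, hρc]⟩
    refine ⟨c', h1, hc', hℓ ρ hρ _ hc' hAρ (hAe.trans (Finset.subset_insert _ _)) ?_ x hx
      (Finset.subset_insert _ _) _ hneg⟩
    intro h
    have : x ∈ insert c' (ρ.erase x) := by rw [h]; exact hx
    simp [h2.symm] at this
  set D1 := (tops F).filter fun ρ => A ⊆ ρ with hD1
  set D2 := (tops G).filter fun ρ => m ∈ ρ with hD2
  obtain ⟨F1, hF1, hc1, he1⟩ := hF.exists_radial (v := v) (fun ρ => -ℓ ρ (hom v)) (D := D1)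
    (Finset.filter_subset _ _)
    (fun ρ hρ => hF.geo.notMem_of_cw_ne hE (Finset.mem_filter.1 hρ).1 (neF ρ (Finset.mem_filter.1
        hρ).1))
    (fun ρ hρ => neF ρ (Finset.mem_filter.1 hρ).1) (by
      intro ρ hρ x hx hneg
      obtain ⟨hρt, hAρ⟩ := Finset.mem_filter.1 hρ
      have hxA : x ∉ A := fun h => (posA ρ hρt hAρ x h).not_gt hneg
      obtain ⟨c', h1, h2, h3⟩ := other ρ hρt hAρ x hx hxA hneg
      refine Or.inr ⟨_, Finset.mem_filter.2 ⟨h2, fun z hz => ?_⟩, by simpa using h3,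
          Finset.subset_insert _ _⟩
      exact Finset.mem_insert_of_mem (Finset.mem_erase.2 ⟨fun h => hxA (h ▸ hz), hAρ hz⟩))
  have hD2' : ∀ σ ∈ D2, ∃ ρ ∈ tops F, A ⊆ ρ ∧ ∃ a ∈ A, σ = insert m (ρ.erase a) := by
    intro σ hσ
    obtain ⟨h1, h2⟩ := Finset.mem_filter.1 hσ
    rcases (mem_tops_stell hF.geo hmF).1 h1 with h | h
    · exact absurd h2 (hmf σ (mem_tops.1 h.1).1)
    · exact h
  have hD2'' : ∀ ρ ∈ tops F, A ⊆ ρ → ∀ a ∈ A, insert m (ρ.erase a) ∈ D2 := fun ρ hρ hAρ a ha =>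
    Finset.mem_filter.2 ⟨(mem_tops_stell hF.geo hmF).2 (Or.inr ⟨ρ, hρ, hAρ, a, ha, rfl⟩), by simp⟩
  have hmA : m ∉ A := hmf A hA
  have hpar : ∀ ρ ∈ tops F, A ⊆ ρ → ∀ a ∈ A, (insert m (ρ.erase a)).erase m ∪ A = ρ := by
    intro ρ hρ hAρ a ha
    rw [Finset.erase_insert (fun h => hmf ρ (mem_tops.1 hρ).1 (Finset.mem_of_mem_erase h))]
    ext x
    simp only [Finset.mem_union, Finset.mem_erase]
    constructor
    · rintro (h | h)
      exacts [h.2, hAρ h]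
    · intro h
      by_cases hx : x = a
      · exact Or.inr (hx ▸ ha)
      · exact Or.inl ⟨hx, h⟩
  obtain ⟨F2, hF2, hc2, he2⟩ := hG.exists_radial (v := v)
    (fun σ => toLex (-ℓ (σ.erase m ∪ A) (hom v), cw σ (hom v) m)) (D := D2)
    (Finset.filter_subset _ _)
    (fun ρ hρ => hG.geo.notMem_of_cw_ne hE (Finset.mem_filter.1 hρ).1 (neG ρ (Finset.mem_filter.1
        hρ).1))
    (fun ρ hρ => neG ρ (Finset.mem_filter.1 hρ).1) (by
      intro σ hσ x hx hneg
      have hσt := (Finset.mem_filter.1 hσ).1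
      obtain ⟨ρ, hρ, hAρ, a, ha, rfl⟩ := hD2' σ hσ
      have hmρ := hmf ρ (mem_tops.1 hρ).1
      have hcw := cw_stell hF.geo hρ hm hAρ ha hG.geo hσt (hom v)
      right
      rcases Finset.mem_insert.1 hx with rfl | hx'
      · refine absurd hneg (not_lt.2 (posG _ hσt x hx ?_).le)
        rw [hG.geo.cw_hom (mem_tops.1 hσt).1 (mem_tops.1 hσt).2 hx]; simp
      have hxm : m ≠ x := fun h => hmρ (h ▸ Finset.mem_of_mem_erase hx')
      have hma : ∀ b ∈ A, ∀ hb : insert m (ρ.erase b) ∈ tops G,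
          cw (insert m (ρ.erase b)) (hom v) m = cw ρ (hom v) b / α b := by
        intro b hb hbt
        rw [cw_stell hF.geo hρ hm hAρ hb hG.geo hbt (hom v)]
        simp [hF.geo.cw_apply_eq_zero (mem_tops.1 hρ).1 (mem_tops.1 hρ).2 hmρ,
          Finsupp.notMem_support_iff.1 hmA]
      by_cases hxA : x ∈ A
      · have hσ' := hD2'' ρ hρ hAρ x hxA
        refine ⟨_, hσ', ?_, ?_⟩
        · rw [Prod.Lex.toLex_lt_toLex]
          refine Or.inr ⟨by simp only [hpar ρ hρ hAρ a ha, hpar ρ hρ hAρ x hxA], ?_⟩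
          simp only
          rw [hma a ha hσt, hma x hxA (Finset.mem_filter.1 hσ').1]
          rw [hcw] at hneg
          simp [hxm] at hneg
          rw [div_lt_iff₀ (hpos x hxA)]
          linarith
        · intro z hz
          simp only [Finset.mem_insert, Finset.mem_erase] at hz ⊢
          tauto
      · have hneg' : cw ρ (hom v) x < 0 := by
          rw [hcw] at hneg
          simpa [Finsupp.single_apply, hxm, Finsupp.notMem_support_iff.1 hxA] using hneg
        obtain ⟨c', h1, h2, h3⟩ := other ρ hρ hAρ x (Finset.mem_of_mem_erase hx') hxA hneg'
        have hAρ' : A ⊆ insert c' (ρ.erase x) := fun z hz =>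
          Finset.mem_insert_of_mem (Finset.mem_erase.2 ⟨fun h => hxA (h ▸ hz), hAρ hz⟩)
        refine ⟨_, hD2'' _ h2 hAρ' a ha, ?_, ?_⟩
        · rw [Prod.Lex.toLex_lt_toLex]
          refine Or.inl ?_
          simp only [hpar ρ hρ hAρ a ha, hpar _ h2 hAρ' a ha]
          linarith
        · intro z hz
          simp only [Finset.mem_insert, Finset.mem_erase] at hz ⊢
          tauto)
  have htops : tops G = (tops F).filter (fun ρ => ¬ A ⊆ ρ) ∪ D2 := by
    ext σ
    simp only [Finset.mem_union, Finset.mem_filter]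
    rw [mem_tops_stell hF.geo hmF]
    constructor
    · rintro (h | ⟨ρ, hρ, hAρ, a, ha, rfl⟩)
      · exact Or.inl h
      · exact Or.inr (hD2'' ρ hρ hAρ a ha)
    · rintro (h | h)
      · exact Or.inl h
      · exact Or.inr (hD2' σ h)
  have hchG : chn (tops G) = chn (tops F) + chn D1 + chn D2 := by
    have h1 : chn (tops F) = chn D1 + chn ((tops F).filter (fun ρ => ¬ A ⊆ ρ)) := by
      rw [← chn_union (Finset.disjoint_filter_filter_not _ _ _), Finset.filter_union_filter_not_eq]
    rw [h1, htops, chn_union, add_comm (chn D1), Chain.add_add_cancel]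
    rw [Finset.disjoint_left]
    intro σ h h'
    exact hmf σ (mem_tops.1 (Finset.mem_filter.1 h).1).1 (Finset.mem_filter.1 h').2
  have hbd : bd (chn D1) = bd (chn D2) := by
    have := hF.bd_eq hG
    rw [hchG, map_add, map_add, add_assoc, left_eq_add] at this
    have h3 := Chain.add_add_cancel (bd (chn D1)) (bd (chn D2))
    rw [this, zero_add] at h3
    exact h3.symm
  have : F1 = F2 := by
    refine hF1.eq_of_tops hF2 (chn_injective ?_)
    rw [he1, he2, hchG, hbd, Chain.add_add_cancel]
  exact hc1.trans (this ▸ hc2.symm)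

end Stell

end GeoFlip

namespace GeoFlip

section ChainStell

lemma Chain.induction_off {S : Set (Finset E)} {p : Chain E → Prop}
    (single : ∀ g ∉ S, p (Finsupp.single g 1)) (zero : p 0)
    (hadd : ∀ c d, p c → p d → p (c + d)) (c : Chain E) (hc : ∀ g ∈ S, c g = 0) : p c := by
  rw [← Finsupp.sum_single c]
  refine Finset.sum_induction _ p hadd zero fun g hg => ?_
  have h1 : c g ≠ 0 := Finsupp.mem_support_iff.1 hg
  have h2 : c g = 1 := by
    generalize c g = z at h1
    revert z; decide
  rw [h2]
  exact single g fun h => h1 (hc g h)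

/-- A chain none of whose simplices contains `m`. -/
def Avoid (m : E) (c : Chain E) : Prop := ∀ g ∈ {g : Finset E | m ∈ g}, c g = 0

lemma Avoid.zero (m : E) : Avoid m 0 := fun _ _ => rfl

lemma Avoid.add {m : E} {c d : Chain E} (hc : Avoid m c) (hd : Avoid m d) : Avoid m (c + d) :=
  fun g hg => by rw [Finsupp.add_apply, hc g hg, hd g hg, add_zero]

lemma Avoid.sum {ι : Type*} {m : E} {s : Finset ι} {c : ι → Chain E} (h : ∀ i ∈ s, Avoid m (c i)) :
    Avoid m (∑ i ∈ s, c i) :=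
  Finset.sum_induction _ (Avoid m) (fun _ _ => Avoid.add) (Avoid.zero m) h

lemma Avoid.single {m : E} {g : Finset E} (h : m ∉ g) : Avoid m (Finsupp.single g 1) :=
  fun g' hg' => Finsupp.single_eq_of_ne (by rintro rfl; exact h hg')

lemma Avoid.chn {m : E} {D : Finset (Finset E)} (h : ∀ g ∈ D, m ∉ g) : Avoid m (chn D) :=
  Avoid.sum fun g hg => Avoid.single (h g hg)

lemma Avoid.bd {m : E} {c : Chain E} (hc : Avoid m c) : Avoid m (bd c) := by
  refine Chain.induction_off (p := fun c => Avoid m (GeoFlip.bd c)) (fun g hg => ?_)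
    (by rw [map_zero]; exact Avoid.zero m) (fun c d h h' => by rw [map_add]; exact h.add h') c hc
  rw [bd_single]
  exact Avoid.sum fun x _ => Avoid.single fun h => hg (Finset.mem_of_mem_erase h)

lemma Avoid.cn {m v : E} (hv : m ≠ v) {c : Chain E} (hc : Avoid m c) : Avoid m (cn v c) := by
  refine Chain.induction_off (p := fun c => Avoid m (GeoFlip.cn v c)) (fun g hg => ?_)
    (by rw [map_zero]; exact Avoid.zero m) (fun c d h h' => by rw [map_add]; exact h.add h') c hc
  rw [cn_single]
  exact Avoid.single fun h => (Finset.mem_insert.1 h).elim hv hg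

/-- Stellar subdivision of chains at the point `m` of the edge `{a, b}`. -/
noncomputable def st (a b m : E) : Chain E →ₗ[ZMod 2] Chain E :=
  Finsupp.linearCombination (ZMod 2) fun g =>
    if a ∈ g ∧ b ∈ g then Finsupp.single (insert m (g.erase a)) 1 +
      Finsupp.single (insert m (g.erase b)) 1 else Finsupp.single g 1

variable {a b m : E}

lemma st_comm : st a b m = st b a m := by
  unfold st; congr 1; ext1 g
  simp only [and_comm, add_comm]

lemma st_single_of_mem {g : Finset E} (ha : a ∈ g) (hb : b ∈ g) :
    st a b m (Finsupp.single g 1) =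
      Finsupp.single (insert m (g.erase a)) 1 + Finsupp.single (insert m (g.erase b)) 1 := by
  simp [st, ha, hb]

lemma st_single_of_not {g : Finset E} (h : ¬ (a ∈ g ∧ b ∈ g)) :
    st a b m (Finsupp.single g 1) = Finsupp.single g 1 := by
  simp [st, h]

lemma st_apply_notMem {c : Chain E} (hc : Avoid m c) {σ : Finset E} (hσ : m ∉ σ) :
    st a b m c σ = if a ∈ σ ∧ b ∈ σ then 0 else c σ := by
  refine Chain.induction_off (p := fun c => st a b m c σ = if a ∈ σ ∧ b ∈ σ then 0 else c σ)
    (fun g hg => ?_) (by simp) (fun c d h h' => by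
      rw [map_add, Finsupp.add_apply, h, h']; split_ifs <;> simp)
    c hc
  by_cases h : a ∈ g ∧ b ∈ g
  · rw [st_single_of_mem h.1 h.2, Finsupp.add_apply,
      Finsupp.single_eq_of_ne (by rintro rfl; simp at hσ),
      Finsupp.single_eq_of_ne (by rintro rfl; simp at hσ), add_zero]
    split_ifs with h'
    · rfl
    · rw [Finsupp.single_eq_of_ne]; rintro rfl; exact h' h
  · rw [st_single_of_not h]
    split_ifs with h'
    · rw [Finsupp.single_eq_of_ne]; rintro rfl; exact h h'
    · rfl

lemma st_apply_left (hbm : b ≠ m) (hab : a ≠ b) {c : Chain E} (hc : Avoid m c) {σ : Finset E}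
    (hσ : m ∈ σ) (ha : a ∉ σ) (hb : b ∈ σ) : st a b m c σ = c (insert a (σ.erase m)) := by
  refine Chain.induction_off (p := fun c => st a b m c σ = c (insert a (σ.erase m)))
    (fun g hg => ?_) (by simp) (fun c d h h' => by rw [map_add, Finsupp.add_apply, h, h']; simp) c
        hc
  have hg : m ∉ g := hg
  by_cases h : a ∈ g ∧ b ∈ g
  · have h2 : insert m (g.erase b) ≠ σ := by
      rintro rfl
      exact ha (Finset.mem_insert_of_mem (Finset.mem_erase.2 ⟨hab, h.1⟩))
    rw [st_single_of_mem h.1 h.2, Finsupp.add_apply, Finsupp.single_eq_of_ne h2.symm, add_zero,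
      Finsupp.single_apply, Finsupp.single_apply]
    refine if_congr ⟨?_, ?_⟩ rfl rfl
    · rintro rfl
      rw [Finset.erase_insert (fun h => hg (Finset.mem_of_mem_erase h)), Finset.insert_erase h.1]
    · rintro rfl
      rw [Finset.erase_insert (fun h => ha (Finset.mem_of_mem_erase h)), Finset.insert_erase hσ]
  · rw [st_single_of_not h, Finsupp.single_eq_of_ne (by rintro rfl; exact hg hσ),
      Finsupp.single_eq_of_ne]
    rintro rfl
    exact h ⟨by simp, Finset.mem_insert_of_mem (Finset.mem_erase.2 ⟨hbm, hb⟩)⟩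

lemma st_apply_other (ham : a ≠ m) (hbm : b ≠ m) (hab : a ≠ b) {c : Chain E} (hc : Avoid m c)
    {σ : Finset E} (hσ : m ∈ σ) (h : a ∈ σ ↔ b ∈ σ) : st a b m c σ = 0 := by
  refine Chain.induction_off (p := fun c => st a b m c σ = 0)
    (fun g hg => ?_) (by simp) (fun c d h h' => by rw [map_add, Finsupp.add_apply, h, h']; simp) c
        hc
  have hg : m ∉ g := hg
  by_cases h' : a ∈ g ∧ b ∈ g
  · rw [st_single_of_mem h'.1 h'.2, Finsupp.add_apply, Finsupp.single_eq_of_ne,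
      Finsupp.single_eq_of_ne, add_zero]
    · rintro rfl
      simp [hab, h'.1, hbm] at h
    · rintro rfl
      simp [hab.symm, h'.2, ham] at h
  · rw [st_single_of_not h', Finsupp.single_eq_of_ne]
    rintro rfl; exact hg hσ

lemma st_cn {v : E} (hva : v ≠ a) (hvb : v ≠ b) (c : Chain E) :
    st a b m (cn v c) = cn v (st a b m c) := by
  refine Chain.induction_off (S := ∅) (p := fun c => st a b m (cn v c) = cn v (st a b m c))
    (fun g hg => ?_) (by simp) (fun c d h h' => by simp only [map_add, h, h']) c (by simp)
  rw [cn_single]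
  by_cases h : a ∈ g ∧ b ∈ g
  · rw [st_single_of_mem h.1 h.2, st_single_of_mem (by simp [h.1]) (by simp [h.2]), map_add,
      cn_single, cn_single, Finset.erase_insert_of_ne hva, Finset.erase_insert_of_ne hvb,
      Finset.insert_comm, Finset.insert_comm m v]
  · rw [st_single_of_not h, st_single_of_not (by simpa [hva.symm, hvb.symm] using h), cn_single]

lemma st_bd (ham : a ≠ m) (hbm : b ≠ m) (hab : a ≠ b) {c : Chain E} (hc : Avoid m c) :
    bd (st a b m c) = st a b m (bd c) := by
  refine Chain.induction_off (p := fun c => bd (st a b m c) = st a b m (bd c))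
    (fun g hg => ?_) (by simp) (fun c d h h' => by simp only [map_add, h, h']) c hc
  have hg : m ∉ g := hg
  by_cases h : a ∈ g ∧ b ∈ g
  · obtain ⟨τ, haτ, rfl⟩ : ∃ τ, a ∉ τ ∧ g = insert a τ :=
      ⟨g.erase a, Finset.notMem_erase _ _, (Finset.insert_erase h.1).symm⟩
    obtain ⟨τ, hbτ, rfl⟩ : ∃ τ', b ∉ τ' ∧ τ = insert b τ' :=
      ⟨τ.erase b, Finset.notMem_erase _ _, (Finset.insert_erase (by simpa [hab.symm] using
          h.2)).symm⟩
    simp only [Finset.mem_insert, not_or] at haτ hg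
    have haτ' : a ∉ insert b τ := by simpa using haτ
    have hbτ' : b ∉ insert a τ := by simpa [hab.symm] using hbτ
    have hbd : bd (Finsupp.single (insert a (insert b τ)) (1 : ZMod 2)) =
        Finsupp.single (insert b τ) 1 + Finsupp.single (insert a τ) 1 +
          ∑ x ∈ τ, Finsupp.single (insert a (insert b (τ.erase x))) 1 := by
      rw [bd_cn_single haτ', bd_cn_single hbτ, map_add, cn_single, bd_single, map_sum, map_sum,
        add_assoc]
      simp only [cn_single]
    have hbd2 : ∀ y, y ≠ m → y ∉ τ → bd (Finsupp.single (insert m (insert y τ)) (1 : ZMod 2)) =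
        Finsupp.single (insert y τ) 1 + Finsupp.single (insert m τ) 1 +
          ∑ x ∈ τ, Finsupp.single (insert m (insert y (τ.erase x))) 1 := by
      intro y hy hyτ
      rw [bd_cn_single (by simp [hy.symm, hg.2.2]), bd_cn_single hyτ, map_add, cn_single,
        bd_single, map_sum, map_sum, add_assoc]
      simp only [cn_single]
    rw [st_single_of_mem (by simp) (by simp), Finset.erase_insert haτ', Finset.insert_comm a b,
      Finset.erase_insert hbτ', Finset.insert_comm b a, hbd, map_add, hbd2 a ham haτ.2,
      hbd2 b hbm hbτ, map_add, map_add, map_sum, st_single_of_not fun h => haτ' h.1,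
      st_single_of_not fun h => hbτ' h.2]
    have h3 : ∀ x ∈ τ, st a b m (Finsupp.single (insert a (insert b (τ.erase x))) 1) =
        Finsupp.single (insert m (insert b (τ.erase x))) 1 +
          Finsupp.single (insert m (insert a (τ.erase x))) 1 := by
      intro x hx
      have h1 : a ∉ insert b (τ.erase x) := by simp [hab, haτ.2]
      have h2 : b ∉ insert a (τ.erase x) := by simp [hab.symm, hbτ]
      rw [st_single_of_mem (by simp) (by simp), Finset.erase_insert h1, Finset.insert_comm a b,
        Finset.erase_insert h2]
    rw [Finset.sum_congr rfl h3, Finset.sum_add_distrib]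
    rw [add_add_add_comm, add_add_add_comm (Finsupp.single (insert b τ) (1 : ZMod 2)),
        Chain.add_self,
      add_zero]
  · rw [st_single_of_not h, bd_single, map_sum]
    refine Finset.sum_congr rfl fun x _ => (st_single_of_not fun h' => h ?_).symm
    exact ⟨Finset.mem_of_mem_erase h'.1, Finset.mem_of_mem_erase h'.2⟩

end ChainStell

end GeoFlip

namespace GeoFlip

variable {C : Set (E × ℝ)} {B₀ : Finset (Finset E)} {F : Finset (Finset E)}

lemma ExchData.exch_exch {α β : E →₀ ℝ} (h : ExchData F α β) (hF : Geo F) (hβ : β.support ∉ F) :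
    exch (exch F α.support β.support) β.support α.support = F := by
  ext f
  have hnot : ∀ g ∈ F, ¬ β.support ⊆ g := fun g hg hs => hβ (hF.down _ hg _ hs)
  rw [mem_exch]
  constructor
  · rintro ⟨hB, hf | ⟨hA, g, hg, hBg, hfg⟩⟩
    · exact (mem_exch.1 hf).2.resolve_right fun h => hB h.1
    · obtain ⟨-, g', hg', hAg', hgg'⟩ := (mem_exch.1 hg).2.resolve_left fun h => hnot g h hBg
      obtain ⟨b, hb, hbf⟩ := Finset.not_subset.1 hB
      refine hF.down _ (h.mem g' hg' hAg' b hb) _ fun x hx => ?_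
      have hxb : x ≠ b := fun h => hbf (h ▸ hx)
      have := hfg hx
      rw [Finset.mem_union] at this
      have h2 : x ∈ g' ∪ β.support := this.elim (fun h => hgg' h)
        (fun h => Finset.mem_union_left _ (hAg' h))
      rw [Finset.mem_union] at h2 ⊢
      exact h2.imp (fun h => Finset.mem_erase.2 ⟨hxb, h⟩) (fun h => Finset.mem_erase.2 ⟨hxb, h⟩)
  · intro hf
    refine ⟨hnot f hf, ?_⟩
    by_cases hA : α.support ⊆ f
    · right
      refine ⟨hA, f \ α.support ∪ β.support, mem_exch.2 ⟨fun hs => ?_, Or.inr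
        ⟨Finset.subset_union_right, f, hf, hA, Finset.union_subset_union_left Finset.sdiff_subset⟩⟩,
        Finset.subset_union_right, fun x hx => ?_⟩
      · obtain ⟨a, ha⟩ := h.ne_left
        have := hs ha
        rw [Finset.mem_union, Finset.mem_sdiff] at this
        exact this.elim (fun h => h.2 ha) (fun h' => Finset.disjoint_left.1 h.disj ha h')
      · simp only [Finset.mem_union, Finset.mem_sdiff]; tauto
    · exact Or.inl (mem_exch.2 ⟨hA, Or.inl hf⟩)

lemma st_injective {a b m : E} (ham : a ≠ m) (hbm : b ≠ m) (hab : a ≠ b) {c d : Chain E}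
    (hc : Avoid m c) (hd : Avoid m d) (h : st a b m c = st a b m d) : c = d := by
  ext g
  by_cases hm : m ∈ g
  · rw [hc g hm, hd g hm]
  by_cases he : a ∈ g ∧ b ∈ g
  · have := DFunLike.congr_fun h (insert m (g.erase a))
    have h1 : a ∉ insert m (g.erase a) := by simp [ham]
    have h2 : b ∈ insert m (g.erase a) := by simp [hab.symm, he.2]
    rwa [st_apply_left hbm hab hc (by simp) h1 h2, st_apply_left hbm hab hd (by simp) h1 h2,
      Finset.erase_insert (fun h => hm (Finset.mem_of_mem_erase h)), Finset.insert_erase he.1] at this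
  · have := DFunLike.congr_fun h g
    rwa [st_apply_notMem hc hm, st_apply_notMem hd hm, if_neg he, if_neg he] at this

/-- Stellar subdivision of a set of simplices at the point `m` of the edge `{a, b}`. -/
noncomputable def stS (a b m : E) (D : Finset (Finset E)) : Finset (Finset E) :=
  D.filter (fun g => ¬ (a ∈ g ∧ b ∈ g)) ∪
    (D.filter fun g => a ∈ g ∧ b ∈ g).biUnion
      fun g => {insert m (g.erase a), insert m (g.erase b)}

lemma mem_stS {a b m : E} {D : Finset (Finset E)} {σ : Finset E} :
    σ ∈ stS a b m D ↔ (σ ∈ D ∧ ¬ (a ∈ σ ∧ b ∈ σ)) ∨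
      ∃ g ∈ D, a ∈ g ∧ b ∈ g ∧ (σ = insert m (g.erase a) ∨ σ = insert m (g.erase b)) := by
  simp only [stS, Finset.mem_union, Finset.mem_filter, Finset.mem_biUnion, Finset.mem_insert,
    Finset.mem_singleton, and_assoc]

lemma chn_stS {a b m : E} (ham : a ≠ m) (hbm : b ≠ m) (hab : a ≠ b) {D : Finset (Finset E)}
    (hD : ∀ g ∈ D, m ∉ g) : chn (stS a b m D) = st a b m (chn D) := by
  have hA := Avoid.chn hD
  have hl : ∀ {a b : E}, a ≠ m → b ≠ m → a ≠ b → ∀ {σ : Finset E}, m ∈ σ → a ∉ σ → b ∈ σ →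
      (σ ∈ stS a b m D ↔ insert a (σ.erase m) ∈ D) := by
    intro a b ham hbm hab σ hm ha hb
    rw [mem_stS]
    constructor
    · rintro (h | ⟨g, hg, ha', hb', rfl | rfl⟩)
      · exact absurd hm (hD _ h.1)
      · rwa [Finset.erase_insert (fun h => hD g hg (Finset.mem_of_mem_erase h)),
          Finset.insert_erase ha']
      · exact absurd (Finset.mem_insert_of_mem (Finset.mem_erase.2 ⟨hab, ha'⟩)) ha
    · intro h
      refine Or.inr ⟨_, h, by simp, Finset.mem_insert_of_mem (Finset.mem_erase.2 ⟨hbm, hb⟩), Or.inl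
          ?_⟩
      rw [Finset.erase_insert (fun h => ha (Finset.mem_of_mem_erase h)), Finset.insert_erase hm]
  have hsymm : stS a b m D = stS b a m D := by
    ext σ; simp only [mem_stS]
    exact or_congr (by tauto) (exists_congr fun g => by tauto)
  ext σ
  rw [chn_apply]
  by_cases hm : m ∈ σ
  · by_cases ha : a ∈ σ <;> by_cases hb : b ∈ σ
    · rw [st_apply_other ham hbm hab hA hm (by tauto), if_neg]
      rw [mem_stS]
      rintro (h | ⟨g, hg, ha', hb', rfl | rfl⟩)
      · exact h.2 ⟨ha, hb⟩
      · simp [ham] at ha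
      · simp [hbm] at hb
    · rw [st_comm, st_apply_left ham hab.symm hA hm hb ha, chn_apply, hsymm]
      exact if_congr (hl hbm ham hab.symm hm hb ha) rfl rfl
    · rw [st_apply_left hbm hab hA hm ha hb, chn_apply]
      exact if_congr (hl ham hbm hab hm ha hb) rfl rfl
    · rw [st_apply_other ham hbm hab hA hm (by tauto), if_neg]
      rw [mem_stS]
      rintro (h | ⟨g, hg, ha', hb', rfl | rfl⟩)
      · exact hD _ h.1 hm
      · simp [hab.symm, hb'] at hb
      · simp [hab, ha'] at ha
  · rw [st_apply_notMem hA hm, chn_apply]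
    have : ¬ ∃ g ∈ D, a ∈ g ∧ b ∈ g ∧ (σ = insert m (g.erase a) ∨ σ = insert m (g.erase b)) := by
      rintro ⟨g, -, -, -, rfl | rfl⟩ <;> simp at hm
    have hiff : σ ∈ stS a b m D ↔ σ ∈ D ∧ ¬ (a ∈ σ ∧ b ∈ σ) := by
      rw [mem_stS]; exact or_iff_left this
    by_cases h : a ∈ σ ∧ b ∈ σ <;> simp [hiff, h]

section FiniteDim

variable [FiniteDimensional ℝ E]

lemma tops_stell_edge (hF : Geo F) {a b m : E} (hm : {m} ∉ F) :
    tops (exch F {a, b} {m}) = stS a b m (tops F) := by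
  ext σ
  rw [mem_tops_stell hF hm, mem_stS]
  simp [Finset.insert_subset_iff, and_assoc]

/-- The inverse of a stellar subdivision of an edge. -/
lemma Tri.unstell (hdim : topCard E ≤ 4) (hE : 2 ≤ topCard E) {G : Finset (Finset E)}
    (hG : Tri C B₀ G) {a b m : E} (ham : a ≠ m) (hbm : b ≠ m) (hab : a ≠ b) {α : E →₀ ℝ}
    (hα : 0 ≤ α) (hs : α.support = {a, b}) (hm : Φ α = hom m) (hcore : core C (hom m))
    {c : Chain E} (hc : Avoid m c) (hch : chn (tops G) = st a b m c) :
    ∃ F', Tri C B₀ F' ∧ Conn C B₀ F' G ∧ chn (tops F') = c := by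
  by_cases hmG : {m} ∈ G
  · have hms : (Finsupp.single m (1 : ℝ)).support = {m} := Finsupp.support_single _ one_ne_zero
    have hInn : ∀ f ∈ G, m ∈ f → Inn C f := fun f hf hmf => by
      refine hG.inn_mono (Finset.singleton_subset_iff.2 hmf) hf ?_
      have : ind {m} = Finsupp.single m (1 : ℝ) := by
        ext x; by_cases hx : m = x <;> simp [ind_apply, hx, eq_comm]
      rw [Inn, this, Φ_single, one_smul]; exact hcore
    have htop : ∀ f ∈ G, m ∈ f → ∃ σ ∈ tops G, f ⊆ σ := fun f hf hmf => by
      obtain ⟨ρ, h1, h2, h3⟩ := hG.geo.exists_top ((hG.inn_iff hf).1 (hInn f hf hmf))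
      exact ⟨ρ, mem_tops.2 ⟨h1, h2⟩, h3⟩
    have hmem : ∀ σ, σ ∈ tops G ↔ st a b m c σ ≠ 0 := fun σ => by
      rw [← hch, chn_apply]; split_ifs with h <;> simp [h]
    have hsib : ∀ {a b : E}, a ≠ m → b ≠ m → a ≠ b → (∀ σ, σ ∈ tops G ↔ st a b m c σ ≠ 0) →
        ∀ σ ∈ tops G, m ∈ σ → a ∉ σ → b ∈ σ → insert a (σ.erase b) ∈ tops G := by
      intro a b ham hbm hab hmem σ hσ hmσ ha hb
      rw [hmem] at hσ ⊢
      rw [st_apply_left hbm hab hc hmσ ha hb] at hσ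
      rw [st_comm, st_apply_left ham hab.symm hc (by simp [hmσ, hbm.symm]) (by simp [hab.symm])
        (by simp)]
      convert hσ using 2
      ext x
      simp only [Finset.mem_insert, Finset.mem_erase]
      by_cases hx : x = b
      · subst hx; simp [hbm, hb]
      · by_cases hx' : x = a
        · subst hx'; simp [ham, hab]
        · simp [hx, hx']
    have hex : ExchData G (Finsupp.single m 1) α := by
      refine ⟨?_, fun x hx => lt_of_le_of_ne (hα x) (Finsupp.mem_support_iff.1 hx).symm,
        by rw [hms]; simp, by rw [hs]; simp, by rw [hms, hs]; simp [ham.symm, hbm.symm],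
        by rw [Φ_single, one_smul, hm], ?_⟩
      · rw [hms]; simp
      rw [hms, hs]
      intro f hf hmf x hx
      rw [Finset.singleton_subset_iff] at hmf
      obtain ⟨σ, hσ, hfσ⟩ := htop f hf hmf
      have hmσ := hfσ hmf
      have key : ∀ {a b : E}, a ≠ m → b ≠ m → a ≠ b → (∀ σ, σ ∈ tops G ↔ st a b m c σ ≠ 0) →
          f.erase b ∪ {a} ∈ G := by
        intro a b ham hbm hab hmem
        by_cases ha : a ∈ σ
        · refine hG.geo.down _ (mem_tops.1 hσ).1 _ (Finset.union_subset
            ((Finset.erase_subset _ _).trans hfσ) (by simpa using ha))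
        · by_cases hb : b ∈ σ
          · refine hG.geo.down _ (mem_tops.1 (hsib ham hbm hab hmem σ hσ hmσ ha hb)).1 _ ?_
            refine Finset.union_subset ?_ (by simp)
            exact (Finset.erase_subset_erase _ hfσ).trans (Finset.subset_insert _ _)
          · have := (hmem σ).1 hσ
            rw [st_apply_other ham hbm hab hc hmσ (by tauto)] at this
            exact absurd rfl this
      rcases Finset.mem_insert.1 hx with rfl | hx
      · have := key hbm ham hab.symm (by rwa [st_comm])
        rwa [show ({x, b} : Finset E).erase x = {b} by
          rw [Finset.erase_insert (by simpa using hab)]]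
      · rw [Finset.mem_singleton] at hx
        subst hx
        have := key ham hbm hab hmem
        rwa [show ({a, x} : Finset E).erase x = {a} by
          rw [Finset.pair_comm, Finset.erase_insert (by simpa using hab.symm)]]
    have h2 : 2 ≤ α.support.card := by rw [hs, Finset.card_pair hab]
    have heG : α.support ∉ G := fun h => hG.geo.singleton_notMem hα h h2 hm hmG
    have hF' := hex.tri hG (by rwa [Φ_single, one_smul])
    have hinv := hex.exch_exch hG.geo heG
    rw [hms] at hF' hinv
    set F' := exch G {m} α.support with hF'def
    have heF' : α.support ∈ F' := by
      rw [hF'def, mem_exch]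
      refine ⟨?_, Or.inr ⟨subset_rfl, {m}, hmG, subset_rfl, Finset.subset_union_right⟩⟩
      rw [hs]; simp [ham.symm, hbm.symm]
    have hi : Inn C α.support := by
      rw [hF'.inn_iff heF']
      refine hF'.geo.full_of_core hα heF' ?_
      rwa [hF'.cone_eq, hm]
    have hconn := (hF'.stell hdim hE hα heF' hi h2 hm).2
    rw [hinv] at hconn
    refine ⟨F', hF', hconn, ?_⟩
    have hmF' := hF'.geo.singleton_notMem hα heF' h2 hm
    have hav : ∀ g ∈ tops F', m ∉ g := fun g hg h =>
      hmF' (hF'.geo.down _ (mem_tops.1 hg).1 _ (by simpa using h))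
    refine st_injective ham hbm hab (Avoid.chn hav) hc ?_
    rw [← hch, ← chn_stS ham hbm hab hav, ← tops_stell_edge hF'.geo hmF', ← hs, hinv]
  · refine ⟨G, hG, Conn.refl G, ?_⟩
    have hav : Avoid m (chn (tops G)) := Avoid.chn fun g hg h =>
      hmG (hG.geo.down _ (mem_tops.1 hg).1 _ (by simpa using h))
    ext g
    by_cases hmg : m ∈ g
    · rw [hav g hmg, hc g hmg]
    by_cases he : a ∈ g ∧ b ∈ g
    · have h1 := hav (insert m (g.erase a)) (Finset.mem_insert_self _ _)
      rw [hch, st_apply_left hbm hab hc (by simp) (by simp [ham]) (by simp [hab.symm, he.2]),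
        Finset.erase_insert (fun h => hmg (Finset.mem_of_mem_erase h)), Finset.insert_erase he.1]
            at h1
      rw [h1, hch, st_apply_notMem hc hmg, if_pos he]
    · rw [hch, st_apply_notMem hc hmg, if_neg he]

end FiniteDim

end GeoFlip

namespace GeoFlip

variable {C : Set (E × ℝ)} {B₀ : Finset (Finset E)} {F : Finset (Finset E)}

/-- Every facet of `D` visible from `v` leads to another member of `D`, of smaller rank unless
the facet lies in one of the hyperplanes of `S`. -/
def Vis (S : Finset (E × ℝ →ₗ[ℝ] ℝ)) (D : Finset (Finset E)) (v : E) (r : Finset E → ℕ) : Prop :=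
  ∀ ρ ∈ D, ∀ x ∈ ρ, cw ρ (hom v) x < 0 → ∃ ρ' ∈ D, ρ' ≠ ρ ∧ ρ.erase x ⊆ ρ' ∧
    ((∃ H ∈ S, ∀ y ∈ ρ.erase x, H (hom y) = 0) ∨ r ρ' < r ρ)

lemma inn_singleton {x : E} : Inn C {x} ↔ core C (hom x) := by
  have : ind {x} = Finsupp.single x (1 : ℝ) := by
    ext y; rw [ind_apply, Finsupp.single_apply]; simp [eq_comm]
  rw [Inn, this, Φ_single, one_smul]

lemma stS_comm (a b m : E) (D : Finset (Finset E)) : stS a b m D = stS b a m D := by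
  ext σ; simp only [mem_stS]
  exact or_congr (by tauto) (exists_congr fun g => by tauto)

lemma stS_subset {a b m : E} {D D' : Finset (Finset E)} (h : D ⊆ D') :
    stS a b m D ⊆ stS a b m D' := by
  intro σ
  simp only [mem_stS]
  rintro (⟨h1, h2⟩ | ⟨g, hg, h2⟩)
  exacts [Or.inl ⟨h h1, h2⟩, Or.inr ⟨g, h hg, h2⟩]

section FiniteDim

variable [FiniteDimensional ℝ E]

lemma Geo.map_eq_sum (hF : Geo F) {ρ : Finset E} (hρ : ρ ∈ tops F) (L : E × ℝ →ₗ[ℝ] ℝ)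
    (y : E × ℝ) : L y = ∑ x ∈ ρ, cw ρ y x * L (hom x) := by
  obtain ⟨h1, h2⟩ := hF.cw_spec (mem_tops.1 hρ).1 (mem_tops.1 hρ).2 y
  conv_lhs => rw [← h2, Φ_eq_sum h1, map_sum]
  simp

/-- Visibility data are inherited by a stellar subdivision of an edge. -/
lemma Vis.stell {S : Finset (E × ℝ →ₗ[ℝ] ℝ)} {D : Finset (Finset E)} {v : E} {r : Finset E → ℕ}
    (hV : Vis S D v r) (hF : Geo F) (hD : D ⊆ tops F) {G : Finset (Finset E)} (hG : Geo G)
    {a b m : E} (hab : a ≠ b) (hGt : tops G = stS a b m (tops F)) (hmF : {m} ∉ F) {α : E →₀ ℝ}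
    (hα : 0 ≤ α) (hs : α.support = {a, b}) (hm : Φ α = hom m) :
    ∃ r', Vis S (stS a b m D) v r' := by
  have hmD : ∀ ρ ∈ D, m ∉ ρ := fun ρ hρ h => hmF (hF.down _ (mem_tops.1 (hD hρ)).1 _ (by simpa))
  set R : Finset E → ℕ := fun σ => if m ∈ σ then 2 * r (σ.erase m ∪ {a, b}) +
    (if ∃ x ∈ σ, x ∈ ({a, b} : Finset E) ∧ cw σ (hom v) x < 0 then 1 else 0) else 2 * r σ with hR
  refine ⟨R, ?_⟩
  have hR0 : ∀ σ, m ∉ σ → R σ = 2 * r σ := fun σ h => if_neg h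
  have hR1 : ∀ {a b : E}, a ≠ b → α.support = {a, b} → ∀ ρ ∈ D, a ∈ ρ → b ∈ ρ →
      R (insert m (ρ.erase a)) = 2 * r ρ +
        if cw (insert m (ρ.erase a)) (hom v) b < 0 then 1 else 0 := by
    intro a' b' hab' hs' ρ hρ ha hb
    have hmρ := hmD ρ hρ
    have e1 : (insert m (ρ.erase a')).erase m = ρ.erase a' :=
      Finset.erase_insert fun h => hmρ (Finset.mem_of_mem_erase h)
    have e2 : ρ.erase a' ∪ {a, b} = ρ := by
      rw [← hs, hs']
      ext z
      simp only [Finset.mem_union, Finset.mem_erase, Finset.mem_insert, Finset.mem_singleton]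
      constructor
      · rintro (h | rfl | rfl)
        exacts [h.2, ha, hb]
      · intro hz; by_cases h : z = a' <;> simp [h, hz]
    have e3 : (∃ x ∈ insert m (ρ.erase a'), x ∈ ({a, b} : Finset E) ∧
        cw (insert m (ρ.erase a')) (hom v) x < 0) ↔ cw (insert m (ρ.erase a')) (hom v) b' < 0 := by
      rw [← hs, hs']
      constructor
      · rintro ⟨x, hx, hx', hlt⟩
        rcases Finset.mem_insert.1 hx' with rfl | hx'
        · exfalso
          simp only [Finset.mem_insert, Finset.mem_erase, ne_eq, not_true, false_and, or_false] at hx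
          exact hmρ (hx ▸ ha)
        · rw [Finset.mem_singleton] at hx'; rwa [← hx']
      · exact fun h => ⟨b', by simp [hab'.symm, hb], by simp, h⟩
    simp only [hR]
    rw [if_pos (Finset.mem_insert_self _ _), e1, e2]
    simp only [e3]
  have key1 : ∀ {a b : E}, a ≠ b → α.support = {a, b} → ∀ σ ∈ D, ∀ x ∈ σ, ∀ ρ' ∈ D,
      a ∈ ρ' → b ∈ ρ' → σ.erase x ⊆ ρ' → a ∉ σ → r ρ' < r σ → ∃ τ ∈ stS a b m D, τ ≠ σ ∧
        σ.erase x ⊆ τ ∧ R τ < R σ := by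
    intro a b hab hs σ hσ x hx ρ' hρ' ha hb hsub haσ hlt
    refine ⟨insert m (ρ'.erase a), mem_stS.2 (Or.inr ⟨ρ', hρ', ha, hb, Or.inl rfl⟩),
      fun h => hmD σ hσ (h ▸ Finset.mem_insert_self _ _), fun y hy => ?_, ?_⟩
    · refine Finset.mem_insert_of_mem (Finset.mem_erase.2 ⟨?_, hsub hy⟩)
      rintro rfl
      exact haσ (Finset.mem_of_mem_erase hy)
    · rw [hR1 hab hs ρ' hρ' ha hb, hR0 σ (hmD σ hσ)]
      split_ifs <;> omega
  have key1' : ∀ {a b : E}, a ≠ b → α.support = {a, b} → ∀ σ ∈ D, ∀ x ∈ σ, ∀ ρ' ∈ D,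
      a ∈ ρ' → b ∈ ρ' → σ.erase x ⊆ ρ' → a ∉ σ → ∃ τ ∈ stS a b m D, τ ≠ σ ∧
        σ.erase x ⊆ τ := by
    intro a b hab hs σ hσ x hx ρ' hρ' ha hb hsub haσ
    refine ⟨insert m (ρ'.erase a), mem_stS.2 (Or.inr ⟨ρ', hρ', ha, hb, Or.inl rfl⟩),
      fun h => hmD σ hσ (h ▸ Finset.mem_insert_self _ _), fun y hy => ?_⟩
    refine Finset.mem_insert_of_mem (Finset.mem_erase.2 ⟨?_, hsub hy⟩)
    rintro rfl
    exact haσ (Finset.mem_of_mem_erase hy)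
  have key2 : ∀ {a b : E}, a ≠ b → α.support = {a, b} → tops G = stS a b m (tops F) →
      ∀ ρ ∈ D, a ∈ ρ → b ∈ ρ → ∀ x ∈ insert m (ρ.erase a),
        cw (insert m (ρ.erase a)) (hom v) x < 0 → ∃ τ ∈ stS a b m D, τ ≠ insert m (ρ.erase a) ∧
        (insert m (ρ.erase a)).erase x ⊆ τ ∧
        ((∃ H ∈ S, ∀ y ∈ (insert m (ρ.erase a)).erase x, H (hom y) = 0) ∨
          R τ < R (insert m (ρ.erase a))) := by
    intro a b hab hs hGt ρ hρ ha hb x hx hneg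
    have hmρ := hmD ρ hρ
    have ham : a ≠ m := fun h => hmρ (h ▸ ha)
    have hbm : b ≠ m := fun h => hmρ (h ▸ hb)
    have hsub : α.support ⊆ ρ := by rw [hs]; simp [Finset.insert_subset_iff, ha, hb]
    have has : a ∈ α.support := by simp [hs]
    have hbs : b ∈ α.support := by simp [hs]
    have hαa : 0 < α a := lt_of_le_of_ne (hα a) (Finsupp.mem_support_iff.1 has).symm
    have hαb : 0 < α b := lt_of_le_of_ne (hα b) (Finsupp.mem_support_iff.1 hbs).symm
    have hσG : insert m (ρ.erase a) ∈ tops G := by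
      rw [hGt]; exact mem_stS.2 (Or.inr ⟨ρ, hD hρ, ha, hb, Or.inl rfl⟩)
    have hτG : insert m (ρ.erase b) ∈ tops G := by
      rw [hGt]; exact mem_stS.2 (Or.inr ⟨ρ, hD hρ, ha, hb, Or.inr rfl⟩)
    have hcw := cw_stell hF (hD hρ) hm hsub has hG hσG (hom v)
    have hcw' := cw_stell hF (hD hρ) hm hsub hbs hG hτG (hom v)
    have hαm : α m = 0 := Finsupp.notMem_support_iff.1 (by simp [hs, ham.symm, hbm.symm])
    have hρm : cw ρ (hom v) m = 0 :=
      hF.cw_apply_eq_zero (mem_tops.1 (hD hρ)).1 (mem_tops.1 (hD hρ)).2 hmρ _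
    by_cases hxm : x = m
    · subst hxm
      have h1 : cw ρ (hom v) a < 0 := by
        rw [hcw] at hneg
        simp only [Finsupp.add_apply, Finsupp.smul_apply, Finsupp.sub_apply, hρm, hαm,
          Finsupp.single_eq_same, smul_eq_mul] at hneg
        simp only [zero_add, sub_zero, mul_one] at hneg
        by_contra! hcon
        exact absurd hneg (not_lt.2 (div_nonneg hcon hαa.le))
      obtain ⟨ρ', hρ', hne, hsub', hH⟩ := hV ρ hρ a ha h1
      have haρ' : a ∉ ρ' := fun h => hne (by
        refine (Finset.eq_of_subset_of_card_le (fun z hz => ?_) ?_).symm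
        · by_cases hza : z = a
          · exact hza ▸ h
          · exact hsub' (Finset.mem_erase.2 ⟨hza, hz⟩)
        · rw [(mem_tops.1 (hD hρ)).2, (mem_tops.1 (hD hρ')).2])
      have e1 : (insert x (ρ.erase a)).erase x = ρ.erase a :=
        Finset.erase_insert fun h => hmρ (Finset.mem_of_mem_erase h)
      refine ⟨ρ', mem_stS.2 (Or.inl ⟨hρ', fun h => haρ' h.1⟩),
        fun h => hmD ρ' hρ' (h ▸ Finset.mem_insert_self _ _), by rwa [e1], ?_⟩
      rw [e1]
      refine hH.imp id fun h => ?_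
      rw [hR1 hab hs ρ hρ ha hb, hR0 _ (hmD ρ' hρ')]
      omega
    have hxρ := (Finset.mem_insert.1 hx).resolve_left hxm
    by_cases hxb : x = b
    · subst hxb
      refine ⟨insert m (ρ.erase x), mem_stS.2 (Or.inr ⟨ρ, hρ, ha, hb, Or.inr rfl⟩),
        fun h => ?_, fun z hz => ?_, Or.inr ?_⟩
      · rw [← h] at hx
        simp [hxm] at hx
      · simp only [Finset.mem_erase, Finset.mem_insert] at hz ⊢
        tauto
      · rw [hR1 hab hs ρ hρ ha hb, hR1 hab.symm (by rw [hs, Finset.pair_comm]) ρ hρ hb ha,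
          if_pos hneg, if_neg]
        · omega
        · rw [hcw] at hneg
          rw [hcw']
          simp only [Finsupp.add_apply, Finsupp.smul_apply, Finsupp.sub_apply,
            Finsupp.single_eq_of_ne hxm, Finsupp.single_eq_of_ne ham, smul_eq_mul, zero_sub] at hneg ⊢
          rw [not_lt]
          have e2 : cw ρ (hom v) x + cw ρ (hom v) a / α a * -α x =
            (cw ρ (hom v) x * α a - cw ρ (hom v) a * α x) / α a := by field_simp; ring
          have e3 : cw ρ (hom v) a + cw ρ (hom v) x / α x * -α a =
            (cw ρ (hom v) a * α x - cw ρ (hom v) x * α a) / α x := by field_simp; ring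
          rw [e2] at hneg
          rw [e3]
          refine div_nonneg ?_ hαb.le
          have := (div_lt_iff₀ hαa).1 hneg
          linarith
    · have hxa : x ≠ a := (Finset.mem_erase.1 hxρ).1
      have hxρ' := Finset.mem_of_mem_erase hxρ
      have h1 : cw ρ (hom v) x < 0 := by
        rw [hcw] at hneg
        have : α x = 0 := Finsupp.notMem_support_iff.1 (by simp [hs, hxa, hxb])
        simpa [Finsupp.single_eq_of_ne hxm, this] using hneg
      obtain ⟨ρ', hρ', hne, hsub', hH⟩ := hV ρ hρ x hxρ' h1
      have ha' : a ∈ ρ' := hsub' (Finset.mem_erase.2 ⟨Ne.symm hxa, ha⟩)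
      have hb' : b ∈ ρ' := hsub' (Finset.mem_erase.2 ⟨Ne.symm hxb, hb⟩)
      refine ⟨insert m (ρ'.erase a), mem_stS.2 (Or.inr ⟨ρ', hρ', ha', hb', Or.inl rfl⟩),
        fun h => hne ?_, fun z hz => ?_, hH.imp ?_ fun h => ?_⟩
      · have := congrArg (fun s => insert a (s.erase m)) h
        rwa [Finset.erase_insert (fun h => hmD ρ' hρ' (Finset.mem_of_mem_erase h)),
          Finset.erase_insert (fun h => hmρ (Finset.mem_of_mem_erase h)),
          Finset.insert_erase ha', Finset.insert_erase ha] at this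
      · have h3 := @hsub' z
        simp only [Finset.mem_erase, Finset.mem_insert] at hz h3 ⊢
        tauto
      · rintro ⟨H, hH, h0⟩
        refine ⟨H, hH, fun y hy => ?_⟩
        have hHa := h0 a (Finset.mem_erase.2 ⟨Ne.symm hxa, ha⟩)
        have hHb := h0 b (Finset.mem_erase.2 ⟨Ne.symm hxb, hb⟩)
        by_cases hym : y = m
        · rw [hym, ← hm, Φ_eq_sum hs.subset, map_sum, Finset.sum_pair hab]
          simp [hHa, hHb]
        · refine h0 y ?_
          simp only [Finset.mem_erase, Finset.mem_insert] at hy ⊢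
          tauto
      · rw [hR1 hab hs ρ hρ ha hb, hR1 hab hs ρ' hρ' ha' hb']
        split_ifs <;> omega
  have hs' : α.support = {b, a} := by rw [hs, Finset.pair_comm]
  intro σ hσ x hx hneg
  rcases mem_stS.1 hσ with ⟨hσD, hnot⟩ | ⟨ρ, hρ, ha, hb, rfl | rfl⟩
  · obtain ⟨ρ', hρ', hne, hsub', hH⟩ := hV σ hσD x hx hneg
    by_cases he : a ∈ ρ' ∧ b ∈ ρ'
    · by_cases haσ : a ∈ σ
      · have hbσ : b ∉ σ := fun h => hnot ⟨haσ, h⟩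
        rcases hH with hH | hH
        · obtain ⟨τ, h1, h2, h3⟩ := key1' hab.symm hs' σ hσD x hx ρ' hρ' he.2 he.1 hsub' hbσ
          exact ⟨τ, by rwa [stS_comm], h2, h3, Or.inl hH⟩
        · obtain ⟨τ, h1, h2, h3, h4⟩ := key1 hab.symm hs' σ hσD x hx ρ' hρ' he.2 he.1 hsub' hbσ hH
          exact ⟨τ, by rwa [stS_comm], h2, h3, Or.inr h4⟩
      · rcases hH with hH | hH
        · obtain ⟨τ, h1, h2, h3⟩ := key1' hab hs σ hσD x hx ρ' hρ' he.1 he.2 hsub' haσ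
          exact ⟨τ, h1, h2, h3, Or.inl hH⟩
        · obtain ⟨τ, h1, h2, h3, h4⟩ := key1 hab hs σ hσD x hx ρ' hρ' he.1 he.2 hsub' haσ hH
          exact ⟨τ, h1, h2, h3, Or.inr h4⟩
    · refine ⟨ρ', mem_stS.2 (Or.inl ⟨hρ', he⟩), hne, hsub', hH.imp id fun h => ?_⟩
      rw [hR0 _ (hmD _ hρ'), hR0 _ (hmD _ hσD)]
      omega
  · exact key2 hab hs hGt ρ hρ ha hb x hx hneg
  · rw [stS_comm]
    exact key2 hab.symm hs' (by rw [hGt, stS_comm]) ρ hρ hb ha x hx hneg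

/-- Starring when no simplex is crossed by the hyperplanes. -/
lemma Tri.star_of_uncrossed (hE : 2 ≤ topCard E) (hF : Tri C B₀ F)
    {S : Finset (E × ℝ →ₗ[ℝ] ℝ)} {D : Finset (Finset E)} (hD : D ⊆ tops F)
    (hun : ∀ H ∈ S, ∀ ρ ∈ D, ∀ a ∈ ρ, ∀ b ∈ ρ, H (hom a) < 0 → ¬ 0 < H (hom b)) {v : E}
    (hv : ∀ L ∈ cfs F, L (hom v) ≠ 0) (hvS : ∀ L ∈ S, L (hom v) ≠ 0) {r : Finset E → ℕ}
    (hV : Vis S D v r) :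
    (∃ F', Tri C B₀ F' ∧ Conn C B₀ F F' ∧
      chn (tops F') = chn (tops F) + chn D + cn v (bd (chn D))) ∧
    (D.Nonempty → core C (hom v)) := by
  have hne : ∀ ρ ∈ D, ∀ x ∈ ρ, cw ρ (hom v) x ≠ 0 := fun ρ hρ x hx =>
    hv _ (mem_cfs.2 ⟨ρ, hD hρ, x, hx, rfl⟩)
  set R : Finset E → ℕ ×ₗ ℕ := fun ρ => toLex
    ((S.filter fun H => ∃ a ∈ ρ, H (hom a) * H (hom v) < 0).card, r ρ) with hR
  have hvis : ∀ ρ ∈ D, ∀ x ∈ ρ, cw ρ (hom v) x < 0 → ∃ ρ' ∈ D, R ρ' < R ρ ∧ ρ.erase x ⊆ ρ' := by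
    intro ρ hρ x hx hneg
    obtain ⟨ρ', hρ', hne', hsub, hH⟩ := hV ρ hρ x hx hneg
    refine ⟨ρ', hρ', ?_, hsub⟩
    obtain ⟨x', hx', he⟩ := exists_erase_of_subset hx
      ((mem_tops.1 (hD hρ)).2.trans (mem_tops.1 (hD hρ')).2.symm) hsub
    have hpos := (hF.geo.facet_neg_iff (hD hρ) (hD hρ') hne'.symm hx hx' he (hom v)).1 hneg
    have hflat : ∀ H : E × ℝ →ₗ[ℝ] ℝ, (∀ y ∈ ρ.erase x, H (hom y) = 0) →
        H (hom v) = cw ρ (hom v) x * H (hom x) ∧ H (hom v) = cw ρ' (hom v) x' * H (hom x') := by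
      intro H h0
      constructor
      · rw [hF.geo.map_eq_sum (hD hρ) H (hom v), ← Finset.add_sum_erase _ _ hx,
          Finset.sum_eq_zero, add_zero]
        intro y hy; rw [h0 y hy, mul_zero]
      · rw [hF.geo.map_eq_sum (hD hρ') H (hom v), ← Finset.add_sum_erase _ _ hx',
          Finset.sum_eq_zero, add_zero]
        intro y hy; rw [h0 y (he ▸ hy), mul_zero]
    have hsep : (S.filter fun H => ∃ a ∈ ρ', H (hom a) * H (hom v) < 0) ⊆
        S.filter fun H => ∃ a ∈ ρ, H (hom a) * H (hom v) < 0 := by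
      intro H hHm
      rw [Finset.mem_filter] at hHm ⊢
      obtain ⟨hHS, c, hc, hlt⟩ := hHm
      refine ⟨hHS, ?_⟩
      by_contra! hcon
      by_cases hcx : c = x'
      · subst hcx
        have h0 : ∀ y ∈ ρ.erase x, H (hom y) = 0 := by
          intro y hy
          have h1 := hcon y (Finset.mem_of_mem_erase hy)
          have hy' : y ∈ ρ' := hsub hy
          rcases mul_neg_iff.1 hlt with ⟨h2, h3⟩ | ⟨h2, h3⟩
          · have h4 : H (hom y) ≤ 0 := by
              by_contra! h
              exact absurd h1 (not_le.2 (mul_neg_of_pos_of_neg h h3))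
            by_contra h5
            exact hun H hHS ρ' hρ' y hy' c hx' (lt_of_le_of_ne h4 h5) h2
          · have h4 : 0 ≤ H (hom y) := by
              by_contra! h
              exact absurd h1 (not_le.2 (mul_neg_of_neg_of_pos h h3))
            by_contra h5
            exact hun H hHS ρ' hρ' c hx' y hy' h2 (lt_of_le_of_ne h4 (Ne.symm h5))
        have h1 := (hflat H h0).2
        have h2 : 0 < H (hom v) * H (hom v) := mul_self_pos.2 (hvS H hHS)
        have h3 : H (hom v) * H (hom v) = cw ρ' (hom v) c * (H (hom c) * H (hom v)) := by
          rw [← mul_assoc, ← h1]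
        nlinarith
      · have : c ∈ ρ.erase x := by rw [he]; exact Finset.mem_erase.2 ⟨hcx, hc⟩
        exact absurd hlt (not_lt.2 (hcon c (Finset.mem_of_mem_erase this)))
    simp only [hR]
    rw [Prod.Lex.toLex_lt_toLex]
    rcases hH with ⟨H, hHS, h0⟩ | hlt
    · left
      refine Finset.card_lt_card ⟨hsep, fun hss => ?_⟩
      have hvv : 0 < H (hom v) * H (hom v) := mul_self_pos.2 (hvS H hHS)
      obtain ⟨h1, h2⟩ := hflat H h0
      have hmem : H ∈ S.filter fun H => ∃ a ∈ ρ, H (hom a) * H (hom v) < 0 := by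
        refine Finset.mem_filter.2 ⟨hHS, x, hx, ?_⟩
        by_contra! h
        have : H (hom v) * H (hom v) = cw ρ (hom v) x * (H (hom x) * H (hom v)) := by
          rw [← mul_assoc, ← h1]
        nlinarith
      obtain ⟨-, a, ha, hlt⟩ := Finset.mem_filter.1 (hss hmem)
      by_cases hax : a = x'
      · subst hax
        have : H (hom v) * H (hom v) = cw ρ' (hom v) a * (H (hom a) * H (hom v)) := by
          rw [← mul_assoc, ← h2]
        nlinarith
      · rw [h0 a (he ▸ Finset.mem_erase.2 ⟨hax, ha⟩), zero_mul] at hlt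
        exact lt_irrefl _ hlt
    · rcases (Finset.card_le_card hsep).lt_or_eq with h | h
      · exact Or.inl h
      · exact Or.inr ⟨h, hlt⟩
  exact ⟨hF.exists_radial R hD (fun ρ hρ => hF.geo.notMem_of_cw_ne hE (hD hρ) (hne ρ hρ)) hne
    fun ρ hρ x hx h => Or.inr (hvis ρ hρ x hx h), fun hn => hF.core_of_radial R hD hn hne hvis⟩

/-- Starring a family from a generic point, provided all edges crossing the given hyperplanes are
interior. -/
lemma Tri.star_of_crossed (hdim : topCard E ≤ 4) (hE : 2 ≤ topCard E)
    {S : Finset (E × ℝ →ₗ[ℝ] ℝ)} (hS : ∀ H ∈ S, H ≠ 0) (T : Finset (E × ℝ →ₗ[ℝ] ℝ)) (hT : T ⊆ S)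
    (hF : Tri C B₀ F) {D : Finset (Finset E)} (hD : D ⊆ tops F)
    (hun : ∀ H ∈ S \ T, ∀ ρ ∈ D, ∀ a ∈ ρ, ∀ b ∈ ρ, H (hom a) < 0 → ¬ 0 < H (hom b))
    (hcr : ∀ H ∈ T, ∀ ρ ∈ D, ∀ a ∈ ρ, ∀ b ∈ ρ, H (hom a) < 0 → 0 < H (hom b) → Inn C {a, b}) :
    ∃ 𝓛 : Finset (E × ℝ →ₗ[ℝ] ℝ), (∀ L ∈ 𝓛, L ≠ 0) ∧ ∀ v, (∀ L ∈ 𝓛, L (hom v) ≠ 0) →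
      ∀ r, Vis S D v r →
      (∃ F', Tri C B₀ F' ∧ Conn C B₀ F F' ∧
        chn (tops F') = chn (tops F) + chn D + cn v (bd (chn D))) ∧
      (D.Nonempty → core C (hom v)) := by
  induction T using Finset.induction generalizing F D with
  | empty =>
    refine ⟨cfs F ∪ S, fun L hL => ?_, fun v hv r hV => ?_⟩
    · exact (Finset.mem_union.1 hL).elim (cfs_ne_zero hF.geo L) (hS L)
    · exact hF.star_of_uncrossed hE hD (by simpa using hun)
        (fun L hL => hv L (Finset.mem_union_left _ hL))
        (fun L hL => hv L (Finset.mem_union_right _ hL)) hV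
  | insert H T hHT ih =>
    have hHS := hT (Finset.mem_insert_self _ _)
    obtain ⟨N, hN⟩ : ∃ N, (((D.biUnion fun ρ => ρ ×ˢ ρ).filter fun p =>
      H (hom p.1) < 0 ∧ 0 < H (hom p.2)).card) = N := ⟨_, rfl⟩
    induction N using Nat.strongRecOn generalizing F D with
    | ind N ihN =>
    by_cases hcross : ∃ ρ ∈ D, ∃ a ∈ ρ, ∃ b ∈ ρ, H (hom a) < 0 ∧ 0 < H (hom b)
    · obtain ⟨ρ, hρ, a, ha, b, hb, hHa, hHb⟩ := hcross
      have hab : a ≠ b := by rintro rfl; exact lt_asymm hHa hHb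
      have hi := hcr H (Finset.mem_insert_self _ _) ρ hρ a ha b hb hHa hHb
      have hd : 0 < H (hom b) - H (hom a) := by linarith
      set p := H (hom b) / (H (hom b) - H (hom a)) with hp
      set q := -H (hom a) / (H (hom b) - H (hom a)) with hq
      have hp0 : 0 < p := div_pos hHb hd
      have hq0 : 0 < q := div_pos (by linarith) hd
      have hpq : p + q = 1 := by rw [hp, hq, ← add_div]; exact div_self hd.ne'
      set m := p • a + q • b with hmdef
      set α : E →₀ ℝ := Finsupp.single a p + Finsupp.single b q with hαdef
      have hαa : α a = p := by simp [hαdef, hab.symm]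
      have hαb : α b = q := by simp [hαdef, hab]
      have hα : 0 ≤ α := add_nonneg (Finsupp.single_nonneg.2 hp0.le) (Finsupp.single_nonneg.2
          hq0.le)
      have hs : α.support = {a, b} := by
        refine Finset.Subset.antisymm (Finsupp.support_add.trans ?_) fun x hx => ?_
        · refine Finset.union_subset (Finsupp.support_single_subset.trans (by simp))
            (Finsupp.support_single_subset.trans (by simp))
        · rw [Finset.mem_insert, Finset.mem_singleton] at hx
          rw [Finsupp.mem_support_iff]
          rcases hx with rfl | rfl
          · rw [hαa]; exact hp0.ne'
          · rw [hαb]; exact hq0.ne'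
      have hlin : ∀ L : E × ℝ →ₗ[ℝ] ℝ, L (Φ α) = p * L (hom a) + q * L (hom b) := fun L => by
        rw [hαdef, map_add, Φ_single, Φ_single, map_add, map_smul, map_smul, smul_eq_mul,
            smul_eq_mul]
      have hm : Φ α = hom m := by
        rw [hαdef, map_add, Φ_single, Φ_single]
        simp [hom, hmdef, hpq]
      have hHm : H (hom m) = 0 := by
        rw [← hm, hlin, hp, hq]; field_simp; ring
      have heF : α.support ∈ F := by
        rw [hs]
        exact hF.geo.down _ (mem_tops.1 (hD hρ)).1 _ (by simp [Finset.insert_subset_iff, ha, hb])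
      have h2 : 2 ≤ α.support.card := by rw [hs, Finset.card_pair hab]
      have hmF := hF.geo.singleton_notMem hα heF h2 hm
      have hmD : ∀ ρ ∈ tops F, m ∉ ρ := fun ρ hρ h =>
        hmF (hF.geo.down _ (mem_tops.1 hρ).1 _ (by simpa))
      have ham : a ≠ m := fun h => hmD ρ (hD hρ) (h ▸ ha)
      have hbm : b ≠ m := fun h => hmD ρ (hD hρ) (h ▸ hb)
      have hcorem : core C (hom m) := by
        rw [← hm]; exact hF.core_of_inn_subset hα heF (by rwa [hs]) subset_rfl
      obtain ⟨hG, hFG⟩ := hF.stell hdim hE hα heF (by rwa [hs]) h2 hm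
      rw [hs] at hG hFG
      set G := exch F {a, b} {m} with hGdef
      have hGt : tops G = stS a b m (tops F) := tops_stell_edge hF.geo hmF
      have hD' : stS a b m D ⊆ tops G := hGt ▸ stS_subset hD
      have hmI : Inn C {m} := inn_singleton.2 hcorem
      have hmem : ∀ σ ∈ stS a b m D, σ ∈ D ∨
          ∃ g ∈ D, a ∈ g ∧ b ∈ g ∧ ∀ x ∈ σ, x = m ∨ x ∈ g := by
        intro σ hσ
        rcases mem_stS.1 hσ with h | ⟨g, hg, ha, hb, rfl | rfl⟩
        · exact Or.inl h.1
        · exact Or.inr ⟨g, hg, ha, hb, fun x hx => (Finset.mem_insert.1 hx).imp id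
            Finset.mem_of_mem_erase⟩
        · exact Or.inr ⟨g, hg, ha, hb, fun x hx => (Finset.mem_insert.1 hx).imp id
            Finset.mem_of_mem_erase⟩
      have hun' : ∀ H' ∈ S \ insert H T, ∀ σ ∈ stS a b m D, ∀ x ∈ σ, ∀ y ∈ σ,
          H' (hom x) < 0 → ¬ 0 < H' (hom y) := by
        intro H' hH' σ hσ x hx y hy hx0 hy0
        rcases hmem σ hσ with hσD | ⟨g, hg, hag, hbg, hsub⟩
        · exact hun H' hH' σ hσD x hx y hy hx0 hy0
        · have hu := hun H' hH' g hg
          have hHm' : H' (hom m) = p * H' (hom a) + q * H' (hom b) := by rw [← hm, hlin]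
          rcases hsub x hx with rfl | hxg <;> rcases hsub y hy with rfl | hyg
          · exact lt_asymm hx0 hy0
          · have h1 : 0 ≤ H' (hom a) := not_lt.1 fun h => hu a hag y hyg h hy0
            have h2 : 0 ≤ H' (hom b) := not_lt.1 fun h => hu b hbg y hyg h hy0
            have := mul_nonneg hp0.le h1
            have := mul_nonneg hq0.le h2
            linarith
          · have h1 : H' (hom a) ≤ 0 := not_lt.1 fun h => hu x hxg a hag hx0 h
            have h2 : H' (hom b) ≤ 0 := not_lt.1 fun h => hu x hxg b hbg hx0 h
            have := mul_nonpos_of_nonneg_of_nonpos hp0.le h1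
            have := mul_nonpos_of_nonneg_of_nonpos hq0.le h2
            linarith
          · exact hu x hxg y hyg hx0 hy0
      have hcr' : ∀ H' ∈ insert H T, ∀ σ ∈ stS a b m D, ∀ x ∈ σ, ∀ y ∈ σ,
          H' (hom x) < 0 → 0 < H' (hom y) → Inn C {x, y} := by
        intro H' hH' σ hσ x hx y hy hx0 hy0
        have hxy : {x, y} ∈ G := hG.geo.down _ (mem_tops.1 (hD' hσ)).1 _
          (by simp [Finset.insert_subset_iff, hx, hy])
        rcases hmem σ hσ with hσD | ⟨g, hg, hag, hbg, hsub⟩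
        · exact hcr H' hH' σ hσD x hx y hy hx0 hy0
        · rcases hsub x hx with rfl | hxg
          · exact hG.inn_mono (by simp) hxy hmI
          rcases hsub y hy with rfl | hyg
          · exact hG.inn_mono (by simp) hxy hmI
          exact hcr H' hH' g hg x hxg y hyg hx0 hy0
      have hlt : ((((stS a b m D).biUnion fun ρ => ρ ×ˢ ρ).filter fun p =>
          H (hom p.1) < 0 ∧ 0 < H (hom p.2)).card) < N := by
        rw [← hN]
        refine Finset.card_lt_card (Finset.ssubset_iff_of_subset ?_ |>.2 ⟨(a, b), ?_, ?_⟩)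
        · rintro ⟨x, y⟩ hxy
          simp only [Finset.mem_filter, Finset.mem_biUnion, Finset.mem_product] at hxy ⊢
          obtain ⟨⟨σ, hσ, hx, hy⟩, hx0, hy0⟩ := hxy
          refine ⟨?_, hx0, hy0⟩
          rcases hmem σ hσ with hσD | ⟨g, hg, -, -, hsub⟩
          · exact ⟨σ, hσD, hx, hy⟩
          · refine ⟨g, hg, (hsub x hx).resolve_left ?_, (hsub y hy).resolve_left ?_⟩
            · rintro rfl; exact hx0.ne hHm
            · rintro rfl; exact hy0.ne' hHm
        · simp only [Finset.mem_filter, Finset.mem_biUnion, Finset.mem_product]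
          exact ⟨⟨ρ, hρ, ha, hb⟩, hHa, hHb⟩
        · simp only [Finset.mem_filter, Finset.mem_biUnion, Finset.mem_product, not_and]
          rintro ⟨σ, hσ, hx, hy⟩
          exfalso
          rcases mem_stS.1 hσ with h | ⟨g, hg, -, -, rfl | rfl⟩
          · exact h.2 ⟨hx, hy⟩
          · simp [ham] at hx
          · simp [hbm] at hy
      obtain ⟨𝓛, h𝓛, hmain⟩ := ihN _ hlt hG hD' hun' hcr' rfl
      refine ⟨insert H (𝓛 ∪ cfs F), fun L hL => ?_, fun v hv r hV => ?_⟩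
      · rcases Finset.mem_insert.1 hL with rfl | hL
        · exact hS _ hHS
        · exact (Finset.mem_union.1 hL).elim (h𝓛 L) (cfs_ne_zero hF.geo L)
      have hvH := hv H (Finset.mem_insert_self _ _)
      have hvρ : v ∉ ρ := hF.geo.notMem_of_cw_ne hE (hD hρ) fun x hx => hv _
        (Finset.mem_insert_of_mem (Finset.mem_union_right _ (mem_cfs.2 ⟨ρ, hD hρ, x, hx, rfl⟩)))
      have hvm : m ≠ v := fun h => hvH (h ▸ hHm)
      obtain ⟨r', hV'⟩ := hV.stell hF.geo hD hG.geo hab hGt hmF hα hs hm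
      obtain ⟨⟨G', hG', hGG', hch⟩, hcore⟩ := hmain v
        (fun L hL => hv L (Finset.mem_insert_of_mem (Finset.mem_union_left _ hL))) r' hV'
      have hav : Avoid m (chn D) := Avoid.chn fun g hg => hmD g (hD hg)
      refine ⟨?_, fun hn => hcore ?_⟩
      · obtain ⟨F', hF', hc, hch'⟩ := hG'.unstell hdim hE ham hbm hab hα hs hm hcorem
          (c := chn (tops F) + chn D + cn v (bd (chn D)))
          (((Avoid.chn hmD).add hav).add (hav.bd.cn hvm)) (by
            rw [hch, hGt, chn_stS ham hbm hab hmD, chn_stS ham hbm hab fun g hg => hmD g (hD hg),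
              map_add, map_add, st_cn (show v ≠ a by rintro rfl; exact hvρ ha)
                (show v ≠ b by rintro rfl; exact hvρ hb), st_bd ham hbm hab hav])
        exact ⟨F', hF', (hFG.trans hGG').trans hc.symm, hch'⟩
      · exact ⟨insert m (ρ.erase a), mem_stS.2 (Or.inr ⟨ρ, hρ, ha, hb, Or.inl rfl⟩)⟩
    · refine ih ((Finset.subset_insert _ _).trans hT) hF hD (fun H' hH' => ?_)
        (fun H' hH' => hcr H' (Finset.mem_insert_of_mem hH'))
      by_cases h : H' = H
      · subst h
        intro ρ hρ a ha b hb h1 h2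
        exact hcross ⟨ρ, hρ, a, ha, b, hb, h1, h2⟩
      · rw [Finset.mem_sdiff] at hH'
        exact hun H' (Finset.mem_sdiff.2 ⟨hH'.1, by simp [h, hH'.2]⟩)

/-- Coning off a family of tops whose common facets are crossed by interior edges only. -/
lemma Tri.exists_star (hdim : topCard E ≤ 4) (hE : 2 ≤ topCard E) (hF : Tri C B₀ F)
    {D : Finset (Finset E)} (hD : D ⊆ tops F)
    (hcr : ∀ ρ ∈ D, ∀ x ∈ ρ, (∃ ρ' ∈ D, ρ' ≠ ρ ∧ ρ.erase x ⊆ ρ') → ∀ σ ∈ D, ∀ a ∈ σ, ∀ b ∈ σ,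
      cw ρ (hom a) x < 0 → 0 < cw ρ (hom b) x → Inn C {a, b}) :
    ∃ 𝓛 : Finset (E × ℝ →ₗ[ℝ] ℝ), (∀ L ∈ 𝓛, L ≠ 0) ∧ ∀ v, (∀ L ∈ 𝓛, L (hom v) ≠ 0) →
      (∀ ρ ∈ D, ∀ x ∈ ρ, cw ρ (hom v) x < 0 → ∃ ρ' ∈ D, ρ' ≠ ρ ∧ ρ.erase x ⊆ ρ') →
      (∃ F', Tri C B₀ F' ∧ Conn C B₀ F F' ∧
        chn (tops F') = chn (tops F) + chn D + cn v (bd (chn D))) ∧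
      (D.Nonempty → core C (hom v)) := by
  set S : Finset (E × ℝ →ₗ[ℝ] ℝ) := D.biUnion fun ρ =>
    (ρ.filter fun x => ∃ ρ' ∈ D, ρ' ≠ ρ ∧ ρ.erase x ⊆ ρ').image (cf ρ) with hS
  have hmem : ∀ H, H ∈ S ↔ ∃ ρ ∈ D, ∃ x, (x ∈ ρ ∧ ∃ ρ' ∈ D, ρ' ≠ ρ ∧ ρ.erase x ⊆ ρ') ∧
      cf ρ x = H := fun H => by
    simp [hS]
  obtain ⟨𝓛, h𝓛, hmain⟩ := Tri.star_of_crossed hdim hE (S := S) (fun H hH => by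
      obtain ⟨ρ, hρ, x, ⟨hx, -⟩, rfl⟩ := (hmem H).1 hH
      exact cf_ne_zero hF.geo (hD hρ) hx) S subset_rfl hF hD (by simp) (fun H hH => by
      obtain ⟨ρ, hρ, x, ⟨hx, h⟩, rfl⟩ := (hmem H).1 hH
      exact hcr ρ hρ x hx h)
  refine ⟨𝓛, h𝓛, fun v hv hvis => hmain v hv (fun _ => 0) fun ρ hρ x hx hneg => ?_⟩
  obtain ⟨ρ', hρ', hne, hsub⟩ := hvis ρ hρ x hx hneg
  refine ⟨ρ', hρ', hne, hsub, Or.inl ⟨cf ρ x, (hmem _).2 ⟨ρ, hρ, x, ⟨hx, ρ', hρ', hne, hsub⟩, rfl⟩,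
    fun y hy => ?_⟩⟩
  rw [cf_apply, hF.geo.cw_hom (mem_tops.1 (hD hρ)).1 (mem_tops.1 (hD hρ)).2
    (Finset.mem_of_mem_erase hy), Finsupp.single_eq_of_ne (Finset.mem_erase.1 hy).1.symm]

end FiniteDim

end GeoFlip

namespace GeoFlip

variable {C : Set (E × ℝ)} {B₀ : Finset (Finset E)} {F F' F₁ F₂ : Finset (Finset E)}

lemma cn_apply {v : E} {c : Chain E} (hc : Avoid v c) (σ : Finset E) :
    cn v c σ = if v ∈ σ then c (σ.erase v) else 0 := by
  refine Chain.induction_off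
    (p := fun c => cn v c σ = if v ∈ σ then c (σ.erase v) else 0) (fun g hg => ?_)
    (by simp) (fun c d h h' => ?_) c hc
  · replace hg : v ∉ g := hg
    rw [cn_single]
    split_ifs with h
    · simp only [Finsupp.single_apply]
      congr 1
      refine propext ⟨fun h' => ?_, fun h' => ?_⟩
      · rw [← h', Finset.erase_insert hg]
      · rw [h', Finset.insert_erase h]
    · exact Finsupp.single_eq_of_ne (by rintro rfl; exact h (Finset.mem_insert_self _ _))
  · rw [map_add, Finsupp.add_apply, h, h']
    split_ifs <;> simp

/-- Tops after coning off a family of tops. -/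
lemma mem_tops_of_chn {D : Finset (Finset E)} {v : E} (hD : D ⊆ tops F) (hv : ∀ ρ ∈ tops F, v ∉ ρ)
    (h : chn (tops F') = chn (tops F) + chn D + cn v (bd (chn D))) (σ : Finset E) :
    σ ∈ tops F' ↔ (v ∉ σ ∧ σ ∈ tops F ∧ σ ∉ D) ∨ (v ∈ σ ∧ bd (chn D) (σ.erase v) ≠ 0) := by
  have h1 := DFunLike.congr_fun h σ
  rw [Finsupp.add_apply, Finsupp.add_apply,
    cn_apply (Avoid.bd (Avoid.chn fun g hg => hv g (hD hg))), chn_apply, chn_apply, chn_apply] at h1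
  by_cases hvσ : v ∈ σ
  · have h2 : σ ∉ tops F := fun h => hv σ h hvσ
    rw [if_neg h2, if_neg (fun h => h2 (hD h)), if_pos hvσ, zero_add, zero_add] at h1
    rw [← h1]
    simp [hvσ]
  · rw [if_neg hvσ, add_zero] at h1
    have h01 : (0 : ZMod 2) ≠ 1 := by decide
    by_cases h2 : σ ∈ tops F <;> by_cases h3 : σ ∈ D <;> by_cases h4 : σ ∈ tops F' <;>
      simp_all [CharTwo.add_self_eq_zero]
    exact h2 (hD h3)

variable [FiniteDimensional ℝ E]

/-- A facet in the boundary of a family of tops lies in exactly one of them. -/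
lemma Geo.exists_unique_of_bd_ne (hF : Geo F) {D : Finset (Finset E)} (hD : D ⊆ tops F)
    {τ : Finset E} (h : bd (chn D) τ ≠ 0) :
    ∃ ρ ∈ D, ∃ x ∈ ρ, τ = ρ.erase x ∧ ∀ ρ' ∈ D, τ ⊆ ρ' → ρ' = ρ := by
  rw [bd_chn_apply] at h
  set S := D.filter fun ρ => ∃ c, c ∉ τ ∧ ρ = insert c τ with hS
  have h2 : S.card ≤ 2 := by
    by_contra! hcon
    obtain ⟨σ₁, σ₂, σ₃, h1, h2, h3, h12, h13, h23⟩ := Finset.two_lt_card_iff.1 hcon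
    rw [hS, Finset.mem_filter] at h1 h2 h3
    obtain ⟨h1, a, ha, rfl⟩ := h1
    obtain ⟨h2, b, hb, rfl⟩ := h2
    obtain ⟨h3, c, hc, rfl⟩ := h3
    replace h1 := mem_tops.1 (hD h1)
    replace h2 := mem_tops.1 (hD h2)
    replace h3 := mem_tops.1 (hD h3)
    have hab : a ≠ b := by rintro rfl; exact h12 rfl
    have hac : a ≠ c := by rintro rfl; exact h13 rfl
    have hbc : b ≠ c := by rintro rfl; exact h23 rfl
    have e1 := hF.two_sides ha hc hac h1.1 h3.1 h1.2
    have e2 := (hF.neg_iff_pos ha hb hab h1.1 h2.1 h1.2 (hom c)).1 e1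
    have e3 := hF.two_sides hb hc hbc h2.1 h3.1 h2.2
    linarith
  have h1 : S.card = 1 := by
    interval_cases hc : S.card
    · simp at h
    · rfl
    · exact absurd (by decide) h
  obtain ⟨ρ, hρ⟩ := Finset.card_eq_one.1 h1
  have hρS : ρ ∈ S := by rw [hρ]; simp
  obtain ⟨hρD, c, hc, rfl⟩ := Finset.mem_filter.1 hρS
  refine ⟨_, hρD, c, Finset.mem_insert_self _ _, (Finset.erase_insert hc).symm,
    fun ρ' hρ' hsub => ?_⟩
  obtain ⟨x', hx', he⟩ := exists_erase_of_subset (Finset.mem_insert_self c τ)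
    ((mem_tops.1 (hD hρD)).2.trans (mem_tops.1 (hD hρ')).2.symm)
    (by rwa [Finset.erase_insert hc])
  rw [Finset.erase_insert hc] at he
  have : ρ' ∈ S := Finset.mem_filter.2 ⟨hρ', x', by rw [he]; exact Finset.notMem_erase _ _,
    by rw [he, Finset.insert_erase hx']⟩
  rw [hρ] at this
  exact Finset.mem_singleton.1 this

/-- The tops meeting `I` whose vertices outside `I` are `s`. -/
noncomputable def layer (F : Finset (Finset E)) (I s : Finset E) : Finset (Finset E) :=
  (tops F).filter fun ρ => ρ \ I = s ∧ ¬ Disjoint ρ I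

lemma mem_layer {I s ρ : Finset E} :
    ρ ∈ layer F I s ↔ ρ ∈ tops F ∧ ρ \ I = s ∧ ¬ Disjoint ρ I := by
  simp [layer]

lemma layer_subset {I s : Finset E} : layer F I s ⊆ tops F := Finset.filter_subset _ _

/-- State of the radial sweep with centre `o`: layers in `U` are still to be processed. -/
structure Sweep (C : Set (E × ℝ)) (B₀ F : Finset (Finset E)) (o : E) (I : Finset E)
    (U : Finset (Finset E)) : Prop where
  tri : Tri C B₀ F
  neg : ∀ σ ∈ tops F, ¬ Disjoint σ I → σ \ I ∉ U → ∀ x ∈ σ \ I, cw σ (hom o) x < 0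
  pos : ∀ σ ∈ tops F, ∀ i, σ ∩ I = {i} → σ \ I ∈ U → 0 < cw σ (hom o) i

variable {o : E} {I s : Finset E} {U : Finset (Finset E)}

lemma Sweep.exists_or_pos (h : Sweep C B₀ F o I U) (hI : ∀ i ∈ I, Inn C {i}) (hs : s ∈ U)
    (hmax : ∀ t ∈ U, s ⊆ t → t = s) {ρ : Finset E} (hρ : ρ ∈ layer F I s) {i : E} (hi : i ∈ ρ)
    (hiI : i ∈ I) :
    (∃ ρ' ∈ layer F I s, ρ' ≠ ρ ∧ ρ.erase i ⊆ ρ') ∨ 0 < cw ρ (hom o) i := by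
  obtain ⟨hρt, hρs, -⟩ := mem_layer.1 hρ
  obtain ⟨hρF, hρc⟩ := mem_tops.1 hρt
  by_cases h1 : ρ ∩ I = {i}
  · exact Or.inr (h.pos ρ hρt i h1 (by rwa [hρs]))
  obtain ⟨j, hj, hji⟩ : ∃ j ∈ ρ ∩ I, j ≠ i := by
    by_contra! hcon
    exact h1 (Finset.eq_singleton_iff_unique_mem.2 ⟨Finset.mem_inter.2 ⟨hi, hiI⟩, hcon⟩)
  obtain ⟨hjρ, hjI⟩ := Finset.mem_inter.1 hj
  have hτF : ρ.erase i ∈ F := h.tri.geo.down _ hρF _ (Finset.erase_subset _ _)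
  have hfull : Full F (ρ.erase i) := (h.tri.inn_iff hτF).1 (h.tri.inn_mono
    (f := {j}) (g := ρ.erase i)
    (by simpa using ⟨hji, hjρ⟩) hτF (hI j hjI))
  have hins := Finset.insert_erase hi
  obtain ⟨y, hyτ, hyi, hyF, -⟩ := h.tri.geo.exists_other (c := i) (Finset.notMem_erase _ _) hfull
    (by rwa [hins]) (by rwa [hins]) (y := - hom i)
    (by rw [hins, map_neg, h.tri.geo.cw_hom hρF hρc hi]; simp)
  have hyc : (insert y (ρ.erase i)) ∈ tops F := by
    refine mem_tops.2 ⟨hyF, ?_⟩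
    rw [Finset.card_insert_of_notMem hyτ, ← hρc, Finset.card_erase_add_one hi]
  have hne : insert y (ρ.erase i) ≠ ρ := by
    intro he
    have : y ∈ ρ := by rw [← he]; exact Finset.mem_insert_self _ _
    exact hyτ (Finset.mem_erase.2 ⟨hyi, this⟩)
  have hnd : ¬ Disjoint (insert y (ρ.erase i)) I := fun hd =>
    Finset.disjoint_left.1 hd (Finset.mem_insert_of_mem (Finset.mem_erase.2 ⟨hji, hjρ⟩)) hjI
  have hsd : (ρ.erase i) \ I = s := by
    rw [← hρs, Finset.erase_sdiff_comm, Finset.erase_eq_of_notMem (by simp [hiI])]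
  by_cases hyI : y ∈ I
  · refine Or.inl ⟨_, mem_layer.2 ⟨hyc, ?_, hnd⟩, hne, Finset.subset_insert _ _⟩
    rw [Finset.insert_sdiff_of_mem _ hyI, hsd]
  · right
    have hys : y ∉ s := fun hys => hyτ (by
      rw [← hsd] at hys; exact (Finset.mem_sdiff.1 hys).1)
    have hsd' : insert y (ρ.erase i) \ I = insert y s := by
      rw [Finset.insert_sdiff_of_notMem _ hyI, hsd]
    have hneg := h.neg _ hyc hnd (by
      rw [hsd']
      intro hU
      exact hys ((hmax _ hU (Finset.subset_insert _ _)) ▸ Finset.mem_insert_self _ _)) y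
      (by rw [hsd']; exact Finset.mem_insert_self _ _)
    exact (h.tri.geo.facet_neg_iff hyc hρt hne (Finset.mem_insert_self _ _) hi
      (Finset.erase_insert hyτ) _).1 hneg

lemma Sweep.erase (h : Sweep C B₀ F o I U) (he : layer F I s = ∅) :
    Sweep C B₀ F o I (U.erase s) where
  tri := h.tri
  neg σ hσ hd hU x hx := by
    refine h.neg σ hσ hd (fun hU' => ?_) x hx
    by_cases hs : σ \ I = s
    · exact Finset.notMem_empty σ (he ▸ mem_layer.2 ⟨hσ, hs, hd⟩)
    · exact hU (Finset.mem_erase.2 ⟨hs, hU'⟩)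
  pos σ hσ i hi hU := h.pos σ hσ i hi (Finset.mem_of_mem_erase hU)

/-- The centre used to cone off a layer is well placed for `F`. -/
structure Centre (F : Finset (Finset E)) (o : E) (I s : Finset E) (v : E) : Prop where
  ne : ∀ ρ ∈ tops F, ∀ x ∈ ρ, cw ρ (hom v) x ≠ 0
  pos : ∀ ρ ∈ layer F I s, ∀ x ∈ s, 0 < cw ρ (hom v) x
  keep : ∀ ρ ∈ layer F I s, ∀ i ∈ ρ, i ∈ I → 0 < cw ρ (hom o) i → 0 < cw ρ (hom v) i
  lt : ∀ ρ ∈ layer F I s, ∀ i ∈ ρ, i ∈ I → 0 < cw ρ (hom o) i → ∀ y ∈ s,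
    cw ρ (hom o) y * cw ρ (hom v) i < cw ρ (hom o) i * cw ρ (hom v) y

lemma Sweep.step (hE : 2 ≤ topCard E) (h : Sweep C B₀ F o I U) (hI : ∀ i ∈ I, Inn C {i})
    (hs : s ∈ U) (hlow : ∀ t ∈ U, ∀ t' ⊆ t, t' ∈ U)
    (hmax : ∀ t ∈ U, s ⊆ t → t = s) {v : E} (hv : Centre F o I s v) (hF' : Tri C B₀ F')
    (hch : chn (tops F') = chn (tops F) + chn (layer F I s) + cn v (bd (chn (layer F I s)))) :
    Sweep C B₀ F' o (insert v I) (U.erase s) := by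
  have hD : layer F I s ⊆ tops F := layer_subset
  have hvn : ∀ ρ ∈ tops F, v ∉ ρ := fun ρ hρ => h.tri.geo.notMem_of_cw_ne hE hρ (hv.ne ρ hρ)
  have hmem := mem_tops_of_chn hD hvn hch
  have hnew : ∀ σ ∈ tops F', v ∈ σ → ∃ ρ ∈ layer F I s, ∃ x ∈ ρ, σ = insert v (ρ.erase x) ∧
      ∀ ρ' ∈ layer F I s, ρ.erase x ⊆ ρ' → ρ' = ρ := by
    intro σ hσ hvσ
    rcases (hmem σ).1 hσ with h1 | ⟨-, h1⟩
    · exact absurd hvσ h1.1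
    · obtain ⟨ρ, hρ, x, hx, he, hu⟩ := h.tri.geo.exists_unique_of_bd_ne hD h1
      exact ⟨ρ, hρ, x, hx, by rw [← he, Finset.insert_erase hvσ], by rwa [← he]⟩
  have hold : ∀ σ, v ∉ σ → σ ∩ insert v I = σ ∩ I ∧ σ \ insert v I = σ \ I := fun σ hσ =>
    ⟨Finset.inter_insert_of_notMem hσ, by
      rw [Finset.sdiff_insert, Finset.erase_eq_of_notMem fun h => hσ (Finset.mem_sdiff.1 h).1]⟩
  have hsd : ∀ ρ ∈ layer F I s, ∀ x, insert v (ρ.erase x) \ insert v I = s.erase x := by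
    intro ρ hρ x
    obtain ⟨hρt, hρs, -⟩ := mem_layer.1 hρ
    rw [Finset.insert_sdiff_of_mem _ (Finset.mem_insert_self _ _),
      (hold (ρ.erase x) fun h => hvn ρ hρt (Finset.mem_of_mem_erase h)).2,
      Finset.erase_sdiff_comm, hρs]
  refine ⟨hF', fun σ hσ hd hU y hy => ?_, fun σ hσ i hi hU => ?_⟩
  · by_cases hvσ : v ∈ σ
    · obtain ⟨ρ, hρ, x, hx, rfl, hu⟩ := hnew σ hσ hvσ
      obtain ⟨hρt, hρs, -⟩ := mem_layer.1 hρ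
      rw [hsd ρ hρ] at hU hy
      by_cases hxs : x ∈ s
      · exact absurd (Finset.mem_erase.2 ⟨fun he => (Finset.notMem_erase x s) (by rwa [he]),
          hlow s hs _ (Finset.erase_subset _ _)⟩) hU
      have hxI : x ∈ I := by
        by_contra hxI
        exact hxs (hρs ▸ Finset.mem_sdiff.2 ⟨hx, hxI⟩)
      have hys : y ∈ s := Finset.mem_of_mem_erase hy
      have hqx : 0 < cw ρ (hom o) x := by
        rcases h.exists_or_pos hI hs hmax hρ hx hxI with ⟨ρ', h1, h2, h3⟩ | h1
        · exact absurd (hu ρ' h1 h3) h2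
        · exact h1
      have hpx := hv.keep ρ hρ x hx hxI hqx
      obtain ⟨hsup, hΦ⟩ := h.tri.geo.cw_spec (mem_tops.1 hρt).1 (mem_tops.1 hρt).2 (hom v)
      rw [cw_stell h.tri.geo hρt hΦ hsup (Finsupp.mem_support_iff.2 hpx.ne') hF'.geo hσ]
      have hyv : v ≠ y := fun he => hvn ρ hρt (by
        rw [he]; exact (Finset.mem_sdiff.1 (by rw [hρs]; exact hys : y ∈ ρ \ I)).1)
      have hlt := hv.lt ρ hρ x hx hxI hqx y hys
      rw [Finsupp.add_apply, Finsupp.smul_apply, Finsupp.sub_apply,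
        Finsupp.single_eq_of_ne hyv.symm, zero_sub, smul_eq_mul]
      have : cw ρ (hom o) y < cw ρ (hom o) x * cw ρ (hom v) y / cw ρ (hom v) x := by
        rwa [lt_div_iff₀ hpx]
      calc _ = cw ρ (hom o) y - cw ρ (hom o) x * cw ρ (hom v) y / cw ρ (hom v) x := by ring
        _ < 0 := by linarith
    · obtain ⟨h1, h2⟩ := hold σ hvσ
      rw [h2] at hU hy
      obtain ⟨hσt, hσD⟩ : σ ∈ tops F ∧ σ ∉ layer F I s := by
        rcases (hmem σ).1 hσ with h1 | ⟨h1, -⟩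
        · exact h1.2
        · exact absurd h1 hvσ
      have hd' : ¬ Disjoint σ I := by
        rwa [Finset.disjoint_iff_inter_eq_empty, ← h1, ← Finset.disjoint_iff_inter_eq_empty]
      refine h.neg σ hσt hd' (fun hU' => hU (Finset.mem_erase.2 ⟨fun he => ?_, hU'⟩)) y hy
      exact hσD (mem_layer.2 ⟨hσt, he, hd'⟩)
  · by_cases hvσ : v ∈ σ
    · exfalso
      obtain ⟨ρ, hρ, x, hx, rfl, hu⟩ := hnew σ hσ hvσ
      obtain ⟨hρt, hρs, hnd⟩ := mem_layer.1 hρ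
      rw [hsd ρ hρ] at hU
      have hxs : x ∈ s := by
        by_contra hxs
        rw [Finset.erase_eq_of_notMem hxs] at hU
        exact Finset.notMem_erase _ _ hU
      obtain ⟨j, hj, hjI⟩ := Finset.not_disjoint_iff.1 hnd
      have hxj : j ≠ x := by
        rintro rfl
        exact (Finset.mem_sdiff.1 (by rw [hρs]; exact hxs : j ∈ ρ \ I)).2 hjI
      have h1 : v ∈ ({i} : Finset E) := hi ▸ Finset.mem_inter.2 ⟨hvσ, Finset.mem_insert_self _ _⟩
      have h2 : j ∈ ({i} : Finset E) := hi ▸ Finset.mem_inter.2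
        ⟨Finset.mem_insert_of_mem (Finset.mem_erase.2 ⟨hxj, hj⟩), Finset.mem_insert_of_mem hjI⟩
      rw [Finset.mem_singleton] at h1 h2
      exact hvn ρ hρt (h1.trans h2.symm ▸ hj)
    · obtain ⟨h1, h2⟩ := hold σ hvσ
      rw [h2] at hU
      rw [h1] at hi
      have hσt : σ ∈ tops F := by
        rcases (hmem σ).1 hσ with h1 | ⟨h1, -⟩
        · exact h1.2.1
        · exact absurd h1 hvσ
      exact h.pos σ hσt i hi (Finset.mem_of_mem_erase hU)

/-- The chain of a layer has a well determined boundary. -/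
lemma bd_layer_eq (hF₁ : Tri C B₀ F₁) (hF₂ : Tri C B₀ F₂)
    (hmax : ∀ t ∈ U, s ⊆ t → t = s)
    (hag : ∀ σ, (Disjoint σ I ∨ σ \ I ∉ U) → (σ ∈ tops F₁ ↔ σ ∈ tops F₂))
    {τ : Finset E} (hτ : τ \ I = s) :
    bd (chn (layer F₁ I s)) τ = bd (chn (layer F₂ I s)) τ := by
  have key : ∀ G : Finset (Finset E),
      chn (tops G) = chn (layer G I s) + chn (tops G \ layer G I s) := fun G => by
    rw [← chn_union Finset.disjoint_sdiff, Finset.union_sdiff_of_subset layer_subset]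
  have h := DFunLike.congr_fun (hF₁.bd_eq hF₂) τ
  rw [key F₁, key F₂, map_add, map_add, Finsupp.add_apply, Finsupp.add_apply] at h
  have h2 : bd (chn (tops F₁ \ layer F₁ I s)) τ = bd (chn (tops F₂ \ layer F₂ I s)) τ := by
    rw [bd_chn_apply, bd_chn_apply]
    congr 2
    ext ρ
    simp only [Finset.mem_filter, Finset.mem_sdiff, mem_layer]
    refine and_congr_left fun ⟨c, hc, he⟩ => ?_
    have hsub : s ⊆ ρ \ I := by
      rw [← hτ, he]
      exact Finset.sdiff_subset_sdiff (Finset.subset_insert _ _) subset_rfl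
    by_cases h1 : Disjoint ρ I
    · simp [h1, hag ρ (Or.inl h1)]
    · by_cases h2 : ρ \ I = s
      · simp [h1, h2]
      · have : ρ \ I ∉ U := fun hU => h2 (hmax _ hU hsub)
        simp [h2, hag ρ (Or.inr this)]
  rw [h2] at h
  exact add_right_cancel h

lemma Sweep.agree_step (hE : 2 ≤ topCard E) (h₁ : Sweep C B₀ F₁ o I U) (h₂ : Sweep C B₀ F₂ o I U)
    (hs : s ∈ U) (hlow : ∀ t ∈ U, ∀ t' ⊆ t, t' ∈ U) (hmax : ∀ t ∈ U, s ⊆ t → t = s)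
    (hag : ∀ σ, (Disjoint σ I ∨ σ \ I ∉ U) → (σ ∈ tops F₁ ↔ σ ∈ tops F₂)) {v : E}
    (hv₁ : Centre F₁ o I s v) (hv₂ : Centre F₂ o I s v) {G₁ G₂ : Finset (Finset E)}
    (hch₁ : chn (tops G₁) = chn (tops F₁) + chn (layer F₁ I s) + cn v (bd (chn (layer F₁ I s))))
    (hch₂ : chn (tops G₂) = chn (tops F₂) + chn (layer F₂ I s) + cn v (bd (chn (layer F₂ I s)))) :
    ∀ σ, (Disjoint σ (insert v I) ∨ σ \ insert v I ∉ U.erase s) →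
      (σ ∈ tops G₁ ↔ σ ∈ tops G₂) := by
  intro σ hσ
  rw [mem_tops_of_chn layer_subset
      (fun ρ hρ => h₁.tri.geo.notMem_of_cw_ne hE hρ (hv₁.ne ρ hρ)) hch₁,
    mem_tops_of_chn layer_subset
      (fun ρ hρ => h₂.tri.geo.notMem_of_cw_ne hE hρ (hv₂.ne ρ hρ)) hch₂]
  by_cases hvσ : v ∈ σ
  · simp only [hvσ, not_true_eq_false, false_and, true_and, false_or]
    have hU : σ.erase v \ I ∉ U.erase s := by
      rcases hσ with h | h
      · exact absurd (Finset.mem_insert_self v I) (Finset.disjoint_left.1 h hvσ)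
      · rwa [Finset.sdiff_insert, ← Finset.erase_sdiff_comm] at h
    by_cases hτ : σ.erase v \ I = s
    · rw [bd_layer_eq h₁.tri h₂.tri hmax hag hτ]
    · have hz : ∀ F, Sweep C B₀ F o I U → bd (chn (layer F I s)) (σ.erase v) = 0 := by
        intro F h
        by_contra hne
        obtain ⟨ρ, hρ, x, hx, he, -⟩ :=
          h.tri.geo.exists_unique_of_bd_ne layer_subset hne
        refine hU (Finset.mem_erase.2 ⟨hτ, hlow s hs _ ?_⟩)
        rw [← (mem_layer.1 hρ).2.1, he]
        exact Finset.sdiff_subset_sdiff (Finset.erase_subset _ _) subset_rfl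
      rw [hz F₁ h₁, hz F₂ h₂]
  · simp only [hvσ, not_false_eq_true, true_and, false_and, or_false, mem_layer]
    rw [Finset.disjoint_insert_right, Finset.sdiff_insert,
      Finset.erase_eq_of_notMem fun h => hvσ (Finset.mem_sdiff.1 h).1] at hσ
    by_cases h1 : Disjoint σ I
    · simp [h1, hag σ (Or.inl h1)]
    · by_cases h2 : σ \ I = s
      · simp [h1, h2]
      · have : σ \ I ∉ U := fun hU => by
          rcases hσ with h | h
          · exact h1 h.2
          · exact h (Finset.mem_erase.2 ⟨h2, hU⟩)
        simp [h2, hag σ (Or.inr this)]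

lemma exists_hom_eq (s : Finset E) (o : E) {M : ℝ} (hM : 0 ≤ M) :
    ∃ (c : E) (κ δ : ℝ), 0 < κ ∧ 0 < δ ∧ δ * M < κ ∧ hom c = κ • Φ (ind s) + δ • hom o := by
  have hd : 0 < 1 + (s.card : ℝ) * (M + 1) := by positivity
  have hδ : 0 < (1 + (s.card : ℝ) * (M + 1))⁻¹ := inv_pos.2 hd
  set δ := (1 + (s.card : ℝ) * (M + 1))⁻¹
  refine ⟨(δ * (M + 1)) • (Φ (ind s)).1 + δ • o, δ * (M + 1), δ, by positivity, hδ, by nlinarith,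
    Prod.ext rfl ?_⟩
  have h2 : (Φ (ind s)).2 = s.card := by
    rw [Φ_eq_sum (s := s) (by rw [ind_support]), Prod.snd_sum, ← nsmul_one, ← Finset.sum_const]
    refine Finset.sum_congr rfl fun x hx => ?_
    simp [hom, ind_apply, hx]
  simp only [hom, Prod.snd_add, Prod.smul_snd, h2, smul_eq_mul, mul_one]
  have := inv_mul_cancel₀ hd.ne'
  linear_combination -this

lemma Geo.centre_of_generic (hF : Geo F) {c v : E} {κ δ M : ℝ} (hκ : 0 < κ) (hδ : 0 < δ)
    (hM : δ * M < κ) (hc : hom c = κ • Φ (ind s) + δ • hom o)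
    (hb : ∀ ρ ∈ layer F I s, ∀ x ∈ ρ, - cw ρ (hom o) x ≤ M)
    (hne : ∀ L ∈ cfs F, L (hom v) ≠ 0) (hpos : ∀ L ∈ cfs F, 0 < L (hom c) → 0 < L (hom v))
    (hlt : ∀ ρ ∈ layer F I s, ∀ i ∈ ρ, ∀ y ∈ ρ,
      0 < (cw ρ (hom o) i • cf ρ y - cw ρ (hom o) y • cf ρ i) (hom c) →
      0 < (cw ρ (hom o) i • cf ρ y - cw ρ (hom o) y • cf ρ i) (hom v)) :
    Centre F o I s v := by
  have hsI : ∀ ρ ∈ layer F I s, ∀ x ∈ s, x ∈ ρ ∧ x ∉ I := fun ρ hρ x hx => by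
    rw [← (mem_layer.1 hρ).2.1] at hx
    exact Finset.mem_sdiff.1 hx
  have hcw : ∀ ρ ∈ layer F I s, ∀ x, cw ρ (hom c) x =
      κ * (if x ∈ s then 1 else 0) + δ * cw ρ (hom o) x := fun ρ hρ x => by
    obtain ⟨h1, h2⟩ := mem_tops.1 (layer_subset hρ)
    rw [hc, map_add, map_smul, map_smul, hF.cw_Φ h1 h2 (by
      rw [ind_support]; exact fun x hx => (hsI ρ hρ x hx).1)]
    simp [ind_apply]
  refine ⟨fun ρ hρ x hx => hne _ (mem_cfs.2 ⟨ρ, hρ, x, hx, rfl⟩), fun ρ hρ x hx => ?_,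
    fun ρ hρ i hi hiI hq => ?_, fun ρ hρ i hi hiI hq y hy => ?_⟩
  · refine hpos _ (mem_cfs.2 ⟨ρ, layer_subset hρ, x, (hsI ρ hρ x hx).1, rfl⟩) ?_
    rw [cf_apply, hcw ρ hρ, if_pos hx]
    nlinarith [hb ρ hρ x (hsI ρ hρ x hx).1]
  · refine hpos _ (mem_cfs.2 ⟨ρ, layer_subset hρ, i, hi, rfl⟩) ?_
    rw [cf_apply, hcw ρ hρ, if_neg fun h => (hsI ρ hρ i h).2 hiI]
    simpa using mul_pos hδ hq
  · have h := hlt ρ hρ i hi y (hsI ρ hρ y hy).1 (by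
      simp only [LinearMap.sub_apply, LinearMap.smul_apply, cf_apply, smul_eq_mul, hcw ρ hρ,
        if_pos hy, if_neg fun h => (hsI ρ hρ i h).2 hiI]
      have := mul_pos hq hκ
      linarith)
    simp only [LinearMap.sub_apply, LinearMap.smul_apply, cf_apply, smul_eq_mul] at h
    linarith

/-- The layer to be processed next can be coned off from any good centre. -/
lemma Sweep.exists_star (hdim : topCard E ≤ 4) (hE : 2 ≤ topCard E) (h : Sweep C B₀ F o I U)
    (hI : ∀ i ∈ I, Inn C {i}) (hs : s ∈ U) (hmax : ∀ t ∈ U, s ⊆ t → t = s) :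
    ∃ 𝓛 : Finset (E × ℝ →ₗ[ℝ] ℝ), (∀ L ∈ 𝓛, L ≠ 0) ∧ ∀ v, (∀ L ∈ 𝓛, L (hom v) ≠ 0) →
      Centre F o I s v →
      (∃ F', Tri C B₀ F' ∧ Conn C B₀ F F' ∧
        chn (tops F') = chn (tops F) + chn (layer F I s) + cn v (bd (chn (layer F I s)))) ∧
      ((layer F I s).Nonempty → core C (hom v)) := by
  have hmemI : ∀ σ ∈ layer F I s, ∀ a ∈ σ, a ∉ s → a ∈ I := fun σ hσ a ha has => by
    by_contra haI
    exact has ((mem_layer.1 hσ).2.1 ▸ Finset.mem_sdiff.2 ⟨ha, haI⟩)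
  have hsub : ∀ σ ∈ layer F I s, s ⊆ σ := fun σ hσ => by
    rw [← (mem_layer.1 hσ).2.1]; exact Finset.sdiff_subset
  obtain ⟨𝓛, h𝓛, hmain⟩ := h.tri.exists_star hdim hE (D := layer F I s) layer_subset
    (fun ρ hρ x hx ⟨ρ', hρ', hne, hsub'⟩ σ hσ a ha b hb hneg hpos => by
      obtain ⟨hρF, hρc⟩ := mem_tops.1 (layer_subset hρ)
      have has : a ∉ s := fun has => by
        rw [h.tri.geo.cw_hom hρF hρc (hsub ρ hρ has), Finsupp.single_apply] at hneg
        split_ifs at hneg <;> linarith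
      refine h.tri.inn_mono (f := {a}) (by simp) ?_ (hI a (hmemI σ hσ a ha has))
      exact h.tri.geo.down _ (mem_tops.1 (layer_subset hσ)).1 _
        (Finset.insert_subset ha (Finset.singleton_subset_iff.2 hb)))
  refine ⟨𝓛, h𝓛, fun v hv hcen => hmain v hv fun ρ hρ x hx hneg => ?_⟩
  have hxs : x ∉ s := fun hxs => (hcen.pos ρ hρ x hxs).not_gt hneg
  have hxI := hmemI ρ hρ x hx hxs
  rcases h.exists_or_pos hI hs hmax hρ hx hxI with h1 | h1
  · exact h1
  · exact absurd (hcen.keep ρ hρ x hx hxI h1) hneg.not_gt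

lemma Sweep.conn (hdim : topCard E ≤ 4) (hE : 2 ≤ topCard E) (h₁ : Sweep C B₀ F₁ o I U)
    (h₂ : Sweep C B₀ F₂ o I U) (hI : ∀ i ∈ I, Inn C {i}) (hlow : ∀ t ∈ U, ∀ t' ⊆ t, t' ∈ U)
    (hag : ∀ σ, (Disjoint σ I ∨ σ \ I ∉ U) → (σ ∈ tops F₁ ↔ σ ∈ tops F₂)) :
    Conn C B₀ F₁ F₂ := by
  induction U using Finset.strongInduction generalizing F₁ F₂ I with
  | H U ih =>
    rcases U.eq_empty_or_nonempty with rfl | hU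
    · rw [h₁.tri.eq_of_tops h₂.tri (Finset.ext fun σ => hag σ (Or.inr (Finset.notMem_empty _)))]
      exact Conn.refl _
    obtain ⟨s, hs, hsm⟩ := Finset.exists_max_image U Finset.card hU
    have hmax : ∀ t ∈ U, s ⊆ t → t = s := fun t ht hst =>
      (Finset.eq_of_subset_of_card_le hst (hsm t ht)).symm
    have hlow' : ∀ t ∈ U.erase s, ∀ t' ⊆ t, t' ∈ U.erase s := fun t ht t' htt' => by
      obtain ⟨h1, h2⟩ := Finset.mem_erase.1 ht
      refine Finset.mem_erase.2 ⟨?_, hlow t h2 t' htt'⟩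
      rintro rfl
      exact h1 (hmax t h2 htt')
    by_cases hem : layer F₁ I s = ∅ ∧ layer F₂ I s = ∅
    · refine ih (U.erase s) (Finset.erase_ssubset hs) (h₁.erase hem.1) (h₂.erase hem.2) hI hlow'
        fun σ hσ => ?_
      by_cases hd : Disjoint σ I
      · exact hag σ (Or.inl hd)
      by_cases he : σ \ I = s
      · refine iff_of_false (fun h => ?_) fun h => ?_
        · exact Finset.notMem_empty σ (hem.1 ▸ mem_layer.2 ⟨h, he, hd⟩)
        · exact Finset.notMem_empty σ (hem.2 ▸ mem_layer.2 ⟨h, he, hd⟩)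
      · exact hag σ (Or.inr fun hU => (hσ.resolve_left hd) (Finset.mem_erase.2 ⟨he, hU⟩))
    obtain ⟨𝓛₁, hne₁, hst₁⟩ := h₁.exists_star hdim hE hI hs hmax
    obtain ⟨𝓛₂, hne₂, hst₂⟩ := h₂.exists_star hdim hE hI hs hmax
    let D := layer F₁ I s ∪ layer F₂ I s
    let M : ℝ := ∑ ρ ∈ D, ∑ x ∈ ρ, |cw ρ (hom o) x|
    have hM : ∀ ρ ∈ D, ∀ x ∈ ρ, - cw ρ (hom o) x ≤ M := fun ρ hρ x hx =>
      calc - cw ρ (hom o) x ≤ |cw ρ (hom o) x| := neg_le_abs _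
        _ ≤ ∑ x ∈ ρ, |cw ρ (hom o) x| :=
          Finset.single_le_sum (f := fun x => |cw ρ (hom o) x|) (fun _ _ => abs_nonneg _) hx
        _ ≤ M := Finset.single_le_sum (f := fun ρ => ∑ x ∈ ρ, |cw ρ (hom o) x|)
          (fun _ _ => Finset.sum_nonneg fun _ _ => abs_nonneg _) hρ
    obtain ⟨c, κ, δ, hκ, hδ, hκδ, hc⟩ := exists_hom_eq s o (M := M)
      (Finset.sum_nonneg fun _ _ => Finset.sum_nonneg fun _ _ => abs_nonneg _)
    let 𝓠 : Finset (E × ℝ →ₗ[ℝ] ℝ) := D.biUnion fun ρ => (ρ ×ˢ ρ).image fun p =>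
      cw ρ (hom o) p.1 • cf ρ p.2 - cw ρ (hom o) p.2 • cf ρ p.1
    have h𝓠 : ∀ ρ ∈ D, ∀ i ∈ ρ, ∀ y ∈ ρ,
        cw ρ (hom o) i • cf ρ y - cw ρ (hom o) y • cf ρ i ∈ 𝓠 := fun ρ hρ i hi y hy =>
      Finset.mem_biUnion.2 ⟨ρ, hρ, Finset.mem_image.2 ⟨(i, y), Finset.mk_mem_product hi hy, rfl⟩⟩
    obtain ⟨v, hv, hvq⟩ := exists_generic c (𝓛₁ ∪ 𝓛₂ ∪ (cfs F₁ ∪ cfs F₂))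
      (𝓠 ∪ (cfs F₁ ∪ cfs F₂)) (fun L hL => by
        simp only [Finset.mem_union] at hL
        rcases hL with (h | h) | (h | h)
        exacts [hne₁ L h, hne₂ L h, cfs_ne_zero h₁.tri.geo L h, cfs_ne_zero h₂.tri.geo L h])
    have hcen₁ : Centre F₁ o I s v := h₁.tri.geo.centre_of_generic hκ hδ hκδ hc
      (fun ρ hρ => hM ρ (Finset.mem_union_left _ hρ)) (fun L hL => hv L (by simp [hL]))
      (fun L hL => hvq L (by simp [hL])) (fun ρ hρ i hi y hy => hvq _
        (Finset.mem_union_left _ (h𝓠 ρ (Finset.mem_union_left _ hρ) i hi y hy)))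
    have hcen₂ : Centre F₂ o I s v := h₂.tri.geo.centre_of_generic hκ hδ hκδ hc
      (fun ρ hρ => hM ρ (Finset.mem_union_right _ hρ)) (fun L hL => hv L (by simp [hL]))
      (fun L hL => hvq L (by simp [hL])) (fun ρ hρ i hi y hy => hvq _
        (Finset.mem_union_left _ (h𝓠 ρ (Finset.mem_union_right _ hρ) i hi y hy)))
    obtain ⟨⟨G₁, hG₁, hcn₁, hch₁⟩, hco₁⟩ := hst₁ v (fun L hL => hv L (by simp [hL])) hcen₁
    obtain ⟨⟨G₂, hG₂, hcn₂, hch₂⟩, hco₂⟩ := hst₂ v (fun L hL => hv L (by simp [hL])) hcen₂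
    have hcore : core C (hom v) := by
      rcases (layer F₁ I s).eq_empty_or_nonempty with h | h
      · refine hco₂ (Finset.nonempty_iff_ne_empty.2 fun h' => hem ⟨h, h'⟩)
      · exact hco₁ h
    refine hcn₁.trans (Conn.trans (ih (U.erase s) (Finset.erase_ssubset hs)
      (h₁.step hE hI hs hlow hmax hcen₁ hG₁ hch₁) (h₂.step hE hI hs hlow hmax hcen₂ hG₂ hch₂)
      (fun i hi => ?_) hlow' (h₁.agree_step hE h₂ hs hlow hmax hag hcen₁ hcen₂ hch₁ hch₂))
      hcn₂.symm)
    rcases Finset.mem_insert.1 hi with rfl | hi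
    · exact inn_singleton.2 hcore
    · exact hI i hi

/-- Two triangulations that agree away from the stars of a set `I` of interior vertices, all of
these stars being star shaped about a common centre, are connected. -/
lemma Tri.conn_of_agree (hdim : topCard E ≤ 4) (hE : 2 ≤ topCard E) (h₁ : Tri C B₀ F₁)
    (h₂ : Tri C B₀ F₂) (I : Finset E) (hI : ∀ i ∈ I, Inn C {i}) (o : E)
    (hp₁ : ∀ ρ ∈ tops F₁, ∀ i, ρ ∩ I = {i} → 0 < cw ρ (hom o) i)
    (hp₂ : ∀ ρ ∈ tops F₂, ∀ i, ρ ∩ I = {i} → 0 < cw ρ (hom o) i)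
    (hag : ∀ σ, Disjoint σ I → (σ ∈ tops F₁ ↔ σ ∈ tops F₂)) : Conn C B₀ F₁ F₂ := by
  let W := ((tops F₁ ∪ tops F₂).biUnion id).powerset
  have hW : ∀ σ ∈ tops F₁ ∪ tops F₂, σ \ I ∈ W := fun σ hσ =>
    Finset.mem_powerset.2 (Finset.sdiff_subset.trans (Finset.subset_biUnion_of_mem id hσ))
  have hs₁ : Sweep C B₀ F₁ o I W := ⟨h₁, fun σ hσ _ h => absurd (hW σ (by simp [hσ])) h,
    fun σ hσ i hi _ => hp₁ σ hσ i hi⟩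
  have hs₂ : Sweep C B₀ F₂ o I W := ⟨h₂, fun σ hσ _ h => absurd (hW σ (by simp [hσ])) h,
    fun σ hσ i hi _ => hp₂ σ hσ i hi⟩
  refine hs₁.conn hdim hE hs₂ hI (fun t ht t' htt' => Finset.mem_powerset.2
    (htt'.trans (Finset.mem_powerset.1 ht))) fun σ hσ => ?_
  by_cases hd : Disjoint σ I
  · exact hag σ hd
  · have h := hσ.resolve_left hd
    exact iff_of_false (fun h' => h (hW σ (by simp [h']))) fun h' => h (hW σ (by simp [h']))

end GeoFlip

namespace GeoFlip

/-- Labels of the cells of an overlay. -/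
abbrev Lab (E : Type*) := Finset E × WithTop (Finset E)

/-- The least label of a cell over the boundary face `f`. -/
def low (f : Finset E) : Lab E := (f, (f : WithTop (Finset E)))

lemma low_mono {f g : Finset E} (h : f ⊆ g) : low f ≤ low g :=
  ⟨h, WithTop.coe_le_coe.2 h⟩

/-- The simplices spanned by a simplex of `S` and the points `b μ` of a chain of labels. -/
noncomputable def ovl (S : Finset (Finset E)) (T : Finset (Lab E)) (b : Lab E → E) :
    Finset (Finset E) :=
  ((S ×ˢ T.powerset).filter fun p => (∀ μ ∈ p.2, low p.1 ≤ μ) ∧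
    ∀ μ ∈ p.2, ∀ ν ∈ p.2, μ ≤ ν ∨ ν ≤ μ).image fun p => p.1 ∪ p.2.image b

lemma mem_ovl {S : Finset (Finset E)} {T : Finset (Lab E)} {b : Lab E → E} {h : Finset E} :
    h ∈ ovl S T b ↔ ∃ f ∈ S, ∃ c ⊆ T, (∀ μ ∈ c, low f ≤ μ) ∧
      (∀ μ ∈ c, ∀ ν ∈ c, μ ≤ ν ∨ ν ≤ μ) ∧ h = f ∪ c.image b := by
  simp only [ovl, Finset.mem_image, Finset.mem_filter, Finset.mem_product, Finset.mem_powerset,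
    Prod.exists]
  constructor
  · rintro ⟨f, c, ⟨⟨hf, hc⟩, h1, h2⟩, rfl⟩
    exact ⟨f, hf, c, hc, h1, h2, rfl⟩
  · rintro ⟨f, hf, c, hc, h1, h2, rfl⟩
    exact ⟨f, c, ⟨⟨hf, hc⟩, h1, h2⟩, rfl⟩

lemma ovl_mono {S S' : Finset (Finset E)} {T T' : Finset (Lab E)} {b : Lab E → E} (hS : S ⊆ S')
    (hT : T ⊆ T') : ovl S T b ⊆ ovl S' T' b := by
  intro h hh
  obtain ⟨f, hf, c, hc, h1, h2, rfl⟩ := mem_ovl.1 hh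
  exact mem_ovl.2 ⟨f, hS hf, c, hc.trans hT, h1, h2, rfl⟩

/-- A decomposition of the cone `C` into cells, each of which is starred from a point. -/
structure CellData (C : Set (E × ℝ)) (B₀ S : Finset (Finset E)) (T : Finset (Lab E))
    (b : Lab E → E) (Q : Lab E → E × ℝ → Prop) : Prop where
  geo : Geo S
  bdry : ∀ f, ¬ Inn C f → (f ∈ S ↔ f ∈ B₀)
  cone_le : cone S ⊆ C
  disj : ∀ μ ∈ T, ∀ ν ∈ T, ∀ y, Q μ y → Q ν y → μ = ν
  disj_cone : ∀ μ ∈ T, ∀ y ∈ cone S, ¬ Q μ y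
  core_of : ∀ μ ∈ T, ∀ y, Q μ y → core C y
  star_low : ∀ μ ∈ T, ∀ w : E →₀ ℝ, 0 ≤ w → w.support ∈ S → low w.support ≤ μ → ∀ t > (0 : ℝ),
    Q μ (Φ w + t • hom (b μ))
  star : ∀ μ ∈ T, ∀ ν ∈ T, ν < μ → ∀ y, Q ν y → ∀ t > (0 : ℝ), Q μ (y + t • hom (b μ))
  radial : ∀ μ ∈ T, ∀ y, Q μ y → ∃ t > (0 : ℝ), ∃ y', y = y' + t • hom (b μ) ∧
    ((∃ ν ∈ T, ν < μ ∧ Q ν y') ∨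
      ∃ w : E →₀ ℝ, 0 ≤ w ∧ w.support ∈ S ∧ low w.support ≤ μ ∧ y' = Φ w)
  cover : ∀ y ∈ C, (∃ μ ∈ T, Q μ y) ∨ y ∈ cone S

variable {C : Set (E × ℝ)} {B₀ S : Finset (Finset E)} {T : Finset (Lab E)} {b : Lab E → E}
  {Q : Lab E → E × ℝ → Prop}

lemma low_empty_le (μ : Lab E) : low ∅ ≤ μ := by
  refine ⟨Finset.empty_subset _, ?_⟩
  show ((∅ : Finset E) : WithTop (Finset E)) ≤ μ.2
  rw [← Finset.bot_eq_empty, WithTop.coe_bot]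
  exact bot_le

namespace CellData

lemma hom_self (D : CellData C B₀ S T b Q) {μ : Lab E} (hμ : μ ∈ T) : Q μ (hom (b μ)) := by
  simpa using D.star_low μ hμ 0 le_rfl (by simpa using D.geo.empty)
    (by simpa using low_empty_le μ) 1 one_pos

lemma b_inj (D : CellData C B₀ S T b Q) {μ ν : Lab E} (hμ : μ ∈ T) (hν : ν ∈ T)
    (h : b μ = b ν) : μ = ν :=
  D.disj μ hμ ν hν _ (D.hom_self hμ) (by rw [h]; exact D.hom_self hν)

lemma label (D : CellData C B₀ S T b Q) {f : Finset E} (hf : f ∈ S) (k : ℕ) :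
    ∀ c ⊆ T, c.card = k → (∀ μ ∈ c, low f ≤ μ) → (∀ μ ∈ c, ∀ ν ∈ c, μ ≤ ν ∨ ν ≤ μ) →
    ∀ w : E →₀ ℝ, 0 ≤ w → w.support ⊆ f ∪ c.image b →
    w.support ⊆ f ∨ ∃ μ ∈ c, b μ ∈ w.support ∧ Q μ (Φ w) := by
  induction k with
  | zero =>
    intro c _ hc _ _ w _ hw
    rw [Finset.card_eq_zero] at hc
    subst hc
    left; simpa using hw
  | succ k ih =>
    intro c hcT hc hlow hch w hw0 hw
    have hne : c.Nonempty := by rw [← Finset.card_pos]; omega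
    obtain ⟨μ, hμ⟩ := c.exists_maximal hne
    have hμc := hμ.prop
    have hgr : ∀ ν ∈ c, ν ≠ μ → ν < μ := fun ν hν hne => by
      rcases hch ν hν μ hμc with h | h
      · exact lt_of_le_of_ne h hne
      · exact absurd (hμ.eq_of_le hν h).symm hne
    have hk : (c.erase μ).card = k := by rw [Finset.card_erase_of_mem hμc]; omega
    have hsub : c.erase μ ⊆ c := Finset.erase_subset _ _
    have ih' := ih (c.erase μ) (hsub.trans hcT) hk (fun ν hν => hlow ν (hsub hν))
      (fun ν hν ν' hν' => hch ν (hsub hν) ν' (hsub hν'))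
    have hcov : ∀ x ∈ f ∪ c.image b, x ≠ b μ → x ∈ f ∪ (c.erase μ).image b := by
      intro x hx hxμ
      rcases Finset.mem_union.1 hx with h | h
      · exact Finset.mem_union_left _ h
      · obtain ⟨ν, hν, rfl⟩ := Finset.mem_image.1 h
        refine Finset.mem_union_right _ (Finset.mem_image_of_mem _ (Finset.mem_erase.2 ⟨?_, hν⟩))
        rintro rfl; exact hxμ rfl
    by_cases hb : b μ ∈ w.support
    · right
      refine ⟨μ, hμc, hb, ?_⟩
      have ht : 0 < w (b μ) := lt_of_le_of_ne (hw0 _) (Finsupp.mem_support_iff.1 hb).symm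
      have hdec : Φ w = Φ (w.erase (b μ)) + w (b μ) • hom (b μ) := by
        rw [← Φ_single, ← map_add, Finsupp.erase_add_single]
      have hw0' : 0 ≤ w.erase (b μ) := fun x => by
        by_cases hx : x = b μ
        · subst hx; simp
        · rw [Finsupp.erase_ne hx]; exact hw0 x
      rw [hdec]
      rcases ih' (w.erase (b μ)) hw0' (fun x hx => by
        rw [Finsupp.support_erase, Finset.mem_erase] at hx
        exact hcov x (hw hx.2) hx.1) with h | ⟨ν, hν, -, hQ⟩
      · exact D.star_low μ (hcT hμc) _ hw0' (D.geo.down _ hf _ h)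
          ((low_mono h).trans (hlow μ hμc)) _ ht
      · exact D.star μ (hcT hμc) ν (hcT (hsub hν))
          (hgr ν (hsub hν) (Finset.ne_of_mem_erase hν)) _ hQ _ ht
    · rcases ih' w hw0 (fun x hx => hcov x (hw hx) (by rintro rfl; exact hb hx)) with
        h | ⟨ν, hν, h⟩
      · exact Or.inl h
      · exact Or.inr ⟨ν, hsub hν, h⟩

lemma label_ovl (D : CellData C B₀ S T b Q) {w : E →₀ ℝ} (hw : 0 ≤ w)
    (hwO : w.support ∈ ovl S T b) :
    w.support ∈ S ∨ ∃ μ ∈ T, b μ ∈ w.support ∧ Q μ (Φ w) := by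
  obtain ⟨f, hf, c, hc, h1, h2, h⟩ := mem_ovl.1 hwO
  rcases D.label hf _ c hc rfl h1 h2 w hw h.subset with h | ⟨μ, hμ, h⟩
  · exact Or.inl (D.geo.down _ hf _ h)
  · exact Or.inr ⟨μ, hc hμ, h⟩

lemma ovl_down (D : CellData C B₀ S T b Q) :
    ∀ h ∈ ovl S T b, ∀ g ⊆ h, g ∈ ovl S T b := by
  intro h hh g hg
  obtain ⟨f, hf, c, hc, h1, h2, rfl⟩ := mem_ovl.1 hh
  refine mem_ovl.2 ⟨g ∩ f, D.geo.down _ hf _ Finset.inter_subset_right,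
    c.filter fun μ => b μ ∈ g, (Finset.filter_subset _ _).trans hc, ?_, ?_, ?_⟩
  · intro μ hμ
    exact (low_mono Finset.inter_subset_right).trans (h1 μ (Finset.mem_filter.1 hμ).1)
  · intro μ hμ ν hν
    exact h2 μ (Finset.mem_filter.1 hμ).1 ν (Finset.mem_filter.1 hν).1
  · ext x
    simp only [Finset.mem_union, Finset.mem_inter, Finset.mem_image, Finset.mem_filter]
    constructor
    · intro hx
      rcases Finset.mem_union.1 (hg hx) with h | h
      · exact Or.inl ⟨hx, h⟩
      · obtain ⟨μ, hμ, rfl⟩ := Finset.mem_image.1 h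
        exact Or.inr ⟨μ, ⟨hμ, hx⟩, rfl⟩
    · rintro (⟨hx, -⟩ | ⟨μ, ⟨-, hx⟩, rfl⟩) <;> exact hx

lemma ovl_inj (D : CellData C B₀ S T b Q) (k : ℕ) : ∀ w w' : E →₀ ℝ,
    w.support.card + w'.support.card = k → 0 ≤ w → 0 ≤ w' → w.support ∈ ovl S T b →
    w'.support ∈ ovl S T b → Φ w = Φ w' → w = w' := by
  induction k using Nat.strong_induction_on with
  | _ k ih =>
  intro w w' hk hw hw' hs hs' he
  rcases D.label_ovl hw hs with h | ⟨μ, hμ, hb, hQ⟩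
  · rcases D.label_ovl hw' hs' with h' | ⟨ν, hν, hb', hQ'⟩
    · exact D.geo.inj _ _ hw hw' h h' he
    · exact absurd hQ' (D.disj_cone ν hν _ ⟨w, hw, h, he⟩)
  · rcases D.label_ovl hw' hs' with h' | ⟨ν, hν, hb', hQ'⟩
    · exact absurd hQ (D.disj_cone μ hμ _ ⟨w', hw', h', he.symm⟩)
    · obtain rfl := D.disj μ hμ ν hν _ hQ (he ▸ hQ')
      set t := min (w (b μ)) (w' (b μ)) with ht
      have key : ∀ u : E →₀ ℝ, 0 ≤ u → t ≤ u (b μ) → b μ ∈ u.support →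
          0 ≤ u - Finsupp.single (b μ) t ∧ (u - Finsupp.single (b μ) t).support ⊆ u.support := by
        intro u hu htu hbu
        refine ⟨fun x => ?_, fun x hx => ?_⟩
        · by_cases hx : x = b μ
          · subst hx; simpa using htu
          · simpa [Finsupp.single_apply, Ne.symm hx] using hu x
        · by_cases hx' : x = b μ
          · rwa [hx']
          · rw [Finsupp.mem_support_iff] at hx ⊢
            simpa [Finsupp.single_apply, Ne.symm hx'] using hx
      have k1 := key w hw (min_le_left _ _) hb
      have k2 := key w' hw' (min_le_right _ _) hb'
      have hlt : (w - Finsupp.single (b μ) t).support.card +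
          (w' - Finsupp.single (b μ) t).support.card < k := by
        rw [← hk]
        rcases min_choice (w (b μ)) (w' (b μ)) with h | h
        · refine Nat.add_lt_add_of_lt_of_le (Finset.card_lt_card ⟨k1.2, fun hh => ?_⟩)
            (Finset.card_le_card k2.2)
          have := hh hb
          rw [Finsupp.mem_support_iff] at this
          apply this; simp [ht, h]
        · refine Nat.add_lt_add_of_le_of_lt (Finset.card_le_card k1.2)
            (Finset.card_lt_card ⟨k2.2, fun hh => ?_⟩)
          have := hh hb'
          rw [Finsupp.mem_support_iff] at this
          apply this; simp [ht, h]
      have := ih _ hlt _ _ rfl k1.1 k2.1 (D.ovl_down _ hs _ k1.2) (D.ovl_down _ hs' _ k2.2)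
        (by rw [map_sub, map_sub, he])
      exact sub_left_injective this

lemma exists_ovl (D : CellData C B₀ S T b Q) (μ : Lab E) : μ ∈ T → ∀ y, Q μ y →
    ∃ w : E →₀ ℝ, 0 ≤ w ∧ Φ w = y ∧ ∃ f ∈ S, ∃ c ⊆ T, (∀ ν ∈ c, low f ≤ ν) ∧
      (∀ ν ∈ c, ∀ ν' ∈ c, ν ≤ ν' ∨ ν' ≤ ν) ∧ (∀ ν ∈ c, ν ≤ μ) ∧ low f ≤ μ ∧
      w.support ⊆ f ∪ c.image b := by
  induction μ using WellFoundedLT.induction with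
  | _ μ ih =>
  intro hμ y hQ
  obtain ⟨t, ht, y', rfl, ⟨ν, hν, hlt, hQ'⟩ | ⟨w, hw, hwS, hwl, rfl⟩⟩ := D.radial μ hμ y hQ
  · obtain ⟨w, hw, rfl, f, hf, c, hc, h1, h2, h3, h4, h5⟩ := ih ν hlt hν y' hQ'
    refine ⟨w + Finsupp.single (b μ) t, add_nonneg hw (Finsupp.single_nonneg.2 ht.le),
      by rw [map_add, Φ_single], f, hf, insert μ c, Finset.insert_subset hμ hc, ?_, ?_, ?_,
      h4.trans hlt.le, ?_⟩
    · rw [Finset.forall_mem_insert]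
      exact ⟨h4.trans hlt.le, h1⟩
    · rw [Finset.forall_mem_insert]
      refine ⟨?_, fun ν' hν' => ?_⟩
      · rw [Finset.forall_mem_insert]
        exact ⟨Or.inl le_rfl, fun ν' hν' => Or.inr ((h3 _ hν').trans hlt.le)⟩
      · rw [Finset.forall_mem_insert]
        exact ⟨Or.inl ((h3 _ hν').trans hlt.le), h2 ν' hν'⟩
    · rw [Finset.forall_mem_insert]
      exact ⟨le_rfl, fun ν' hν' => (h3 _ hν').trans hlt.le⟩
    · refine Finsupp.support_add.trans (Finset.union_subset (h5.trans ?_) ?_)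
      · exact Finset.union_subset_union_right (Finset.image_subset_image (Finset.subset_insert _ _))
      · refine Finsupp.support_single_subset.trans ?_
        rw [Finset.image_insert]
        intro x hx
        rw [Finset.mem_singleton] at hx
        subst hx
        simp
  · refine ⟨w + Finsupp.single (b μ) t, add_nonneg hw (Finsupp.single_nonneg.2 ht.le),
      by rw [map_add, Φ_single], w.support, hwS, {μ}, by simpa using hμ, by simpa using hwl,
      by simp, by simp, hwl, ?_⟩
    refine Finsupp.support_add.trans (Finset.union_subset_union_right ?_)
    simpa using Finsupp.support_single_subset

theorem tri (D : CellData C B₀ S T b Q) : Tri C B₀ (ovl S T b) := by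
  have hS : S ⊆ ovl S T b := fun f hf =>
    mem_ovl.2 ⟨f, hf, ∅, Finset.empty_subset _, by simp, by simp, by simp⟩
  refine ⟨⟨hS D.geo.empty, D.ovl_down, fun w w' hw hw' hs hs' he =>
    D.ovl_inj _ w w' rfl hw hw' hs hs' he⟩, Set.Subset.antisymm ?_ ?_, fun f hf => ?_⟩
  · rintro y ⟨w, hw, hs, rfl⟩
    rcases D.label_ovl hw hs with h | ⟨μ, hμ, -, hQ⟩
    · exact D.cone_le ⟨w, hw, h, rfl⟩
    · exact (D.core_of μ hμ _ hQ).mem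
  · intro y hy
    rcases D.cover y hy with ⟨μ, hμ, hQ⟩ | ⟨w, hw, h, rfl⟩
    · obtain ⟨w, hw, rfl, f, hf, c, hc, h1, h2, -, -, h5⟩ := D.exists_ovl μ hμ y hQ
      exact ⟨w, hw, D.ovl_down _ (mem_ovl.2 ⟨f, hf, c, hc, h1, h2, rfl⟩) _ h5, rfl⟩
    · exact ⟨w, hw, hS h, rfl⟩
  · rw [← D.bdry f hf]
    refine ⟨fun h => ?_, fun h => hS h⟩
    rcases D.label_ovl (ind_nonneg f) (by rwa [ind_support]) with h | ⟨μ, hμ, -, hQ⟩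
    · rwa [ind_support] at h
    · exact absurd (D.core_of μ hμ _ hQ) hf

end CellData

end GeoFlip

namespace GeoFlip

variable {C : Set (E × ℝ)} {B₀ F F' G S U : Finset (Finset E)} {b : Lab E → E}

/-- The weight representing a point of the cone over `F`. -/
noncomputable def wt (F : Finset (Finset E)) (y : E × ℝ) : E →₀ ℝ :=
  if h : y ∈ cone F then h.choose else 0

/-- The simplex whose relative interior contains the given point. -/
noncomputable def car (F : Finset (Finset E)) (y : E × ℝ) : Finset E := (wt F y).support

lemma wt_spec {y : E × ℝ} (h : y ∈ cone F) : 0 ≤ wt F y ∧ car F y ∈ F ∧ Φ (wt F y) = y := by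
  unfold car wt
  rw [dif_pos h]
  exact h.choose_spec

namespace Geo

lemma wt_Φ (hF : Geo F) {w : E →₀ ℝ} (hw : 0 ≤ w) (hs : w.support ∈ F) : wt F (Φ w) = w := by
  obtain ⟨h1, h2, h3⟩ := wt_spec (F := F) (y := Φ w) ⟨w, hw, hs, rfl⟩
  exact hF.inj _ _ h1 hw h2 hs h3

lemma car_Φ (hF : Geo F) {w : E →₀ ℝ} (hw : 0 ≤ w) (hs : w.support ∈ F) :
    car F (Φ w) = w.support := by
  rw [car, hF.wt_Φ hw hs]

lemma car_add (hF : Geo F) {y z : E × ℝ} (hy : y ∈ cone F) (hz : z ∈ cone F)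
    (h : car F y ⊆ car F z) {t : ℝ} (ht : 0 < t) :
    y + t • z ∈ cone F ∧ car F (y + t • z) = car F z := by
  obtain ⟨y1, y2, y3⟩ := wt_spec hy
  obtain ⟨z1, z2, z3⟩ := wt_spec hz
  have h0 : 0 ≤ wt F y + t • wt F z := add_nonneg y1 (smul_nonneg ht.le z1)
  have hs : (wt F y + t • wt F z).support = car F z := by
    ext x
    constructor
    · intro hx
      rcases Finset.mem_union.1 (Finsupp.support_add hx) with hx | hx
      · exact h hx
      · exact Finsupp.support_smul hx
    · intro hx
      have h1 : 0 < wt F z x := lt_of_le_of_ne (z1 x) (Finsupp.mem_support_iff.1 hx).symm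
      have h2 : 0 ≤ wt F y x := y1 x
      rw [Finsupp.mem_support_iff]
      simp only [Finsupp.coe_add, Pi.add_apply, Finsupp.coe_smul, Pi.smul_apply, smul_eq_mul]
      positivity
  have he : Φ (wt F y + t • wt F z) = y + t • z := by rw [map_add, map_smul, y3, z3]
  rw [← he]
  exact ⟨⟨_, h0, hs ▸ z2, rfl⟩, by rw [hF.car_Φ h0 (hs ▸ z2), hs]⟩

lemma car_sub (hF : Geo F) {y z : E × ℝ} (hy : y ∈ cone F) (hz : z ∈ cone F)
    (h : car F y = car F z) (hne : (car F z).Nonempty) :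
    ∃ t > (0 : ℝ), (y - t • z ∈ cone F ∧ car F (y - t • z) ⊂ car F z) ∧
      ∀ s, 0 ≤ s → s ≤ t → y - s • z ∈ cone F ∧ car F (y - s • z) ⊆ car F z := by
  obtain ⟨y1, y2, y3⟩ := wt_spec hy
  obtain ⟨z1, z2, z3⟩ := wt_spec hz
  obtain ⟨t, ht0, ht, ⟨x, hx, hxt⟩, hpos⟩ := exists_max_sub (β := wt F z) (w := wt F y)
    (fun x hx => lt_of_le_of_ne (z1 x) (Finsupp.mem_support_iff.1 hx).symm) hne y1
  have ht' := hpos h.symm.subset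
  have key : ∀ s, 0 ≤ s → s ≤ t → y - s • z ∈ cone F ∧ car F (y - s • z) ⊆ car F z ∧
      car F (y - s • z) = (wt F y - s • wt F z).support := by
    intro s hs hst
    have h0 : 0 ≤ wt F y - s • wt F z := fun x => by
      have h1 := ht x
      have h2 : 0 ≤ wt F z x := z1 x
      simp only [Finsupp.coe_sub, Pi.sub_apply, Finsupp.coe_smul, Pi.smul_apply, smul_eq_mul,
        Finsupp.coe_zero, Pi.zero_apply] at h1 ⊢
      nlinarith
    have hs' : (wt F y - s • wt F z).support ⊆ car F z := by
      refine Finsupp.support_sub.trans (Finset.union_subset h.subset Finsupp.support_smul)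
    have hsF := hF.down _ z2 _ hs'
    have he : Φ (wt F y - s • wt F z) = y - s • z := by rw [map_sub, map_smul, y3, z3]
    rw [← he]
    exact ⟨⟨_, h0, hsF, rfl⟩, by rw [hF.car_Φ h0 hsF]; exact hs', hF.car_Φ h0 hsF⟩
  obtain ⟨k1, k2, k3⟩ := key t ht0 le_rfl
  refine ⟨t, ht', ⟨k1, k2, fun hh => ?_⟩, fun s hs hst => ⟨(key s hs hst).1, (key s hs hst).2.1⟩⟩
  have := hh hx
  rw [k3, Finsupp.mem_support_iff] at this
  apply this
  simp [hxt]

lemma sub (hF : Geo F) (hS : S ⊆ F) (h0 : ∅ ∈ S) (hd : ∀ f ∈ S, ∀ g ⊆ f, g ∈ S) : Geo S :=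
  ⟨h0, hd, fun w w' hw hw' hs hs' => hF.inj w w' hw hw' (hS hs) (hS hs')⟩

end Geo

namespace Tri

lemma core_car (hF : Tri C B₀ F) {y : E × ℝ} (hy : y ∈ C) : core C y ↔ Inn C (car F y) := by
  rw [← hF.cone_eq] at hy
  obtain ⟨y1, y2, y3⟩ := wt_spec hy
  rw [hF.inn_iff y2]
  conv_lhs => rw [← y3, ← hF.cone_eq]
  exact hF.geo.core_iff y1 y2

lemma not_core_zero (hF : Tri C B₀ F) : ¬ core C 0 := fun h => by
  obtain ⟨ε, hε, h⟩ := h (0, -1)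
  have := h ε hε.le le_rfl
  rw [← hF.cone_eq] at this
  obtain ⟨w, hw, -, he⟩ := this
  have h2 := congrArg Prod.snd he
  rw [Φ_eq_sum subset_rfl, Prod.snd_sum] at h2
  simp only [hom, Prod.smul_snd, zero_add, smul_eq_mul, mul_one] at h2
  have : 0 ≤ ∑ x ∈ w.support, w x := Finset.sum_nonneg fun x _ => hw x
  linarith

lemma not_inn_empty (hF : Tri C B₀ F) : ¬ Inn C ∅ := fun h => by
  apply hF.not_core_zero
  have : ind (∅ : Finset E) = 0 := by
    rw [← Finsupp.support_eq_empty, ind_support]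
  rw [Inn, this, map_zero] at h
  exact h

lemma nonempty_of_inn (hF : Tri C B₀ F) {f : Finset E} (h : Inn C f) : f.Nonempty := by
  rw [Finset.nonempty_iff_ne_empty]
  rintro rfl
  exact hF.not_inn_empty h

lemma eq_of_subset (hF : Tri C B₀ F) (hG : Tri C B₀ G) (h : F ⊆ G) : F = G := by
  refine Finset.Subset.antisymm h fun f hf => ?_
  have hy : Φ (ind f) ∈ cone F := by
    rw [hF.cone_eq, ← hG.cone_eq]
    exact ⟨_, ind_nonneg f, by rwa [ind_support], rfl⟩
  obtain ⟨w, hw, hs, he⟩ := hy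
  have := hG.geo.inj _ _ hw (ind_nonneg f) (h hs) (by rwa [ind_support]) he
  rwa [this, ind_support] at hs

end Tri

/-- An upward closed family of interior simplices. -/
structure Upper (C : Set (E × ℝ)) (F U : Finset (Finset E)) : Prop where
  sub : ∀ A ∈ U, A ∈ F ∧ Inn C A
  up : ∀ A ∈ U, ∀ A' ∈ F, A ⊆ A' → A' ∈ U

/-- The interior simplices. -/
noncomputable def inns (C : Set (E × ℝ)) (F : Finset (Finset E)) : Finset (Finset E) :=
  F.filter fun f => Inn C f

/-- The boundary simplices. -/
noncomputable def bdys (C : Set (E × ℝ)) (F : Finset (Finset E)) : Finset (Finset E) :=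
  F.filter fun f => ¬ Inn C f

lemma mem_inns {f : Finset E} : f ∈ inns C F ↔ f ∈ F ∧ Inn C f := Finset.mem_filter

lemma mem_bdys {f : Finset E} : f ∈ bdys C F ↔ f ∈ F ∧ ¬ Inn C f := Finset.mem_filter

/-- A family of triangulations indexed by upward closed families is connected if adding one
simplex to the family stays in the class. -/
lemma Tri.conn_of_step (hF : Tri C B₀ F) (Z : Finset (Finset E) → Finset (Finset E))
    (h : ∀ U A, Upper C F U → Upper C F (insert A U) → A ∉ U →
      Conn C B₀ (Z U) (Z (insert A U))) :
    Conn C B₀ (Z ∅) (Z (inns C F)) := by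
  have main : ∀ k, ∀ U, (inns C F \ U).card = k → Upper C F U →
      Conn C B₀ (Z U) (Z (inns C F)) := by
    intro k
    induction k with
    | zero =>
      intro U hk hU
      rw [Finset.card_eq_zero, Finset.sdiff_eq_empty_iff_subset] at hk
      rw [Finset.Subset.antisymm hk fun A hA => mem_inns.2 (hU.sub A hA)]
      exact Conn.refl _
    | succ k ih =>
      intro U hk hU
      obtain ⟨A, hA⟩ := (inns C F \ U).exists_maximal (by rw [← Finset.card_pos]; omega)
      have hAm := Finset.mem_sdiff.1 hA.prop
      have hAi := mem_inns.1 hAm.1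
      have hU' : Upper C F (insert A U) := by
        refine ⟨fun A' hA' => ?_, fun A₁ hA₁ A' hA' hs => ?_⟩
        · rcases Finset.mem_insert.1 hA' with rfl | hA'
          · exact hAi
          · exact hU.sub _ hA'
        · rcases Finset.mem_insert.1 hA₁ with rfl | hA₁
          · by_cases hu : A' ∈ U
            · exact Finset.mem_insert_of_mem hu
            · rw [Finset.mem_insert]; left
              refine (hA.eq_of_le (Finset.mem_sdiff.2 ⟨mem_inns.2 ⟨hA', ?_⟩, hu⟩) hs).symm
              exact hF.inn_mono hs hA' hAi.2
          · exact Finset.mem_insert_of_mem (hU.up _ hA₁ _ hA' hs)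
      refine (h U A hU hU' hAm.2).trans (ih _ ?_ hU')
      rw [Finset.sdiff_insert, Finset.card_erase_of_mem hA.prop]
      omega
  exact main _ ∅ rfl ⟨by simp, by simp⟩

/-- The chosen interior points of the interior simplices of `F`. -/
def Bary (C : Set (E × ℝ)) (F : Finset (Finset E)) (b : Lab E → E) : Prop :=
  ∀ A ∈ F, Inn C A → core C (hom (b (A, ⊤))) ∧ car F (hom (b (A, ⊤))) = A

/-- The partial barycentric subdivision of `F` along the upward closed family `U`. -/
noncomputable def der (F : Finset (Finset E)) (b : Lab E → E) (U : Finset (Finset E)) :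
    Finset (Finset E) :=
  ovl (F \ U) (U.image fun A => (A, ⊤)) b

lemma Tri.der_cell (hF : Tri C B₀ F) (hb : Bary C F b) (hU : Upper C F U) :
    CellData C B₀ (F \ U) (U.image fun A => (A, ⊤)) b
      (fun μ y => y ∈ cone F ∧ car F y ∈ U ∧ (car F y, ⊤) = μ) where
  geo := hF.geo.sub Finset.sdiff_subset
    (Finset.mem_sdiff.2 ⟨hF.geo.empty, fun h => hF.not_inn_empty (hU.sub _ h).2⟩)
    (fun f hf g hg => by
      rw [Finset.mem_sdiff] at hf ⊢
      exact ⟨hF.geo.down _ hf.1 _ hg, fun h => hf.2 (hU.up _ h _ hf.1 hg)⟩)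
  bdry f hf := by
    rw [← hF.bdry f hf, Finset.mem_sdiff]
    exact and_iff_left fun h => hf (hU.sub _ h).2
  cone_le := by
    rintro y ⟨w, hw, hs, rfl⟩
    rw [← hF.cone_eq]
    exact ⟨w, hw, (Finset.mem_sdiff.1 hs).1, rfl⟩
  disj μ _ ν _ y h h' := h.2.2.symm.trans h'.2.2
  disj_cone μ _ y hy h := by
    obtain ⟨w, hw, hs, rfl⟩ := hy
    rw [Finset.mem_sdiff] at hs
    rw [hF.geo.car_Φ hw hs.1] at h
    exact hs.2 h.2.1
  core_of μ _ y h := by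
    rw [hF.core_car (hF.cone_eq ▸ h.1)]
    exact (hU.sub _ h.2.1).2
  star_low μ hμ w hw hs hl t ht := by
    obtain ⟨A, hA, rfl⟩ := Finset.mem_image.1 hμ
    obtain ⟨hAF, hAi⟩ := hU.sub A hA
    obtain ⟨b1, b2⟩ := hb A hAF hAi
    have hz : hom (b (A, ⊤)) ∈ cone F := hF.cone_eq ▸ b1.mem
    have hsF := (Finset.mem_sdiff.1 hs).1
    have := hF.geo.car_add (y := Φ w) ⟨w, hw, hsF, rfl⟩ hz
      (by rw [hF.geo.car_Φ hw hsF, b2]; exact hl.1) ht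
    rw [b2] at this
    exact ⟨this.1, by rw [this.2]; exact hA, by rw [this.2]⟩
  star μ hμ ν hν hlt y hy t ht := by
    obtain ⟨A, hA, rfl⟩ := Finset.mem_image.1 hμ
    obtain ⟨hAF, hAi⟩ := hU.sub A hA
    obtain ⟨b1, b2⟩ := hb A hAF hAi
    have hz : hom (b (A, ⊤)) ∈ cone F := hF.cone_eq ▸ b1.mem
    have := hF.geo.car_add (y := y) hy.1 hz
      (by rw [b2]; rw [← hy.2.2] at hlt; exact hlt.le.1) ht
    rw [b2] at this
    exact ⟨this.1, by rw [this.2]; exact hA, by rw [this.2]⟩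
  radial μ hμ y hy := by
    obtain ⟨A, hA, rfl⟩ := Finset.mem_image.1 hμ
    obtain ⟨hAF, hAi⟩ := hU.sub A hA
    obtain ⟨b1, b2⟩ := hb A hAF hAi
    have hz : hom (b (A, ⊤)) ∈ cone F := hF.cone_eq ▸ b1.mem
    have hyA : car F y = A := congrArg Prod.fst hy.2.2
    obtain ⟨t, ht, ⟨h1, h2⟩, -⟩ := hF.geo.car_sub hy.1 hz (hyA.trans b2.symm)
      (by rw [b2]; exact hF.nonempty_of_inn hAi)
    rw [b2] at h2
    refine ⟨t, ht, y - t • hom (b (A, ⊤)), by rw [sub_add_cancel], ?_⟩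
    by_cases hu : car F (y - t • hom (b (A, ⊤))) ∈ U
    · left
      refine ⟨_, Finset.mem_image_of_mem _ hu, lt_of_le_of_ne ⟨h2.1, le_rfl⟩ ?_, h1, hu, rfl⟩
      intro he
      exact h2.ne (congrArg Prod.fst he)
    · right
      obtain ⟨w1, w2, w3⟩ := wt_spec h1
      exact ⟨_, w1, Finset.mem_sdiff.2 ⟨w2, hu⟩, ⟨h2.1, le_top⟩, w3.symm⟩
  cover y hy := by
    have hy' : y ∈ cone F := hF.cone_eq ▸ hy
    obtain ⟨w1, w2, w3⟩ := wt_spec hy'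
    by_cases hu : car F y ∈ U
    · exact Or.inl ⟨_, Finset.mem_image_of_mem _ hu, hy', hu, rfl⟩
    · exact Or.inr ⟨_, w1, Finset.mem_sdiff.2 ⟨w2, hu⟩, w3⟩

lemma Tri.der_tri (hF : Tri C B₀ F) (hb : Bary C F b) (hU : Upper C F U) :
    Tri C B₀ (der F b U) := (hF.der_cell hb hU).tri

lemma der_empty : der F b ∅ = F := by
  ext h
  rw [der, mem_ovl]
  constructor
  · rintro ⟨f, hf, c, hc, -, -, rfl⟩
    rw [Finset.image_empty, Finset.subset_empty] at hc
    simpa [hc] using hf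
  · intro hh
    exact ⟨h, by simpa using hh, ∅, by simp⟩

lemma Tri.der_step [FiniteDimensional ℝ E] (hdim : topCard E ≤ 4) (hE : 2 ≤ topCard E)
    (hF : Tri C B₀ F) (hb : Bary C F b) {A : Finset E} (hU : Upper C F U)
    (hU' : Upper C F (insert A U)) (hA : A ∉ U) :
    Conn C B₀ (der F b U) (der F b (insert A U)) := by
  obtain ⟨hAF, hAi⟩ := hU'.sub A (Finset.mem_insert_self _ _)
  obtain ⟨b1, b2⟩ := hb A hAF hAi
  have h₁ := hF.der_tri hb hU
  have h₂ := hF.der_tri hb hU'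
  set m := b (A, ⊤) with hm
  obtain ⟨a1, a2, a3⟩ := wt_spec (hF.cone_eq.symm ▸ b1.mem : hom m ∈ cone F)
  have hAd : A ∈ der F b U :=
    mem_ovl.2 ⟨A, Finset.mem_sdiff.2 ⟨hAF, hA⟩, ∅, by simp⟩
  have hmd : {m} ∈ der F b (insert A U) := by
    refine mem_ovl.2 ⟨∅, Finset.mem_sdiff.2 ⟨hF.geo.empty, fun h => ?_⟩, {(A, ⊤)}, by simp,
      ?_, by simp, by simp [hm]⟩
    · exact hF.not_inn_empty (hU'.sub _ h).2
    · intro μ _; exact low_empty_le μ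
  have key : ∀ h ∈ der F b (insert A U), h ∈ der F b U ∨
      {m} ⊆ h ∧ ∃ g ∈ der F b U, A ⊆ g ∧ h ⊆ g ∪ {m} := by
    intro h hh
    obtain ⟨f, hf, c, hc, h1, h2, rfl⟩ := mem_ovl.1 hh
    rw [Finset.mem_sdiff, Finset.mem_insert, not_or] at hf
    have hc' : ∀ ν ∈ c, ν ≠ (A, ⊤) → ∃ A' ∈ U, (A', ⊤) = ν := by
      intro ν hν hne
      obtain ⟨A', hA', rfl⟩ := Finset.mem_image.1 (hc hν)
      rcases Finset.mem_insert.1 hA' with rfl | hA'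
      · exact absurd rfl hne
      · exact ⟨A', hA', rfl⟩
    by_cases hAc : ((A, ⊤) : Lab E) ∈ c
    · right
      refine ⟨?_, A ∪ (c.erase (A, ⊤)).image b, mem_ovl.2 ⟨A, Finset.mem_sdiff.2 ⟨hAF, hA⟩,
        c.erase (A, ⊤), ?_, ?_, ?_, rfl⟩, Finset.subset_union_left, ?_⟩
      · rw [Finset.singleton_subset_iff]
        exact Finset.mem_union_right _ (Finset.mem_image_of_mem _ hAc)
      · intro ν hν
        obtain ⟨A', hA', rfl⟩ := hc' ν (Finset.mem_of_mem_erase hν) (Finset.ne_of_mem_erase hν)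
        exact Finset.mem_image_of_mem _ hA'
      · intro ν hν
        obtain ⟨A', hA', rfl⟩ := hc' ν (Finset.mem_of_mem_erase hν) (Finset.ne_of_mem_erase hν)
        rcases h2 _ hAc _ (Finset.mem_of_mem_erase hν) with h | h
        · exact ⟨h.1, le_top⟩
        · exact absurd (hU.up _ hA' _ hAF h.1) hA
      · intro ν hν ν' hν'
        exact h2 ν (Finset.mem_of_mem_erase hν) ν' (Finset.mem_of_mem_erase hν')
      · intro x hx
        rcases Finset.mem_union.1 hx with hx | hx
        · exact Finset.mem_union_left _ (Finset.mem_union_left _ ((h1 _ hAc).1 hx))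
        · obtain ⟨ν, hν, rfl⟩ := Finset.mem_image.1 hx
          by_cases hνA : ν = (A, ⊤)
          · rw [hνA]; exact Finset.mem_union_right _ (by simp [hm])
          · exact Finset.mem_union_left _ (Finset.mem_union_right _
              (Finset.mem_image_of_mem _ (Finset.mem_erase.2 ⟨hνA, hν⟩)))
    · left
      refine mem_ovl.2 ⟨f, Finset.mem_sdiff.2 ⟨hf.1, hf.2.2⟩, c, fun ν hν => ?_, h1, h2, rfl⟩
      obtain ⟨A', hA', rfl⟩ := hc' ν hν (by rintro rfl; exact hAc hν)
      exact Finset.mem_image_of_mem _ hA'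
  have hinj : A ∈ der F b (insert A U) → A = {m} := by
    intro h
    have := h₂.geo.inj (wt F (hom m)) (Finsupp.single m 1) a1 (Finsupp.single_nonneg.2 zero_le_one)
      (by change car F (hom m) ∈ _; rwa [b2])
      (by rwa [Finsupp.support_single _ one_ne_zero]) (by rw [a3, Φ_single, one_smul])
    have h' := congrArg Finsupp.support this
    rw [Finsupp.support_single _ one_ne_zero] at h'
    rw [← h']; exact b2.symm
  by_cases h2 : 2 ≤ A.card
  · have hst := h₁.stell hdim hE (α := wt F (hom m)) (m := m) a1
      (by change car F (hom m) ∈ _; rwa [b2]) (by change Inn C (car F (hom m)); rwa [b2])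
      (by change 2 ≤ (car F (hom m)).card; rwa [b2]) a3
    change Tri C B₀ (exch _ (car F (hom m)) {m}) ∧ Conn C B₀ _ (exch _ (car F (hom m)) {m}) at hst
    rw [b2] at hst
    rw [h₂.eq_of_subset hst.1 fun h hh => mem_exch.2 ⟨fun hAh => ?_, key h hh⟩]
    · exact hst.2
    · rw [hinj (h₂.geo.down _ hh _ hAh)] at h2
      simp at h2
  · have hA1 : A.card = 1 := by
      have := (hF.nonempty_of_inn hAi).card_pos
      omega
    obtain ⟨x, rfl⟩ := Finset.card_eq_one.1 hA1
    have hxm : x = m := by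
      have e := a3
      rw [Φ_eq_sum (s := {x}) (by change car F (hom m) ⊆ _; rw [b2]), Finset.sum_singleton] at e
      have e2 := congrArg Prod.snd e
      have e1 := congrArg Prod.fst e
      simp only [hom, Prod.smul_snd, Prod.smul_fst, smul_eq_mul, mul_one] at e1 e2
      rwa [e2, one_smul] at e1
    rw [h₂.eq_of_subset h₁ fun h hh => ?_]
    · exact Conn.refl _
    rcases key h hh with h | ⟨-, g, hg, hxg, hhg⟩
    · exact h
    · rw [← hxm, Finset.union_eq_left.2 hxg] at hhg
      exact h₁.geo.down _ hg _ hhg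

end GeoFlip

namespace GeoFlip

variable {C : Set (E × ℝ)} {B₀ F F' G S U : Finset (Finset E)} {b : Lab E → E}

/-- The chosen points of the cells of the common refinement of `F` and `G`. -/
def Pts (C : Set (E × ℝ)) (F G : Finset (Finset E)) (b : Lab E → E) : Prop :=
  ∀ y, core C y → core C (hom (b (car F y, (car G y : WithTop (Finset E))))) ∧
    car F (hom (b (car F y, (car G y : WithTop (Finset E))))) = car F y ∧
    car G (hom (b (car F y, (car G y : WithTop (Finset E))))) = car G y

/-- The label of the cell containing a point. -/
noncomputable def lab (F G U : Finset (Finset E)) (y : E × ℝ) : Lab E :=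
  (car F y, if car F y ∈ U then ⊤ else (car G y : WithTop (Finset E)))

/-- The labels of the interior cells. -/
noncomputable def labs (C : Set (E × ℝ)) (F G U : Finset (Finset E)) : Finset (Lab E) :=
  (F ×ˢ insert ⊤ (G.image (WithTop.some : Finset E → WithTop (Finset E)))).filter fun μ =>
    ∃ y, core C y ∧ lab F G U y = μ

lemma lab_of_mem {y : E × ℝ} (h : car F y ∈ U) : lab F G U y = (car F y, ⊤) := by
  rw [lab, if_pos h]

lemma lab_of_notMem {y : E × ℝ} (h : car F y ∉ U) :
    lab F G U y = (car F y, (car G y : WithTop (Finset E))) := by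
  rw [lab, if_neg h]

namespace Tri

lemma mem_labs (hF : Tri C B₀ F) (hG : Tri C B₀ G) {μ : Lab E} :
    μ ∈ labs C F G U ↔ ∃ y, core C y ∧ lab F G U y = μ := by
  rw [labs, Finset.mem_filter, and_iff_right_iff_imp]
  rintro ⟨y, hy, rfl⟩
  have h1 := (wt_spec (hF.cone_eq.symm ▸ hy.mem : y ∈ cone F)).2.1
  have h2 := (wt_spec (hG.cone_eq.symm ▸ hy.mem : y ∈ cone G)).2.1
  rw [Finset.mem_product]
  refine ⟨h1, ?_⟩
  unfold lab
  split_ifs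
  · exact Finset.mem_insert_self _ _
  · exact Finset.mem_insert_of_mem (Finset.mem_image_of_mem WithTop.some h2)

lemma core_b (hF : Tri C B₀ F) (hG : Tri C B₀ G) (hb : Bary C F b) (hp : Pts C F G b)
    {μ : Lab E} (hμ : μ ∈ labs C F G U) :
    core C (hom (b μ)) ∧ lab F G U (hom (b μ)) = μ := by
  obtain ⟨y, hy, rfl⟩ := (hF.mem_labs hG).1 hμ
  by_cases hu : car F y ∈ U
  · have hi := (hF.core_car hy.mem).1 hy
    obtain ⟨b1, b2⟩ := hb _ (wt_spec (hF.cone_eq.symm ▸ hy.mem : y ∈ cone F)).2.1 hi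
    rw [lab_of_mem hu]
    refine ⟨b1, ?_⟩
    rw [lab_of_mem (by rwa [b2]), b2]
  · obtain ⟨p1, p2, p3⟩ := hp y hy
    rw [lab_of_notMem hu]
    refine ⟨p1, ?_⟩
    rw [lab_of_notMem (by rwa [p2]), p2, p3]

lemma bdys_comm (hF : Tri C B₀ F) (hG : Tri C B₀ G) : bdys C F = bdys C G := by
  ext f
  rw [mem_bdys, mem_bdys, and_congr_left_iff]
  intro hf
  rw [hF.bdry f hf, hG.bdry f hf]

lemma lab_add (hF : Tri C B₀ F) (hG : Tri C B₀ G) {y z : E × ℝ} (hy : y ∈ C)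
    (hz : core C z) (h1 : car F y ⊆ car F z) (h2 : car F z ∉ U → car G y ⊆ car G z) {t : ℝ}
    (ht : 0 < t) : core C (y + t • z) ∧ lab F G U (y + t • z) = lab F G U z := by
  have k1 := hF.geo.car_add (hF.cone_eq.symm ▸ hy) (hF.cone_eq.symm ▸ hz.mem) h1 ht
  refine ⟨?_, ?_⟩
  · rw [hF.core_car (hF.cone_eq ▸ k1.1), k1.2, ← hF.core_car hz.mem]
    exact hz
  · by_cases hu : car F z ∈ U
    · rw [lab_of_mem hu, lab_of_mem (by rwa [k1.2]), k1.2]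
    · have k2 := hG.geo.car_add (hG.cone_eq.symm ▸ hy) (hG.cone_eq.symm ▸ hz.mem) (h2 hu) ht
      rw [lab_of_notMem hu, lab_of_notMem (by rwa [k1.2]), k1.2, k2.2]

lemma meet_cell (hF : Tri C B₀ F) (hG : Tri C B₀ G) (hb : Bary C F b) (hp : Pts C F G b)
    (hU : Upper C F U) :
    CellData C B₀ (bdys C F) (labs C F G U) b (fun μ y => core C y ∧ lab F G U y = μ) where
  geo := hF.geo.sub (Finset.filter_subset _ _) (mem_bdys.2 ⟨hF.geo.empty, hF.not_inn_empty⟩)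
    (fun f hf g hg => by
      rw [mem_bdys] at hf ⊢
      exact ⟨hF.geo.down _ hf.1 _ hg, fun h => hf.2 (hF.inn_mono hg hf.1 h)⟩)
  bdry f hf := by
    rw [← hF.bdry f hf, mem_bdys]
    exact and_iff_left hf
  cone_le := by
    rintro y ⟨w, hw, hs, rfl⟩
    rw [← hF.cone_eq]
    exact ⟨w, hw, (mem_bdys.1 hs).1, rfl⟩
  disj μ _ ν _ y h h' := h.2.symm.trans h'.2
  disj_cone μ _ y hy h := by
    obtain ⟨w, hw, hs, rfl⟩ := hy
    rw [mem_bdys] at hs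
    apply hs.2
    rw [← hF.geo.car_Φ hw hs.1, ← hF.core_car h.1.mem]
    exact h.1
  core_of μ _ y h := h.1
  star_low μ hμ w hw hs hl t ht := by
    obtain ⟨b1, b2⟩ := hF.core_b hG hb hp hμ
    have hsF := (mem_bdys.1 hs).1
    have hsG := (mem_bdys.1 (hF.bdys_comm hG ▸ hs)).1
    have := hF.lab_add hG (U := U) (y := Φ w) (hF.cone_eq ▸ ⟨w, hw, hsF, rfl⟩) b1 ?_ ?_ ht
    · rwa [b2] at this
    · rw [hF.geo.car_Φ hw hsF]
      rw [← b2] at hl; exact hl.1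
    · intro hu
      rw [hG.geo.car_Φ hw hsG]
      rw [← b2, lab_of_notMem hu] at hl
      exact WithTop.coe_le_coe.1 hl.2
  star μ hμ ν hν hlt y hy t ht := by
    obtain ⟨b1, b2⟩ := hF.core_b hG hb hp hμ
    rw [← hy.2, ← b2] at hlt
    have hle := hlt.le
    have := hF.lab_add hG (U := U) hy.1.mem b1 hle.1 ?_ ht
    · rwa [b2] at this
    · intro hu
      rw [lab_of_notMem hu, lab_of_notMem fun h => hu (hU.up _ h _
        (wt_spec (hF.cone_eq.symm ▸ b1.mem : _ ∈ cone F)).2.1 hle.1)] at hle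
      exact WithTop.coe_le_coe.1 hle.2
  radial μ hμ y hy := by
    obtain ⟨b1, b2⟩ := hF.core_b hG hb hp hμ
    set z := hom (b μ) with hz
    have hzF : z ∈ cone F := hF.cone_eq.symm ▸ b1.mem
    have hzG : z ∈ cone G := hG.cone_eq.symm ▸ b1.mem
    have hyF : y ∈ cone F := hF.cone_eq.symm ▸ hy.1.mem
    have hyG : y ∈ cone G := hG.cone_eq.symm ▸ hy.1.mem
    have hl : lab F G U y = lab F G U z := hy.2.trans b2.symm
    have hlF : car F y = car F z := congrArg Prod.fst hl
    have hup : ∀ A ∈ U, A ⊆ car F z → car F z ∈ U := fun A hA h => hU.up _ hA _ (wt_spec hzF).2.1 h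
    obtain ⟨t, ht, ⟨h1, h2⟩, h3⟩ := hF.geo.car_sub hyF hzF hlF
      (hF.nonempty_of_inn ((hF.core_car b1.mem).1 b1))
    have fin : ∀ t > (0 : ℝ), y - t • z ∈ cone F → car F (y - t • z) ⊆ car F z →
        (car F z ∉ U → car G (y - t • z) ⊆ car G z) →
        (lab F G U (y - t • z) ≠ lab F G U z) →
        ∃ t > (0 : ℝ), ∃ y', y = y' + t • z ∧
          ((∃ ν ∈ labs C F G U, ν < μ ∧ core C y' ∧ lab F G U y' = ν) ∨
          ∃ w : E →₀ ℝ, 0 ≤ w ∧ w.support ∈ bdys C F ∧ low w.support ≤ μ ∧ y' = Φ w) := by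
      intro t ht hc1 hc2 hc3 hc4
      refine ⟨t, ht, y - t • z, by rw [sub_add_cancel], ?_⟩
      by_cases hcore : core C (y - t • z)
      · left
        refine ⟨_, (hF.mem_labs hG).2 ⟨_, hcore, rfl⟩, ?_, hcore, rfl⟩
        rw [← b2]
        refine lt_of_le_of_ne ⟨hc2, ?_⟩ hc4
        by_cases hu : car F z ∈ U
        · rw [lab_of_mem hu]; exact le_top
        · rw [lab_of_notMem hu, lab_of_notMem fun h => hu (hup _ h hc2)]
          exact WithTop.coe_le_coe.2 (hc3 hu)
      · right
        obtain ⟨w1, w2, w3⟩ := wt_spec hc1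
        have hs : car F (y - t • z) ∈ bdys C F :=
          mem_bdys.2 ⟨w2, fun h => hcore ((hF.core_car (hF.cone_eq ▸ hc1)).2 h)⟩
        refine ⟨_, w1, hs, ?_, w3.symm⟩
        rw [← b2]
        refine ⟨hc2, ?_⟩
        by_cases hu : car F z ∈ U
        · rw [lab_of_mem hu]; exact le_top
        · rw [lab_of_notMem hu]
          refine WithTop.coe_le_coe.2 (subset_trans ?_ (hc3 hu))
          have := hG.geo.car_Φ w1 (mem_bdys.1 (hF.bdys_comm hG ▸ hs)).1
          rw [w3] at this
          exact this.symm.subset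
    by_cases hu : car F z ∈ U
    · exact fin t ht h1 h2.1 (fun h => absurd hu h) fun h => h2.ne (congrArg Prod.fst h)
    · rw [lab_of_notMem hu, lab_of_notMem (by rwa [hlF])] at hl
      have hlG : car G y = car G z := WithTop.coe_injective (congrArg Prod.snd hl)
      obtain ⟨t', ht', ⟨h1', h2'⟩, h3'⟩ := hG.geo.car_sub hyG hzG hlG
        (hG.nonempty_of_inn ((hG.core_car b1.mem).1 b1))
      rcases le_total t t' with htt | htt
      · have := h3' t ht.le htt
        exact fin t ht h1 h2.1 (fun _ => this.2) fun h => h2.ne (congrArg Prod.fst h)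
      · have := h3 t' ht'.le htt
        refine fin t' ht' this.1 this.2 (fun _ => h2'.1) fun h => h2'.ne ?_
        rw [lab_of_notMem hu, lab_of_notMem fun h => hu (hup _ h this.2)] at h
        exact WithTop.coe_injective (congrArg Prod.snd h)
  cover y hy := by
    by_cases hc : core C y
    · exact Or.inl ⟨_, (hF.mem_labs hG).2 ⟨y, hc, rfl⟩, hc, rfl⟩
    · obtain ⟨w1, w2, w3⟩ := wt_spec (hF.cone_eq.symm ▸ hy : y ∈ cone F)
      exact Or.inr ⟨_, w1, mem_bdys.2 ⟨w2, fun h => hc ((hF.core_car hy).2 h)⟩, w3⟩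

end Tri

/-- The common refinement of `F` and `G`, coarsened over the interiors of the simplices in `U`. -/
noncomputable def meet (C : Set (E × ℝ)) (F G : Finset (Finset E)) (b : Lab E → E)
    (U : Finset (Finset E)) : Finset (Finset E) :=
  ovl (bdys C F) (labs C F G U) b

lemma Tri.meet_tri (hF : Tri C B₀ F) (hG : Tri C B₀ G) (hb : Bary C F b) (hp : Pts C F G b)
    (hU : Upper C F U) : Tri C B₀ (meet C F G b U) := (hF.meet_cell hG hb hp hU).tri

lemma Tri.upper_inns (hF : Tri C B₀ F) : Upper C F (inns C F) :=
  ⟨fun _ hA => mem_inns.1 hA, fun _ hA _ hA' h =>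
    mem_inns.2 ⟨hA', hF.inn_mono h hA' (mem_inns.1 hA).2⟩⟩

lemma Tri.meet_inns (hF : Tri C B₀ F) (hG : Tri C B₀ G) (hb : Bary C F b) (hp : Pts C F G b) :
    meet C F G b (inns C F) = der F b (inns C F) := by
  refine (hF.meet_tri hG hb hp hF.upper_inns).eq_of_subset (hF.der_tri hb hF.upper_inns) ?_
  refine ovl_mono (fun f hf => ?_) fun μ hμ => ?_
  · rw [mem_bdys] at hf
    exact Finset.mem_sdiff.2 ⟨hf.1, fun h => hf.2 (mem_inns.1 h).2⟩
  · obtain ⟨y, hy, rfl⟩ := (hF.mem_labs hG).1 hμ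
    have : car F y ∈ inns C F := mem_inns.2
      ⟨(wt_spec (hF.cone_eq.symm ▸ hy.mem : y ∈ cone F)).2.1, (hF.core_car hy.mem).1 hy⟩
    rw [lab_of_mem this]
    exact Finset.mem_image_of_mem _ this

lemma Tri.meet_comm (hF : Tri C B₀ F) (hG : Tri C B₀ G) {b' : Lab E → E} (hb : Bary C F b)
    (hp : Pts C F G b) (hb' : Bary C G b') (hp' : Pts C G F b')
    (h : ∀ A B : Finset E, b' (B, (A : WithTop (Finset E))) = b (A, (B : WithTop (Finset E)))) :
    meet C F G b ∅ = meet C G F b' ∅ := by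
  have hU : ∀ F, Upper C F ∅ := fun F => ⟨by simp, by simp⟩
  refine (hF.meet_tri hG hb hp (hU _)).eq_of_subset (hG.meet_tri hF hb' hp' (hU _)) ?_
  intro σ hσ
  obtain ⟨f, hf, c, hc, h1, h2, rfl⟩ := mem_ovl.1 hσ
  have hc' : ∀ μ ∈ c, ∃ A B : Finset E, μ = (A, (B : WithTop (Finset E))) ∧
      ((B, (A : WithTop (Finset E))) : Lab E) ∈ labs C G F ∅ := by
    intro μ hμ
    obtain ⟨y, hy, rfl⟩ := (hF.mem_labs hG).1 (hc hμ)
    exact ⟨_, _, lab_of_notMem (by simp), (hG.mem_labs hF).2 ⟨y, hy, lab_of_notMem (by simp)⟩⟩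
  let s : Lab E → Lab E := fun μ => (μ.2.untopD ∅, (μ.1 : WithTop (Finset E)))
  refine mem_ovl.2 ⟨f, hF.bdys_comm hG ▸ hf, c.image s, ?_, ?_, ?_, ?_⟩
  · intro ν hν
    obtain ⟨μ, hμ, rfl⟩ := Finset.mem_image.1 hν
    obtain ⟨A, B, rfl, hm⟩ := hc' μ hμ
    exact hm
  · intro ν hν
    obtain ⟨μ, hμ, rfl⟩ := Finset.mem_image.1 hν
    have hl := h1 μ hμ
    obtain ⟨A, B, rfl, hm⟩ := hc' μ hμ
    exact ⟨WithTop.coe_le_coe.1 hl.2, WithTop.coe_le_coe.2 hl.1⟩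
  · intro ν hν ν' hν'
    obtain ⟨μ, hμ, rfl⟩ := Finset.mem_image.1 hν
    obtain ⟨μ', hμ', rfl⟩ := Finset.mem_image.1 hν'
    have hl := h2 μ hμ μ' hμ'
    obtain ⟨A, B, rfl, -⟩ := hc' μ hμ
    obtain ⟨A', B', rfl, -⟩ := hc' μ' hμ'
    exact hl.imp (fun hl => ⟨WithTop.coe_le_coe.1 hl.2, WithTop.coe_le_coe.2 hl.1⟩)
      fun hl => ⟨WithTop.coe_le_coe.1 hl.2, WithTop.coe_le_coe.2 hl.1⟩
  · rw [Finset.image_image]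
    congr 1
    refine Finset.image_congr fun μ hμ => ?_
    obtain ⟨A, B, rfl, -⟩ := hc' μ hμ
    exact (h A B).symm

end GeoFlip

namespace GeoFlip

variable {C : Set (E × ℝ)} {B₀ F F' G S U : Finset (Finset E)} {b : Lab E → E}

lemma exists_notMem_chain {A : Finset E} (s : Finset (Finset E)) (hne : s.Nonempty)
    (hch : ∀ g ∈ s, ∀ h ∈ s, g ⊆ h ∨ h ⊆ g) (hs : ∀ g ∈ s, g ⊂ A) : ∃ d ∈ A, ∀ g ∈ s, d ∉ g := by
  obtain ⟨m, hm⟩ := s.exists_maximal hne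
  obtain ⟨d, hd, hdm⟩ := Finset.exists_of_ssubset (hs m hm.prop)
  refine ⟨d, hd, fun g hg hdg => hdm ?_⟩
  rcases hch g hg m hm.prop with h | h
  · exact h hdg
  · rw [hm.eq_of_le hg h]; exact hdg

lemma Geo.hom_mem_cone (hF : Geo F) {f : Finset E} (hf : f ∈ F) {x : E} (hx : x ∈ f) :
    hom x ∈ cone F ∧ car F (hom x) = {x} := by
  have hs : (Finsupp.single x (1 : ℝ)).support = {x} := Finsupp.support_single _ one_ne_zero
  have h1 : (Finsupp.single x (1 : ℝ)).support ∈ F := by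
    rw [hs]; exact hF.down _ hf _ (by simpa)
  have h0 : (0 : E →₀ ℝ) ≤ Finsupp.single x 1 := Finsupp.single_nonneg.2 zero_le_one
  have he : Φ (Finsupp.single x (1 : ℝ)) = hom x := by rw [Φ_single, one_smul]
  refine ⟨⟨_, h0, h1, he⟩, ?_⟩
  rw [← he, hF.car_Φ h0 h1, hs]

lemma Tri.notMem_bdys (hF : Tri C B₀ F) {x : E} (hx : core C (hom x)) {f : Finset E}
    (hf : f ∈ bdys C F) : x ∉ f := fun h => by
  rw [mem_bdys] at hf
  have := (hF.core_car hx.mem).1 hx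
  rw [(hF.geo.hom_mem_cone hf.1 h).2] at this
  exact hf.2 (hF.inn_mono (by simpa using h) hf.1 this)

section FiniteDim

variable [FiniteDimensional ℝ E]

lemma Tri.meet_pos (hF : Tri C B₀ F) (hG : Tri C B₀ G) (hb : Bary C F b) (hp : Pts C F G b)
    (hU : Upper C F U) {A : Finset E} (hAF : A ∈ F) (hAi : Inn C A)
    (hbig : ∀ A' ∈ F, A ⊂ A' → A' ∈ U) {f : Finset E} (hf : f ∈ bdys C F) {c : Finset (Lab E)}
    (hc : c ⊆ labs C F G U) (hlow : ∀ μ ∈ c, low f ≤ μ)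
    (hch : ∀ μ ∈ c, ∀ ν ∈ c, μ ≤ ν ∨ ν ≤ μ)
    (htop : f ∪ c.image b ∈ tops (meet C F G b U)) {μ : Lab E} (hμ : μ ∈ c) (hμA : μ.1 = A)
    (huniq : ∀ ν ∈ c, ν.1 = A → ν = μ) :
    0 < cw (f ∪ c.image b) (hom (b (A, ⊤))) (b μ) := by
  have hX := hF.meet_tri hG hb hp hU
  have hfF := (mem_bdys.1 hf).1
  set ρ := f ∪ c.image b with hρ
  obtain ⟨hρX, hcard⟩ := mem_tops.1 htop
  set o := b (A, ⊤) with ho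
  obtain ⟨o1, o2⟩ := hb A hAF hAi
  set u := cw ρ (hom o) with hu
  obtain ⟨us, ue⟩ := hX.geo.cw_spec hρX hcard (hom o)
  have hcar : ∀ ν ∈ c, hom (b ν) ∈ cone F ∧ car F (hom (b ν)) = ν.1 := fun ν hν => by
    obtain ⟨c1, c2⟩ := hF.core_b hG hb hp (hc hν)
    exact ⟨hF.cone_eq.symm ▸ c1.mem, congrArg Prod.fst c2⟩
  have hcF : ∀ ν ∈ c, ν.1 ∈ F := fun ν hν => by
    rw [← (hcar ν hν).2]; exact (wt_spec (hcar ν hν).1).2.1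
  have hcU : ∀ ν ∈ c, ν.1 ∈ U → ν.2 = ⊤ := fun ν hν h => by
    obtain ⟨y, hy, rfl⟩ := (hF.mem_labs hG).1 (hc hν)
    rw [lab_of_mem h]
  have hρcar : ∀ x ∈ ρ, hom x ∈ cone F := fun x hx => by
    rcases Finset.mem_union.1 hx with hx | hx
    · exact (hF.geo.hom_mem_cone hfF hx).1
    · obtain ⟨ν, hν, rfl⟩ := Finset.mem_image.1 hx
      exact (hcar ν hν).1
  obtain ⟨l, hl⟩ := c.exists_maximal ⟨μ, hμ⟩
  have hgr : ∀ ν ∈ c, ν.1 ⊆ l.1 := fun ν hν => by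
    rcases hch ν hν l hl.prop with h | h
    · exact h.1
    · rw [hl.eq_of_le hν h]
  have hρl : ∀ x ∈ ρ, car F (hom x) ⊆ l.1 := fun x hx => by
    rcases Finset.mem_union.1 hx with hx | hx
    · rw [(hF.geo.hom_mem_cone hfF hx).2, Finset.singleton_subset_iff]
      exact (hlow l hl.prop).1 hx
    · obtain ⟨ν, hν, rfl⟩ := Finset.mem_image.1 hx
      rw [(hcar ν hν).2]
      exact hgr ν hν
  have ocone : hom o ∈ cone F := hF.cone_eq.symm ▸ o1.mem
  have hsum : ∑ x ∈ ρ, u x • wt F (hom x) = wt F (hom o) := by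
    refine hF.geo.inj_on (hcF l hl.prop) ?_ ?_ ?_
    · refine Finsupp.support_finsetSum.trans fun d hd => ?_
      obtain ⟨x, hx, hd⟩ := Finset.mem_biUnion.1 hd
      exact hρl x hx (Finsupp.support_smul hd)
    · change car F (hom o) ⊆ _
      rw [o2, ← hμA]
      exact hgr μ hμ
    · rw [map_sum, (wt_spec ocone).2.2, ← ue, Φ_eq_sum us]
      refine Finset.sum_congr rfl fun x hx => ?_
      rw [map_smul, (wt_spec (hρcar x hx)).2.2]
  have hsum' : ∀ d, ∑ x ∈ ρ, u x * wt F (hom x) d = wt F (hom o) d := fun d => by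
    rw [← hsum, Finsupp.finsetSum_apply]
    rfl
  have hev : ∀ ν ∈ c, ∀ d, d ∉ f → (∀ ν' ∈ c, ν' ≠ ν → u (b ν') ≠ 0 → d ∉ ν'.1) →
      u (b ν) * wt F (hom (b ν)) d = wt F (hom o) d := by
    intro ν hν d hdf hd
    rw [← hsum' d, ← Finset.sum_subset (s₁ := {b ν})]
    · simp
    · exact Finset.singleton_subset_iff.2 (Finset.mem_union_right f (Finset.mem_image_of_mem b hν))
    · intro x hx hxν
      rw [Finset.mem_singleton] at hxν
      rcases Finset.mem_union.1 hx with hx | hx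
      · have := (hF.geo.hom_mem_cone hfF hx).2
        have h0 : d ∉ car F (hom x) := by
          rw [this, Finset.mem_singleton]; rintro rfl; exact hdf hx
        rw [Finsupp.notMem_support_iff.1 h0, mul_zero]
      · obtain ⟨ν', hν', rfl⟩ := Finset.mem_image.1 hx
        by_cases h0 : u (b ν') = 0
        · rw [h0, zero_mul]
        · have := hd ν' hν' (by rintro rfl; exact hxν rfl) h0
          rw [← (hcar ν' hν').2] at this
          rw [Finsupp.notMem_support_iff.1 this, mul_zero]
  have hwne : ∀ ν ∈ c, ∀ d ∈ ν.1, wt F (hom (b ν)) d ≠ 0 := fun ν hν d hd => by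
    rw [← (hcar ν hν).2] at hd
    exact Finsupp.mem_support_iff.1 hd
  have hfsub : ∀ ν ∈ c, f ⊆ ν.1 := fun ν hν => (hlow ν hν).1
  have hchain : ∀ s ⊆ c, ∀ g ∈ insert f (s.image Prod.fst), ∀ h ∈ insert f (s.image Prod.fst),
      g ⊆ h ∨ h ⊆ g := by
    intro s hs g hg h hh
    rcases Finset.mem_insert.1 hg with rfl | hg
    · rcases Finset.mem_insert.1 hh with rfl | hh
      · exact Or.inl subset_rfl
      · obtain ⟨ν, hν, rfl⟩ := Finset.mem_image.1 hh
        exact Or.inl (hfsub ν (hs hν))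
    · obtain ⟨ν, hν, rfl⟩ := Finset.mem_image.1 hg
      rcases Finset.mem_insert.1 hh with rfl | hh
      · exact Or.inr (hfsub ν (hs hν))
      · obtain ⟨ν', hν', rfl⟩ := Finset.mem_image.1 hh
        exact (hch ν (hs hν) ν' (hs hν')).imp (fun h => h.1) fun h => h.1
  have hcmp : ∀ ν ∈ c, ν.1 ⊆ A ∨ A ⊂ ν.1 := fun ν hν => by
    by_cases h : ν.1 ⊆ A
    · exact Or.inl h
    · right
      refine ⟨?_, h⟩
      rcases hch ν hν μ hμ with h' | h'
      · exact absurd (hμA ▸ h'.1) h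
      · rw [← hμA]; exact h'.1
  have hfA : f ⊂ A := by
    refine lt_of_le_of_ne (hμA ▸ hfsub μ hμ) ?_
    rintro rfl
    exact (mem_bdys.1 hf).2 hAi
  have step : ∀ ν ∈ c, A ⊂ ν.1 → u (b ν) = 0 := by
    by_contra! hcon
    obtain ⟨ν₀, h0, h1, h2⟩ := hcon
    obtain ⟨ν, hν⟩ := (c.filter fun ν => A ⊂ ν.1 ∧ u (b ν) ≠ 0).exists_maximal
      ⟨ν₀, Finset.mem_filter.2 ⟨h0, h1, h2⟩⟩
    obtain ⟨hνc, hνA, hνu⟩ := Finset.mem_filter.1 hν.prop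
    have hνt := hcU ν hνc (hbig _ (hcF ν hνc) hνA)
    have hlt : ∀ ν' ∈ c, ν' ≠ ν → u (b ν') ≠ 0 → ν'.1 ⊂ ν.1 := by
      intro ν' hν' hne hu'
      rcases hcmp ν' hν' with h | h
      · exact h.trans_ssubset hνA
      · have hle : ν' ≤ ν := by
          rcases hch ν' hν' ν hνc with h' | h'
          · exact h'
          · exact (hν.eq_of_le (Finset.mem_filter.2 ⟨hν', h, hu'⟩) h').symm.le
        refine lt_of_le_of_ne hle.1 fun he => hne ?_
        exact Prod.ext he ((hcU ν' hν' (hbig _ (hcF ν' hν') h)).trans hνt.symm)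
    obtain ⟨d, hd, hd'⟩ := exists_notMem_chain (A := ν.1)
      (insert f ((c.filter fun ν' => ν'.1 ⊂ ν.1).image Prod.fst))
      (Finset.insert_nonempty _ _) (hchain _ (Finset.filter_subset _ _)) (by
        intro g hg
        rcases Finset.mem_insert.1 hg with rfl | hg
        · exact hfA.trans hνA
        · obtain ⟨ν', hν', rfl⟩ := Finset.mem_image.1 hg
          exact (Finset.mem_filter.1 hν').2)
    have hd'' : ∀ ν' ∈ c, ν'.1 ⊂ ν.1 → d ∉ ν'.1 := fun ν' hν' h =>
      hd' _ (Finset.mem_insert_of_mem (Finset.mem_image_of_mem _ (Finset.mem_filter.2 ⟨hν', h⟩)))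
    have := hev ν hνc d (hd' f (Finset.mem_insert_self _ _))
      fun ν' hν' hne hu' => hd'' ν' hν' (hlt ν' hν' hne hu')
    have h0 : d ∉ car F (hom o) := by
      rw [o2, ← hμA]
      exact hd'' μ hμ (hμA ▸ hνA)
    rw [Finsupp.notMem_support_iff.1 h0] at this
    exact mul_ne_zero hνu (hwne ν hνc d hd) this
  obtain ⟨d, hd, hd'⟩ := exists_notMem_chain (A := A)
    (insert f ((c.filter fun ν' => ν'.1 ⊂ A).image Prod.fst))
    (Finset.insert_nonempty _ _) (hchain _ (Finset.filter_subset _ _)) (by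
      intro g hg
      rcases Finset.mem_insert.1 hg with rfl | hg
      · exact hfA
      · obtain ⟨ν', hν', rfl⟩ := Finset.mem_image.1 hg
        exact (Finset.mem_filter.1 hν').2)
  have := hev μ hμ d (hd' f (Finset.mem_insert_self _ _)) fun ν' hν' hne hu' => by
    refine hd' _ (Finset.mem_insert_of_mem (Finset.mem_image_of_mem _
      (Finset.mem_filter.2 ⟨hν', ?_⟩)))
    rcases hcmp ν' hν' with h | h
    · exact lt_of_le_of_ne h fun he => hne (huniq ν' hν' he)
    · exact absurd (step ν' hν' h) hu'
  have p1 : 0 < wt F (hom (b μ)) d :=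
    lt_of_le_of_ne ((wt_spec (hcar μ hμ).1).1 d) (hwne μ hμ d (hμA ▸ hd)).symm
  have p2 : 0 < wt F (hom o) d := by
    refine lt_of_le_of_ne ((wt_spec ocone).1 d) (Finsupp.mem_support_iff.1 ?_).symm
    change d ∈ car F (hom o)
    rwa [o2]
  rw [← this] at p2
  exact pos_of_mul_pos_left p2 p1.le

lemma Tri.meet_step (hdim : topCard E ≤ 4) (hE : 2 ≤ topCard E) (hF : Tri C B₀ F)
    (hG : Tri C B₀ G) (hb : Bary C F b) (hp : Pts C F G b) {A : Finset E} (hU : Upper C F U)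
    (hU' : Upper C F (insert A U)) (hA : A ∉ U) :
    Conn C B₀ (meet C F G b U) (meet C F G b (insert A U)) := by
  obtain ⟨hAF, hAi⟩ := hU'.sub A (Finset.mem_insert_self _ _)
  have h₁ := hF.meet_tri hG hb hp hU
  have h₂ := hF.meet_tri hG hb hp hU'
  obtain ⟨o1, o2⟩ := hb A hAF hAi
  let I := (((labs C F G U).filter fun μ => μ.1 = A) ∪ {(A, ⊤)}).image b
  have hI : ∀ i ∈ I, core C (hom i) ∧ car F (hom i) = A := by
    intro i hi
    obtain ⟨μ, hμ, rfl⟩ := Finset.mem_image.1 hi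
    rcases Finset.mem_union.1 hμ with hμ | hμ
    · obtain ⟨h1, h2⟩ := Finset.mem_filter.1 hμ
      obtain ⟨c1, c2⟩ := hF.core_b hG hb hp h1
      exact ⟨c1, (congrArg Prod.fst c2).trans h2⟩
    · rw [Finset.mem_singleton.1 hμ]
      exact ⟨o1, o2⟩
  have hI' : ∀ μ ∈ labs C F G U, μ.1 = A → b μ ∈ I := fun μ hμ h =>
    Finset.mem_image_of_mem _ (Finset.mem_union_left _ (Finset.mem_filter.2 ⟨hμ, h⟩))
  have ho : b (A, ⊤) ∈ I := Finset.mem_image_of_mem _ (by simp)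
  have hfst : ∀ V, ∀ μ ∈ labs C F G V, car F (hom (b μ)) = μ.1 := fun V μ hμ =>
    congrArg Prod.fst (hF.core_b hG hb hp hμ).2
  have hlabA : ∀ μ ∈ labs C F G (insert A U), μ.1 = A → μ = (A, ⊤) := by
    intro μ hμ h
    obtain ⟨y, hy, rfl⟩ := (hF.mem_labs hG).1 hμ
    replace h : car F y = A := h
    rw [lab_of_mem (by rw [h]; exact Finset.mem_insert_self _ _), h]
  have hlab : ∀ μ : Lab E, μ.1 ≠ A → (μ ∈ labs C F G U ↔ μ ∈ labs C F G (insert A U)) := by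
    intro μ hμ
    rw [hF.mem_labs hG, hF.mem_labs hG]
    refine exists_congr fun y => and_congr_right fun _ => ?_
    have : car F y ≠ A → lab F G U y = lab F G (insert A U) y := fun h => by
      unfold lab
      simp [h]
    constructor
    · intro h
      rw [← this, h]
      rintro rfl; exact hμ (congrArg Prod.fst h).symm
    · intro h
      rw [this, h]
      rintro rfl; exact hμ (congrArg Prod.fst h).symm
  refine h₁.conn_of_agree hdim hE h₂ I (fun i hi => inn_singleton.2 (hI i hi).1) (b (A, ⊤))
    ?_ ?_ ?_
  · intro ρ hρ i hi
    obtain ⟨hiρ, hiI⟩ := Finset.mem_inter.1 (hi.symm ▸ Finset.mem_singleton_self i : i ∈ ρ ∩ I)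
    obtain ⟨f, hf, c, hc, k1, k2, rfl⟩ := mem_ovl.1 (mem_tops.1 hρ).1
    rcases Finset.mem_union.1 hiρ with h | h
    · exact absurd h (hF.notMem_bdys (hI i hiI).1 hf)
    · obtain ⟨μ, hμ, rfl⟩ := Finset.mem_image.1 h
      have hμA : μ.1 = A := by rw [← hfst _ μ (hc hμ)]; exact (hI _ hiI).2
      refine hF.meet_pos hG hb hp hU hAF hAi (fun A' hA' hlt => ?_) hf hc k1 k2 hρ hμ hμA ?_
      · refine (Finset.mem_insert.1 (hU'.up A (Finset.mem_insert_self _ _) A' hA'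
          hlt.1)).resolve_left ?_
        rintro rfl; exact lt_irrefl _ hlt
      · intro ν hν hνA
        refine (hF.meet_cell hG hb hp hU).b_inj (hc hν) (hc hμ) ?_
        have : b ν ∈ (f ∪ c.image b) ∩ I := Finset.mem_inter.2
          ⟨Finset.mem_union_right _ (Finset.mem_image_of_mem _ hν), hI' ν (hc hν) hνA⟩
        rwa [hi, Finset.mem_singleton] at this
  · intro ρ hρ i hi
    obtain ⟨hiρ, hiI⟩ := Finset.mem_inter.1 (hi.symm ▸ Finset.mem_singleton_self i : i ∈ ρ ∩ I)
    have hio : i = b (A, ⊤) := by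
      obtain ⟨f, hf, c, hc, k1, k2, rfl⟩ := mem_ovl.1 (mem_tops.1 hρ).1
      rcases Finset.mem_union.1 hiρ with h | h
      · exact absurd h (hF.notMem_bdys (hI i hiI).1 hf)
      · obtain ⟨μ, hμ, rfl⟩ := Finset.mem_image.1 h
        rw [hlabA μ (hc hμ) (by rw [← hfst _ μ (hc hμ)]; exact (hI _ hiI).2)]
    rw [← hio, h₂.geo.cw_hom (mem_tops.1 hρ).1 (mem_tops.1 hρ).2 hiρ, Finsupp.single_eq_same]
    exact one_pos
  · intro σ hσ
    rw [mem_tops, mem_tops]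
    refine and_congr_left fun _ => ?_
    have hd : ∀ x ∈ σ, x ∉ I := fun x hx hx' => Finset.disjoint_left.1 hσ hx hx'
    constructor
    · intro h
      obtain ⟨f, hf, c, hc, k1, k2, rfl⟩ := mem_ovl.1 h
      refine mem_ovl.2 ⟨f, hf, c, fun μ hμ => (hlab μ fun he => ?_).1 (hc hμ), k1, k2, rfl⟩
      exact hd _ (Finset.mem_union_right _ (Finset.mem_image_of_mem _ hμ)) (hI' μ (hc hμ) he)
    · intro h
      obtain ⟨f, hf, c, hc, k1, k2, rfl⟩ := mem_ovl.1 h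
      refine mem_ovl.2 ⟨f, hf, c, fun μ hμ => (hlab μ fun he => ?_).2 (hc hμ), k1, k2, rfl⟩
      refine hd _ (Finset.mem_union_right _ (Finset.mem_image_of_mem _ hμ)) ?_
      rw [hlabA μ (hc hμ) he]
      exact ho

lemma Tri.conn_meet (hdim : topCard E ≤ 4) (hE : 2 ≤ topCard E) (hF : Tri C B₀ F)
    (hG : Tri C B₀ G) (hb : Bary C F b) (hp : Pts C F G b) :
    Conn C B₀ F (meet C F G b ∅) := by
  have h1 := hF.conn_of_step (meet C F G b) fun U A hU hU' hA =>
    hF.meet_step hdim hE hG hb hp hU hU' hA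
  have h2 := hF.conn_of_step (der F b) fun U A hU hU' hA =>
    hF.der_step hdim hE hb hU hU' hA
  rw [der_empty] at h2
  rw [hF.meet_inns hG hb hp] at h1
  exact h2.trans h1.symm

/-- Every point of the core of the cone is a positive multiple of a point `hom x`. -/
lemma Tri.exists_hom (hF : Tri C B₀ F) {y : E × ℝ} (hy : core C y) :
    ∃ x, ∃ t > (0 : ℝ), y = t • hom x := by
  obtain ⟨w, hw, hs, rfl⟩ := hF.cone_eq.symm ▸ hy.mem
  have h2 : (Φ w).2 = ∑ x ∈ w.support, w x := by
    rw [Φ_eq_sum subset_rfl, Prod.snd_sum]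
    simp [hom]
  have hpos : 0 < (Φ w).2 := by
    rw [h2]
    refine Finset.sum_pos (fun x hx => lt_of_le_of_ne (hw x) (Finsupp.mem_support_iff.1 hx).symm) ?_
    rw [Finset.nonempty_iff_ne_empty, Ne, Finsupp.support_eq_empty]
    rintro rfl
    rw [map_zero] at hy
    exact hF.not_core_zero hy
  refine ⟨(Φ w).2⁻¹ • (Φ w).1, (Φ w).2, hpos, ?_⟩
  ext1
  · simp [hom, smul_smul, mul_inv_cancel₀ hpos.ne']
  · simp [hom]

lemma Geo.car_smul (hF : Geo F) {y : E × ℝ} (hy : y ∈ cone F) {t : ℝ} (ht : 0 < t) :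
    car F (t • y) = car F y := by
  obtain ⟨w, hw, hs, rfl⟩ := hy
  have h1 : (t • w).support = w.support := by
    ext x; simp [ht.ne']
  rw [← map_smul, hF.car_Φ (smul_nonneg ht.le hw) (by rwa [h1]), hF.car_Φ hw hs, h1]

lemma Tri.exists_point (hF : Tri C B₀ F) {y : E × ℝ} (hy : core C y) :
    ∃ x, core C (hom x) ∧ ∀ G, Tri C B₀ G → car G (hom x) = car G y := by
  obtain ⟨x, t, ht, rfl⟩ := hF.exists_hom hy
  have hx : hom x ∈ C := by
    obtain ⟨w, hw, hs, he⟩ := hF.cone_eq.symm ▸ hy.mem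
    rw [← hF.cone_eq]
    refine ⟨t⁻¹ • w, smul_nonneg (inv_nonneg.2 ht.le) hw, hF.geo.down _ hs _ Finsupp.support_smul,
        ?_⟩
    rw [map_smul, he, smul_smul, inv_mul_cancel₀ ht.ne', one_smul]
  have hcar : ∀ G, Tri C B₀ G → car G (hom x) = car G (t • hom x) := fun G hG =>
    (hG.geo.car_smul (hG.cone_eq.symm ▸ hx) ht).symm
  refine ⟨x, ?_, hcar⟩
  rw [hF.core_car hx, hcar F hF, ← hF.core_car hy.mem]
  exact hy

/-- Any two triangulations of a cone of dimension at most four with the same boundary are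
connected by moves. -/
theorem Tri.conn (hdim : topCard E ≤ 4) (hE : 2 ≤ topCard E) (hF : Tri C B₀ F)
    (hG : Tri C B₀ G) : Conn C B₀ F G := by
  have hbary : ∀ A : Finset E, ∃ x, ∀ G, Tri C B₀ G → A ∈ G → Inn C A →
      core C (hom x) ∧ car G (hom x) = A := by
    intro A
    by_cases hA : Inn C A
    · obtain ⟨x, hx, hx'⟩ := hF.exists_point hA
      refine ⟨x, fun G hG hAG _ => ⟨hx, ?_⟩⟩
      rw [hx' G hG, hG.geo.car_Φ (ind_nonneg A) (by rwa [ind_support]), ind_support]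
    · exact ⟨0, fun _ _ _ h => absurd h hA⟩
  have hpts : ∀ A B : Finset E, ∃ x, ∀ y, core C y → car F y = A → car G y = B →
      core C (hom x) ∧ car F (hom x) = A ∧ car G (hom x) = B := by
    intro A B
    by_cases h : ∃ y, core C y ∧ car F y = A ∧ car G y = B
    · obtain ⟨y, hy, rfl, rfl⟩ := h
      obtain ⟨x, hx, hx'⟩ := hF.exists_point hy
      exact ⟨x, fun _ _ _ _ => ⟨hx, hx' F hF, hx' G hG⟩⟩
    · exact ⟨0, fun y h1 h2 h3 => absurd ⟨y, h1, h2, h3⟩ h⟩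
  choose q hq using hbary
  choose p hp using hpts
  let b₁ : Lab E → E := fun μ => if μ.2 = ⊤ then q μ.1 else p μ.1 (μ.2.untopD ∅)
  let b₂ : Lab E → E := fun μ => if μ.2 = ⊤ then q μ.1 else p (μ.2.untopD ∅) μ.1
  have hb₁ : Bary C F b₁ := fun A hA hi => by
    simpa [b₁] using hq A F hF hA hi
  have hb₂ : Bary C G b₂ := fun A hA hi => by
    simpa [b₂] using hq A G hG hA hi
  have hp₁ : Pts C F G b₁ := fun y hy => by
    simpa [b₁] using hp _ _ y hy rfl rfl
  have hp₂ : Pts C G F b₂ := fun y hy => by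
    have := hp _ _ y hy rfl rfl
    simpa [b₂] using ⟨this.1, this.2.2, this.2.1⟩
  have h1 := hF.conn_meet hdim hE hG hb₁ hp₁
  have h2 := hG.conn_meet hdim hE hF hb₂ hp₂
  rw [← hF.meet_comm hG hb₁ hp₁ hb₂ hp₂ (fun A B => by simp [b₁, b₂])] at h2
  exact h1.trans h2.symm

end FiniteDim

end GeoFlip

namespace GeoFlip

variable {C : Set (E × ℝ)} {B₀ F F' : Finset (Finset E)}

lemma sum_hom {ι : Type*} (s : Finset ι) (w : ι → ℝ) (p : ι → E) :
    ∑ i ∈ s, w i • hom (p i) = (∑ i ∈ s, w i • p i, ∑ i ∈ s, w i) := by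
  ext <;> simp [hom, Prod.fst_sum, Prod.snd_sum]

lemma mem_convexHull_iff_weight {f : Finset E} {x : E} :
    x ∈ convexHull ℝ (f : Set E) ↔ ∃ w : E →₀ ℝ, 0 ≤ w ∧ w.support ⊆ f ∧ Φ w = hom x := by
  rw [Finset.mem_convexHull']
  constructor
  · rintro ⟨w, h0, h1, h2⟩
    have hs : (Finsupp.indicator f fun i _ => w i).support ⊆ f := Finsupp.support_indicator_subset
        _ _
    refine ⟨Finsupp.indicator f fun i _ => w i, fun i => ?_, hs, ?_⟩
    · by_cases hi : i ∈ f <;> simp [Finsupp.indicator_apply, hi, h0]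
    · rw [Φ_eq_sum hs]
      have : ∑ i ∈ f, (Finsupp.indicator f fun i _ => w i) i • hom i = ∑ i ∈ f, w i • hom i :=
        Finset.sum_congr rfl fun i hi => by simp [Finsupp.indicator_apply, hi]
      rw [this]
      simpa [h1, h2, hom] using sum_hom f w id
  · rintro ⟨w, h0, hs, h⟩
    rw [Φ_eq_sum hs] at h
    replace h := (sum_hom f w id).symm.trans h
    simp only [hom, Prod.mk.injEq] at h
    exact ⟨w, fun i _ => h0 i, h.2, h.1⟩

lemma affineIndependent_iff_hom {f : Finset E} :
    AffineIndependent ℝ ((↑) : f → E) ↔ LinearIndepOn ℝ hom (f : Set E) := by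
  rw [affineIndependent_iff, LinearIndepOn, linearIndependent_iff']
  refine forall₂_congr fun s w => ?_
  have h : ∑ i ∈ s, w i • hom (i : E) = 0 ↔ ∑ i ∈ s, w i • (i : E) = 0 ∧ ∑ i ∈ s, w i = 0 := by
    rw [← Prod.mk_eq_zero]
    exact (sum_hom s w (fun i => (i : E))).congr_left
  exact ⟨fun H h0 => H (h.1 h0).2 (h.1 h0).1, fun H h1 h2 => H (h.2 ⟨h2, h1⟩)⟩

lemma weight_eq_of_linearIndepOn {f : Finset E} (hf : LinearIndepOn ℝ hom (f : Set E))
    {w w' : E →₀ ℝ} (h : w.support ⊆ f) (h' : w'.support ⊆ f) (e : Φ w = Φ w') : w = w' := by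
  rw [linearIndepOn_iff] at hf
  rw [← sub_eq_zero]
  refine hf _ ?_ (by have := map_sub Φ w w'; rw [e, sub_self] at this; exact this)
  rw [Finsupp.mem_supported]
  exact_mod_cast Finsupp.support_sub.trans (Finset.union_subset h h')

/-- A nonzero nonnegative weight rescales to the homogenization of a point. -/
lemma exists_pos_smul_hom {w : E →₀ ℝ} (hw : 0 ≤ w) (hne : w ≠ 0) :
    ∃ s : ℝ, 0 < s ∧ ∃ x, Φ w = s • hom x := by
  have hs : 0 < ∑ i ∈ w.support, w i := by
    refine Finset.sum_pos (fun i hi => ?_) (Finsupp.support_nonempty_iff.2 hne)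
    exact lt_of_le_of_ne (hw i) (Ne.symm (Finsupp.mem_support_iff.1 hi))
  refine ⟨_, hs, (∑ i ∈ w.support, w i)⁻¹ • ∑ i ∈ w.support, w i • i, ?_⟩
  refine (Φ_eq_sum subset_rfl).trans ((sum_hom _ w id).trans ?_)
  ext
  · simp [hom, smul_smul, hs.ne']
  · simp [hom]

lemma smul_support {w : E →₀ ℝ} {s : ℝ} (hs : s ≠ 0) : (s • w).support = w.support := by
  ext; simp [hs]

lemma mem_cone_hom {x : E} :
    hom x ∈ cone F ↔ ∃ w : E →₀ ℝ, 0 ≤ w ∧ w.support ∈ F ∧ Φ w = hom x := Iff.rfl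

lemma Geo.hom_mem_cone_iff (hF : Geo F) {x : E} :
    hom x ∈ cone F ↔ ∃ f ∈ F, x ∈ convexHull ℝ (f : Set E) := by
  simp only [mem_convexHull_iff_weight, mem_cone_hom]
  constructor
  · rintro ⟨w, h0, hs, h⟩
    exact ⟨_, hs, w, h0, subset_rfl, h⟩
  · rintro ⟨f, hf, w, h0, hs, h⟩
    exact ⟨w, h0, hF.down _ hf _ hs, h⟩

lemma hom_ne_zero (x : E) : hom x ≠ 0 := fun h => by
  have := congrArg Prod.snd h
  simp [hom] at this

lemma cone_smul {y : E × ℝ} {s : ℝ} (hs : 0 < s) : s • y ∈ cone F ↔ y ∈ cone F := by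
  have key : ∀ {y : E × ℝ} {s : ℝ}, 0 < s → y ∈ cone F → s • y ∈ cone F := by
    rintro _ s hs ⟨w, h0, hw, rfl⟩
    exact ⟨s • w, smul_nonneg hs.le h0, by rwa [smul_support hs.ne'], map_smul _ _ _⟩
  refine ⟨fun h => ?_, key hs⟩
  have := key (inv_pos.2 hs) h
  rwa [inv_smul_smul₀ hs.ne'] at this

lemma cone_subset_of_hom (hF' : Geo F') (h : ∀ x, hom x ∈ cone F → hom x ∈ cone F') :
    cone F ⊆ cone F' := by
  rintro y hy
  obtain ⟨w, h0, hw, rfl⟩ := id hy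
  by_cases hne : w = 0
  · subst hne; exact ⟨0, le_rfl, by simpa using hF'.empty, rfl⟩
  · obtain ⟨s, hs, x, e⟩ := exists_pos_smul_hom h0 hne
    rw [e, cone_smul hs] at hy ⊢
    exact h x hy

section Interior

variable [FiniteDimensional ℝ E]

lemma core_of_mem_interior {P : Set E} (hP : ∀ x, x ∈ P → hom x ∈ cone F) {x : E}
    (hx : x ∈ interior P) : core (cone F) (hom x) := by
  rintro ⟨d, τ⟩
  have hc : ContinuousAt (fun t : ℝ => (1 + t * τ)⁻¹ • (x + t • d)) 0 := by
    refine ContinuousAt.smul (ContinuousAt.inv₀ (by fun_prop) (by simp)) (by fun_prop)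
  have h1 : ∀ᶠ t : ℝ in nhds 0, (1 + t * τ)⁻¹ • (x + t • d) ∈ P :=
    hc.eventually_mem (by simpa using mem_interior_iff_mem_nhds.1 hx)
  have h2 : ∀ᶠ t : ℝ in nhds 0, 0 < 1 + t * τ := by
    have : ContinuousAt (fun t : ℝ => 1 + t * τ) 0 := by fun_prop
    exact this.eventually_mem (Ioi_mem_nhds (by simp))
  obtain ⟨ε, hε, h⟩ := Metric.eventually_nhds_iff.1 (h1.and h2)
  refine ⟨ε / 2, by positivity, fun t ht0 ht => ?_⟩
  obtain ⟨ha, hb⟩ := h (y := t) (by simp [abs_of_nonneg ht0]; linarith)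
  have := (cone_smul hb).2 (hP _ ha)
  convert this using 1
  ext
  · simp [hom, smul_smul, hb.ne']
  · simp [hom]

lemma Geo.mem_interior_of_core (hF : Geo F) {P : Set E} (hP : ∀ x, hom x ∈ cone F → x ∈ P) {x : E}
    (hx : core (cone F) (hom x)) : x ∈ interior P := by
  obtain ⟨w, h0, hw, e⟩ := id hx.mem
  have hfull : Full F w.support := (hF.core_iff h0 hw).1 (e ▸ hx)
  have hev : ∀ᶠ x' : E in nhds x, ∀ ρ ∈ F, ∀ i ∈ w.support, -w i < cw ρ (hom x' - hom x) i := by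
    simp only [Filter.eventually_all_finset]
    intro ρ _ i hi
    have hcont : Continuous fun v : E × ℝ => cw ρ v i :=
      ((Finsupp.lapply i : (E →₀ ℝ) →ₗ[ℝ] ℝ) ∘ₗ cw ρ).continuous_of_finiteDimensional
    have hcont' : ContinuousAt (fun x' : E => cw ρ (hom x' - hom x) i) x := by
      refine (hcont.comp ?_).continuousAt
      unfold hom; fun_prop
    refine hcont'.eventually_mem (Ioi_mem_nhds ?_)
    simpa using lt_of_le_of_ne (h0 i) (Ne.symm (Finsupp.mem_support_iff.1 hi))
  rw [mem_interior_iff_mem_nhds]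
  filter_upwards [hev] with x' hx'
  apply hP
  obtain ⟨u, hu, huF, hue⟩ := hfull (hom x' - hom x)
  obtain ⟨ρ, hρ, hρc, hsub⟩ := hF.exists_top (hF.full_mono Finset.subset_union_right huF hfull)
  have hus : u.support ⊆ ρ := Finset.subset_union_left.trans hsub
  have hcw : cw ρ (hom x' - hom x) = u := by rw [← hue, hF.cw_Φ hρ hρc hus]
  refine ⟨w + u, fun i => ?_, hF.down _ hρ _ ?_, ?_⟩
  · by_cases hi : i ∈ w.support
    · have := hx' ρ hρ i hi
      rw [hcw] at this
      simp; linarith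
    · have h1 := h0 i
      have h2 := hu i hi
      simp at *; linarith
  · exact Finsupp.support_add.trans (Finset.union_subset
      (Finset.subset_union_right.trans hsub) hus)
  · rw [map_add, e, hue]; abel

lemma Geo.mem_interior_iff (hF : Geo F) {P : Set E} (hP : ∀ x, x ∈ P ↔ hom x ∈ cone F) {x : E} :
    x ∈ interior P ↔ core (cone F) (hom x) :=
  ⟨core_of_mem_interior fun x => (hP x).1, hF.mem_interior_of_core fun x => (hP x).2⟩

lemma core_smul {y : E × ℝ} {s : ℝ} (hs : 0 < s) (h : core (cone F) (s • y)) : core (cone F) y := by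
  intro d
  obtain ⟨ε, hε, h⟩ := h (s • d)
  refine ⟨ε, hε, fun t h0 h1 => (cone_smul hs).1 ?_⟩
  have := h t h0 h1
  rwa [smul_comm, ← smul_add] at this

lemma Geo.convexHull_subset_frontier_iff (hF : Geo F) {P : Set E}
    (hP : ∀ x, x ∈ P ↔ hom x ∈ cone F) {f : Finset E} (hf : f ∈ F) (hne : f.Nonempty) :
    convexHull ℝ (f : Set E) ⊆ frontier P ↔ ¬ Inn (cone F) f := by
  constructor
  · intro h hi
    have hind : ind f ≠ 0 := fun h => by
      have := ind_support f
      rw [h] at this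
      simp [← this] at hne
    obtain ⟨s, hs, x, e⟩ := exists_pos_smul_hom (ind_nonneg f) hind
    have hx : core (cone F) (hom x) := core_smul hs (by rw [← e]; exact hi)
    have hxf : x ∈ convexHull ℝ (f : Set E) := by
      refine mem_convexHull_iff_weight.2 ⟨s⁻¹ • ind f, smul_nonneg (inv_pos.2 hs).le (ind_nonneg f),
        ?_, ?_⟩
      · rw [smul_support (inv_pos.2 hs).ne', ind_support]
      · rw [map_smul, e, inv_smul_smul₀ hs.ne']
    exact (h hxf).2 ((hF.mem_interior_iff hP).2 hx)
  · intro h x hx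
    refine ⟨subset_closure ((hP x).2 (hF.hom_mem_cone_iff.2 ⟨f, hf, hx⟩)), fun hxi => h ?_⟩
    obtain ⟨w, h0, hs, e⟩ := mem_convexHull_iff_weight.1 hx
    have hcore := (hF.mem_interior_iff hP).1 hxi
    rw [← e, hF.core_iff h0 (hF.down _ hf _ hs)] at hcore
    exact (hF.inn_iff hf).2 (hF.full_mono hs hf hcore)

end Interior

/-- The geometric simplicial complex with given faces. -/
noncomputable def Geo.toComplex (hF : Geo F) : Geometry.SimplicialComplex ℝ E :=
  .ofErase F (fun _ hs => affineIndependent_iff_hom.2 (hF.linearIndepOn hs))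
    (fun _ _ hst hs => hF.down _ hs _ hst) (by
      rintro s hs t ht x ⟨hxs, hxt⟩
      obtain ⟨w, h0, hw, e⟩ := mem_convexHull_iff_weight.1 hxs
      obtain ⟨w', h0', hw', e'⟩ := mem_convexHull_iff_weight.1 hxt
      obtain rfl := hF.inj w w' h0 h0' (hF.down _ hs _ hw) (hF.down _ ht _ hw') (e.trans e'.symm)
      rw [← Finset.coe_inter]
      exact mem_convexHull_iff_weight.2 ⟨w, h0, Finset.subset_inter hw hw', e⟩)

/-- The geometric simplicial complex of a family satisfying `Geo`. -/
noncomputable def cpx (F : Finset (Finset E)) : Geometry.SimplicialComplex ℝ E :=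
  if h : Geo F then h.toComplex else ⊥

lemma Geo.mem_cpx (hF : Geo F) {f : Finset E} : f ∈ (cpx F).faces ↔ f ∈ F ∧ f.Nonempty := by
  rw [cpx, dif_pos hF, Finset.nonempty_iff_ne_empty]
  rfl

lemma Geo.mem_space_cpx (hF : Geo F) {x : E} : x ∈ (cpx F).space ↔ hom x ∈ cone F := by
  rw [hF.hom_mem_cone_iff, Geometry.SimplicialComplex.mem_space_iff]
  constructor
  · rintro ⟨s, hs, hx⟩
    exact ⟨s, (hF.mem_cpx.1 hs).1, hx⟩
  · rintro ⟨s, hs, hx⟩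
    refine ⟨s, hF.mem_cpx.2 ⟨hs, ?_⟩, hx⟩
    simpa using convexHull_nonempty_iff.1 ⟨x, hx⟩

/-- The faces of a finite complex, including the empty one. -/
noncomputable def fam (K : Geometry.SimplicialComplex ℝ E) (hK : K.faces.Finite) :
    Finset (Finset E) :=
  insert ∅ hK.toFinset

lemma mem_fam {K : Geometry.SimplicialComplex ℝ E} {hK : K.faces.Finite} {f : Finset E} :
    f ∈ fam K hK ↔ f = ∅ ∨ f ∈ K.faces := by simp [fam]

lemma geo_fam (K : Geometry.SimplicialComplex ℝ E) (hK : K.faces.Finite) : Geo (fam K hK) where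
  empty := mem_fam.2 (Or.inl rfl)
  down f hf g hg := by
    rw [mem_fam] at hf ⊢
    rcases g.eq_empty_or_nonempty with rfl | hne
    · exact Or.inl rfl
    · rcases hf with rfl | hf
      · exact Or.inl (Finset.subset_empty.1 hg)
      · exact Or.inr (K.down_closed hf hg hne)
  inj w w' h0 h0' hw hw' e := by
    rcases eq_or_ne w 0 with rfl | hne
    · by_contra h
      obtain ⟨s, hs, x, e'⟩ := exists_pos_smul_hom h0' (Ne.symm h)
      rw [← e, map_zero] at e'
      exact (smul_ne_zero hs.ne' (hom_ne_zero x)) e'.symm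
    rcases eq_or_ne w' 0 with rfl | hne'
    · obtain ⟨s, hs, x, e'⟩ := exists_pos_smul_hom h0 hne
      rw [e, map_zero] at e'
      exact absurd e'.symm (smul_ne_zero hs.ne' (hom_ne_zero x))
    obtain ⟨s, hs, x, ex⟩ := exists_pos_smul_hom h0 hne
    have hi := inv_pos.2 hs
    have hwK := (mem_fam.1 hw).resolve_left (by simpa using hne)
    have hwK' := (mem_fam.1 hw').resolve_left (by simpa using hne')
    have e1 : Φ (s⁻¹ • w) = hom x := by rw [map_smul, ex, inv_smul_smul₀ hs.ne']
    have e2 : Φ (s⁻¹ • w') = hom x := by rw [map_smul, ← e, ex, inv_smul_smul₀ hs.ne']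
    have s1 := smul_support (w := w) hi.ne'
    have s2 := smul_support (w := w') hi.ne'
    have hx := K.inter_subset_convexHull hwK hwK'
      ⟨mem_convexHull_iff_weight.2 ⟨_, smul_nonneg hi.le h0, s1.subset, e1⟩,
        mem_convexHull_iff_weight.2 ⟨_, smul_nonneg hi.le h0', s2.subset, e2⟩⟩
    rw [← Finset.coe_inter] at hx
    obtain ⟨v, -, vs, ve⟩ := mem_convexHull_iff_weight.1 hx
    have a1 := weight_eq_of_linearIndepOn (affineIndependent_iff_hom.1 (K.indep hwK)) s1.subset
      (vs.trans Finset.inter_subset_left) (e1.trans ve.symm)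
    have a2 := weight_eq_of_linearIndepOn (affineIndependent_iff_hom.1 (K.indep hwK')) s2.subset
      (vs.trans Finset.inter_subset_right) (e2.trans ve.symm)
    exact smul_right_injective _ hi.ne' (a1.trans a2.symm)

lemma cpx_fam (K : Geometry.SimplicialComplex ℝ E) (hK : K.faces.Finite) : cpx (fam K hK) = K := by
  refine Geometry.SimplicialComplex.ext ?_
  ext f
  rw [(geo_fam K hK).mem_cpx, mem_fam]
  constructor
  · rintro ⟨rfl | h, hne⟩
    · simp at hne
    · exact h
  · exact fun h => ⟨Or.inr h, K.nonempty_of_mem_faces h⟩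

lemma Move.bistellarMove {n : ℕ} (hn : topCard E = n + 1) (hF : Tri C B₀ F) (hF' : Tri C B₀ F')
    (h : Move F F') : BistellarMove n (cpx F) (cpx F') := by
  obtain ⟨A, B, hA, hB, hd, hcard, hAF, hBF, hBF', hAF', h1, h2, h3⟩ := h
  refine ⟨A, B, hF.geo.mem_cpx.2 ⟨hAF, hA⟩, fun h => hBF (hF.geo.mem_cpx.1 h).1, hB, by omega,
    ?_, ?_, ?_⟩
  · ext D
    simp only [mem_ofPred_eq, hF.geo.mem_cpx]
    constructor
    · rintro ⟨hne, hdis, hD, -⟩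
      obtain ⟨B', hB', e⟩ := (h1 _).1 ⟨hD, Finset.subset_union_left⟩
      have : D = B' := by
        rw [← Finset.union_sdiff_cancel_left hdis, e,
          Finset.union_sdiff_cancel_left (hd.mono_right hB'.subset)]
      exact ⟨hne, this ▸ hB'⟩
    · rintro ⟨hne, hD⟩
      exact ⟨hne, hd.mono_right hD.subset, ((h1 _).2 ⟨D, hD, rfl⟩).1, hA.inl⟩
  · ext f
    simp only [mem_union, mem_sdiff, mem_ofPred_eq, hF.geo.mem_cpx, hF'.geo.mem_cpx]
    constructor
    · rintro ⟨hf, hne⟩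
      by_cases hBf : B ⊆ f
      · exact Or.inr ((h2 f).1 ⟨hf, hBf⟩)
      · have hAf : ¬ A ⊆ f := fun h => hAF' (hF'.geo.down _ hf _ h)
        exact Or.inl ⟨⟨(h3 f hAf hBf).2 hf, hne⟩, hAf⟩
    · rintro (⟨⟨hf, hne⟩, hAf⟩ | hf)
      · exact ⟨(h3 f hAf fun h => hBF (hF.geo.down _ hf _ h)).1 hf, hne⟩
      · have := (h2 f).2 hf
        exact ⟨this.1, hB.mono this.2⟩
  · ext x
    rw [hF.geo.mem_space_cpx, hF'.geo.mem_space_cpx, hF.cone_eq, hF'.cone_eq]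

lemma Tri.frontier_faces [FiniteDimensional ℝ E] (hF : Tri C B₀ F) {P : Set E}
    (hP : ∀ x, x ∈ P ↔ hom x ∈ C) :
    {s ∈ (cpx F).faces | convexHull ℝ (s : Set E) ⊆ frontier P} =
      {s | s.Nonempty ∧ ¬ Inn C s ∧ s ∈ B₀} := by
  ext f
  simp only [mem_ofPred_eq, hF.geo.mem_cpx]
  have key : ∀ hf : f ∈ F, f.Nonempty → (convexHull ℝ (f : Set E) ⊆ frontier P ↔ ¬ Inn C f) :=
    fun hf hne => by
      have := hF.geo.convexHull_subset_frontier_iff (by rwa [hF.cone_eq]) hf hne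
      rwa [hF.cone_eq] at this
  constructor
  · rintro ⟨⟨hf, hne⟩, h⟩
    have hi := (key hf hne).1 h
    exact ⟨hne, hi, (hF.bdry f hi).1 hf⟩
  · rintro ⟨hne, hi, hB⟩
    have hf := (hF.bdry f hi).2 hB
    exact ⟨⟨hf, hne⟩, (key hf hne).2 hi⟩

end GeoFlip

/-- Let `n ≤ 3`, let `P ⊂ ℝⁿ` be a compact flat polyhedron whose support is
an `n`-manifold with boundary, and let `K₁`, `K₂` be simplicial triangulations of `P` inducing
the same triangulation of `∂P`. Then `K₁` and `K₂` are related by a finite sequence of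
geometric bistellar moves, each keeping the boundary triangulation fixed (no derived
subdivisions needed). -/
theorem statement11 {n : ℕ} [NeZero n] (hn : n ≤ 3) (P : Set (Fin n → ℝ))
    (hPcompact : IsCompact P) (hPflat : (interior P).Nonempty)
    (hPmanifold : Nonempty (ChartedSpace (EuclideanHalfSpace n) P))
    (K₁ K₂ : Geometry.SimplicialComplex ℝ (Fin n → ℝ))
    (hK₁fin : K₁.faces.Finite) (hK₂fin : K₂.faces.Finite)
    (hK₁ : K₁.space = P) (hK₂ : K₂.space = P)
    (hbd : {s ∈ K₁.faces | convexHull ℝ (s : Set (Fin n → ℝ)) ⊆ frontier P} =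
           {s ∈ K₂.faces | convexHull ℝ (s : Set (Fin n → ℝ)) ⊆ frontier P}) :
    Relation.ReflTransGen
      (fun X Y => BistellarMove n X Y ∧
        {s ∈ X.faces | convexHull ℝ (s : Set (Fin n → ℝ)) ⊆ frontier P} =
          {s ∈ Y.faces | convexHull ℝ (s : Set (Fin n → ℝ)) ⊆ frontier P})
      K₁ K₂ := by
  open GeoFlip in
  have hg₁ := geo_fam K₁ hK₁fin
  have hg₂ := geo_fam K₂ hK₂fin
  have hP₁ : ∀ x, x ∈ P ↔ hom x ∈ cone (fam K₁ hK₁fin) := fun x => by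
    rw [← hg₁.mem_space_cpx, cpx_fam, hK₁]
  have hP₂ : ∀ x, x ∈ P ↔ hom x ∈ cone (fam K₂ hK₂fin) := fun x => by
    rw [← hg₂.mem_space_cpx, cpx_fam, hK₂]
  have hC : cone (fam K₂ hK₂fin) = cone (fam K₁ hK₁fin) :=
    (cone_subset_of_hom hg₁ fun x hx => (hP₁ x).1 ((hP₂ x).2 hx)).antisymm
      (cone_subset_of_hom hg₂ fun x hx => (hP₂ x).1 ((hP₁ x).2 hx))
  have htop : topCard (Fin n → ℝ) = n + 1 := by simp [topCard]
  have hT₁ : Tri (cone (fam K₁ hK₁fin))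
      ((fam K₁ hK₁fin).filter fun f => ¬ Inn (cone (fam K₁ hK₁fin)) f) (fam K₁ hK₁fin) :=
    ⟨hg₁, rfl, fun f hf => by simp [hf]⟩
  have hT₂ : Tri (cone (fam K₁ hK₁fin))
      ((fam K₁ hK₁fin).filter fun f => ¬ Inn (cone (fam K₁ hK₁fin)) f) (fam K₂ hK₂fin) := by
    refine ⟨hg₂, hC, fun f hf => ?_⟩
    rw [Finset.mem_filter, and_iff_left hf]
    rcases f.eq_empty_or_nonempty with rfl | hne
    · simp [hg₁.empty, hg₂.empty]
    have h := Set.ext_iff.1 hbd f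
    simp only [mem_ofPred_eq] at h
    rw [mem_fam, mem_fam]
    simp only [hne.ne_empty, false_or]
    constructor
    · intro h2
      refine (h.2 ⟨h2, (hg₂.convexHull_subset_frontier_iff hP₂ (mem_fam.2 (Or.inr h2)) hne).2 ?_⟩).1
      rwa [hC]
    · intro h1
      exact (h.1 ⟨h1, (hg₁.convexHull_subset_frontier_iff hP₁ (mem_fam.2 (Or.inr h1)) hne).2 hf⟩).1
  have hn0 := NeZero.pos n
  have := hT₁.conn (by omega) (by omega) hT₂
  rw [← cpx_fam K₁ hK₁fin, ← cpx_fam K₂ hK₂fin]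
  refine Relation.ReflTransGen.lift cpx ?_ _ _ this
  rintro X Y ⟨hX, hY, h⟩
  refine ⟨h.bistellarMove htop hX hY, ?_⟩
  rw [hX.frontier_faces hP₁, hY.frontier_faces hP₁]
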